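/- Let g be a simple Lie algebra. Then codim_C C^sing ≥ 5 − l, where l is the lacing number of g: l = 1 if g is of type A_r, D_r, E_6, E_7 or E_8; l = 2 if g is of type B_r, C_r or F_4; l = 3 if g is of type G_2. -/

import Mathlib

noncomputable section

namespace CV

variable (k : Type*) [Field k] (V : Type*) [AddCommGroup V] [Module k V] [FiniteDimensional k V]

/-- Coordinates with respect to a chosen basis of `V`. -/
def coordFn (z : V) (i : Module.Free.ChooseBasisIndex k V) : k :=
  (Module.Free.chooseBasis k V).repr z i

/-- Evaluation of a polynomial (in the chosen coordinates) at a point of `V`. -/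
def evalP (F : MvPolynomial (Module.Free.ChooseBasisIndex k V) k) (z : V) : k :=
  MvPolynomial.aeval (coordFn k V z) F

/-- The Zariski topology on `V`: generated by complements of zero sets of polynomial
functions. -/
def zar : TopologicalSpace V :=
  TopologicalSpace.generateFrom
    {U | ∃ F : MvPolynomial (Module.Free.ChooseBasisIndex k V) k, U = {z | evalP k V F z ≠ 0}}

/-- The dimension of a subset of `V`:  the Krull dimension for the topology induced by the
Zariski topology of `V`. -/
def dimSet (S : Set V) : WithBot ℕ∞ :=
  @topologicalKrullDim S (TopologicalSpace.induced Subtype.val (zar k V))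

/-- The differential at `z ∈ V` of a polynomial `F`, as a linear functional on `V`. -/
def diffAt (F : MvPolynomial (Module.Free.ChooseBasisIndex k V) k) (z : V) : V →ₗ[k] k :=
  (Module.Free.chooseBasis k V).constr k fun i => evalP k V (MvPolynomial.pderiv i F) z

/-- The Zariski tangent space at `z` of a subset `S ⊆ V`:  the common kernel of the
differentials at `z` of all polynomial functions vanishing identically on `S`. -/
def tangent (S : Set V) (z : V) : Submodule k V :=
  ⨅ F ∈ {F | ∀ w ∈ S, evalP k V F w = 0}, LinearMap.ker (diffAt k V F z)

end CV

/-- The commuting variety `C = {(x,y) ∈ g × g | [x,y] = 0}`. -/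
def commSet (k : Type*) (g : Type*) [Field k] [LieRing g] [LieAlgebra k g] : Set (g × g) :=
  {p | ⁅p.1, p.2⁆ = 0}

/-- The centralizer `g_x = {y ∈ g | [x,y] = 0}` of an element `x` of a Lie algebra,
as a submodule. -/
def cent (k : Type*) {g : Type*} [Field k] [LieRing g] [LieAlgebra k g] (x : g) :
    Submodule k g := LinearMap.ker (LieAlgebra.ad k g x)

variable (k : Type*) [Field k] [IsAlgClosed k] [CharZero k]
variable (g : Type*) [LieRing g] [LieAlgebra k g] [FiniteDimensional k g]

/-- The lacing number ("lacety") of a Lie algebra with nondegenerate Killing form, relative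
to a Cartan subalgebra `t`:  it is `1` if `rk g = 1`, and otherwise the maximum of the
absolute values of the Cartan integers `⟨α, β∨⟩ = α (coroot β)` over pairs of
non-proportional roots `α`, `β`.  (For a simple Lie algebra this equals `1` in types
`A`, `D`, `E`, `2` in types `B`, `C`, `F₄`, and `3` in type `G₂`.) -/
def lacety [LieAlgebra.IsKilling k g] (t : LieSubalgebra k g) [t.IsCartanSubalgebra] : ℕ :=
  if Module.finrank k ↥t = 1 then 1
  else sSup {n : ℕ | ∃ α β : LieModule.Weight k ↥t g, α.IsNonZero ∧ β.IsNonZero ∧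
    (∀ c : k, (α : ↥t → k) ≠ c • (β : ↥t → k)) ∧
    (α (LieAlgebra.IsKilling.coroot β) = (n : k) ∨ α (LieAlgebra.IsKilling.coroot β) = -(n : k))}

/-- The singular locus of the commuting variety:  points `z` of `C` at which the Zariski
tangent space has dimension strictly greater than `dim C = dim g + rk g`. -/
def Csing (t : LieSubalgebra k g) : Set (g × g) :=
  {z ∈ commSet k g |
    Module.finrank k g + Module.finrank k ↥t
      < Module.finrank k ↥(CV.tangent k (g × g) (commSet k g) z)}

section
universe u

theorem CVtrace_aux {K : Type*} [Field K] (d : K → K) (m : ℕ) :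
    ∀ (V : Type u) [AddCommGroup V] [Module K V] [FiniteDimensional K V]
    (A B C : V →ₗ[K] V) (D : V →+ V), Module.finrank K V ≤ m → IsNilpotent A → A ∘ₗ B = B ∘ₗ A →
    (∀ c v, D (c • v) = d c • v + c • D v) → (∀ v, D (B v) = B (D v) + C v) →
    LinearMap.trace K V (A ∘ₗ C) = 0 := by
  induction m with
  | zero =>
    intro V _ _ _ A B C D hV hA hAB hD hC
    have : A ∘ₗ C = 0 := by
      have := Module.finrank_zero_iff.mp (Nat.le_zero.mp hV)
      ext v; exact Subsingleton.elim _ _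
    rw [this, map_zero]
  | succ m ih =>
    intro V _ _ _ A B C D hV hA hAB hD hC
    have hAB' : ∀ v, A (B v) = B (A v) := fun v => LinearMap.congr_fun hAB v
    by_cases hA0 : LinearMap.ker A = ⊥
    · -- injective nilpotent: V trivial
      obtain ⟨N, hN⟩ := hA
      have hinj : Function.Injective A := LinearMap.ker_eq_bot.mp hA0
      have : ∀ v : V, v = 0 := by
        intro v
        have h1 : Function.Injective (A ^ N) := by
          rw [Module.End.coe_pow]; exact hinj.iterate N
        apply h1; simp [hN]
      have : A ∘ₗ C = 0 := by
        ext v; exact this _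
      rw [this, map_zero]
    · obtain ⟨W', hW'⟩ := (LinearMap.ker A).exists_isCompl
      set W := LinearMap.ker A
      let p : V →ₗ[K] W' := W'.projectionOnto W hW'.symm
      let i : W' →ₗ[K] V := W'.subtype
      have hpi : ∀ w, p (i w) = w := fun w => by simp [p, i]
      have hker : ∀ v, p v = 0 ↔ A v = 0 := fun v => by
        have : LinearMap.ker p = W := by simp [p]
        rw [← LinearMap.mem_ker, this]; rfl
      have hAip : ∀ v, A (i (p v)) = A v := by
        intro v
        have : p (v - i (p v)) = 0 := by simp [hpi]
        rw [hker, map_sub, sub_eq_zero] at this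
        exact this.symm
      have hpB : ∀ v, p (B (i (p v))) = p (B v) := by
        intro v
        have : p (B (v - i (p v))) = 0 := by
          rw [hker, hAB', map_sub, hAip, sub_self, map_zero]
        rw [map_sub, map_sub, sub_eq_zero] at this
        exact this.symm
      have hpA : ∀ v, p (A (i (p v))) = p (A v) := fun v => by rw [hAip]
      let Mf : V →ₗ[K] W' :=
        { toFun := fun v => p (D (v - i (p v)))
          map_add' := fun v w => by
            rw [← map_add, ← map_add]; congr 2; simp; abel
          map_smul' := fun c v => by
            have : c • v - i (p (c • v)) = c • (v - i (p v)) := by simp [smul_sub]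
            rw [this, hD]; simp [hpi] }
      let D1 : W' →+ W' := (p.toAddMonoidHom.comp D).comp i.toAddMonoidHom
      have hD1 : ∀ w, D1 w = p (D (i w)) := fun w => rfl
      let A1 := p ∘ₗ A ∘ₗ i
      let B1 := p ∘ₗ B ∘ₗ i
      let C1 := p ∘ₗ C ∘ₗ i - Mf ∘ₗ B ∘ₗ i
      have key := ih W' A1 B1 C1 D1 ?_ ?_ ?_ ?_ ?_
      · let N : V →ₗ[K] V := A ∘ₗ i ∘ₗ Mf
        have hN : ∀ v, N v = A (D (v - i (p v))) := fun v => hAip _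
        have e1 : A ∘ₗ C = A ∘ₗ C ∘ₗ i ∘ₗ p + (N ∘ₗ B - (N ∘ₗ B) ∘ₗ (i ∘ₗ p)) - B ∘ₗ N := by
          ext v
          simp only [LinearMap.sub_apply, LinearMap.add_apply, LinearMap.comp_apply, hN]
          have h1 := hC (v - i (p v))
          have h2 : p (B (v - i (p v))) = 0 := by rw [map_sub, map_sub, hpB, sub_self]
          have h3 : A (C v) = A (C (i (p v))) + A (C (v - i (p v))) := by
            rw [← map_add, ← map_add]; congr 2; abel
          rw [h3, add_sub_assoc]; congr 1
          have h4 : C (v - i (p v)) = D (B (v - i (p v))) - B (D (v - i (p v))) := by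
            rw [h1]; abel
          rw [h4, map_sub, hAB', hpB, ← map_sub, ← map_sub]
          congr 4
          rw [map_sub]; abel
        have e2 : A1 ∘ₗ C1 = p ∘ₗ (A ∘ₗ C ∘ₗ i) - p ∘ₗ (N ∘ₗ B ∘ₗ i) := by
          ext v
          simp only [A1, C1, N, LinearMap.sub_apply, LinearMap.comp_apply, map_sub, hAip]
        rw [e2, map_sub, LinearMap.trace_comp_comm', LinearMap.trace_comp_comm' (g := p)] at key
        rw [e1, map_sub, map_add, map_sub, LinearMap.trace_comp_comm' (f := B)]
        simp only [LinearMap.comp_assoc] at key ⊢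
        linear_combination key
      · have := Submodule.finrank_add_eq_of_isCompl hW'
        have h0 : 0 < Module.finrank K W := Module.finrank_pos_iff.mpr
          (Submodule.nontrivial_iff_ne_bot.mpr hA0)
        omega
      · obtain ⟨N, hN⟩ := hA
        refine ⟨N, ?_⟩
        have : ∀ n, ∀ w, (A1 ^ n) w = p ((A ^ n) (i w)) := by
          intro n; induction n with
          | zero => intro w; simp [hpi]
          | succ n ihn => intro w; rw [pow_succ', Module.End.mul_apply, ihn, pow_succ', Module.End.mul_apply]; simp only [A1, LinearMap.comp_apply]; rw [hpA]
        ext w; rw [this, hN]; simp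
      · ext w; simp only [A1, B1, LinearMap.comp_apply, hpA, hpB, hAip, hAB']
      · intro c v; rw [hD1, map_smul, hD, map_add, map_smul, map_smul, hpi, hD1]
      · intro v
        simp only [hD1, B1, C1, LinearMap.comp_apply, LinearMap.sub_apply]
        rw [hpB]
        have : Mf (B (i v)) = p (D (B (i v))) - p (D (i (p (B (i v))))) := by
          simp [Mf]
        rw [this, hC, map_add]; abel_nf

/-- trace lemma -/
theorem CVtrace {K V : Type*} [Field K] [AddCommGroup V] [Module K V] [FiniteDimensional K V]
    (d : K → K) (A B C : V →ₗ[K] V) (D : V →+ V) (hA : IsNilpotent A) (hAB : A ∘ₗ B = B ∘ₗ A)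
    (hD : ∀ c v, D (c • v) = d c • v + c • D v) (hC : ∀ v, D (B v) = B (D v) + C v) :
    LinearMap.trace K V (A ∘ₗ C) = 0 :=
  CVtrace_aux d _ V A B C D le_rfl hA hAB hD hC

end

section
open Module LieAlgebra

section
variable {K L : Type*} [Field K] [PerfectField K] [LieRing L] [LieAlgebra K L] [FiniteDimensional K L]
  

attribute [local instance] LieRing.ofAssociativeRing

theorem CVcenter [LieAlgebra.IsKilling K L] (a : L) (h : ∀ w : L, ⁅a, w⁆ = 0) : a = 0 := by
  have : a ∈ LieAlgebra.center K L := by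
    rw [LieModule.mem_maxTrivSubmodule]; intro x; rw [← lie_skew, h, neg_zero]
  rwa [LieAlgebra.center_eq_bot, LieSubmodule.mem_bot] at this

theorem CVjordan [LieAlgebra.IsKilling K L] (x : L) : ∃ s n : L, s + n = x ∧ (ad K L s).IsSemisimple ∧ IsNilpotent (ad K L n) ∧
    (∀ w : L, ⁅x, w⁆ = 0 → ⁅s, w⁆ = 0 ∧ ⁅n, w⁆ = 0) ∧
    ∀ (w : L) (c : K), ⁅x, w⁆ = c • w → ⁅s, w⁆ = c • w := by
  obtain ⟨N, hNa, S, hSa, hN, hS, hx⟩ := (ad K L x).exists_isNilpotent_isSemisimple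
  have hc : Commute N S :=
    Algebra.commute_of_mem_adjoin_singleton_of_commute hSa
      (Algebra.commute_of_mem_adjoin_self hNa).symm
  have h1 := LieAlgebra.ad_mem_adjoin_of_isSemisimple hc hN hS
  rw [← hx] at h1
  rw [Algebra.adjoin_singleton_eq_range_aeval] at h1
  obtain ⟨p, hp⟩ := h1
  replace hp : Polynomial.aeval (ad K (End K L) (ad K L x)) p = ad K (End K L) S := hp
  -- intertwining
  let f : L →ₗ[K] End K L := (ad K L : L →ₗ[K] End K L)
  have hf : Function.Injective f := by
    intro a b hab
    refine sub_eq_zero.mp (CVcenter (K := K) _ fun w => ?_)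
    have := LinearMap.congr_fun hab w
    rw [sub_lie, sub_eq_zero]; exact this
  have gen : ∀ (X : End K L) (Y : End K (End K L)), f ∘ₗ X = Y ∘ₗ f → ∀ q : Polynomial K,
      f ∘ₗ (Polynomial.aeval X q) = (Polynomial.aeval Y q) ∘ₗ f := by
    intro X Y h q
    induction q using Polynomial.induction_on' with
    | add a b ha hb => rw [map_add, map_add, LinearMap.comp_add, LinearMap.add_comp, ha, hb]
    | monomial n a =>
      rw [Polynomial.aeval_monomial, Polynomial.aeval_monomial]
      have : ∀ n, f ∘ₗ (X ^ n) = (Y ^ n) ∘ₗ f := by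
        intro n; induction n with
        | zero => rfl
        | succ n ih =>
          rw [pow_succ, pow_succ, Module.End.mul_eq_comp, Module.End.mul_eq_comp, ← LinearMap.comp_assoc, ih, LinearMap.comp_assoc, h, LinearMap.comp_assoc]
      ext v : 1
      have := LinearMap.congr_fun (this n) v
      simp only [LinearMap.comp_apply, Module.End.mul_apply, Module.algebraMap_end_apply, map_smul] at this ⊢
      rw [this]
  have hfx : f ∘ₗ (ad K L x) = (ad K (End K L) (ad K L x)) ∘ₗ f := by
    ext v : 1
    change ad K L ⁅x, v⁆ = ⁅ad K L x, ad K L v⁆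
    simp
  set P := Polynomial.aeval (ad K L x) p with hP
  have hfP : f ∘ₗ P = (ad K (End K L) S) ∘ₗ f := by rw [hP, gen _ _ hfx, hp]
  have hPS : P.IsSemisimple := by
    have hss := LieAlgebra.ad_isSemisimple_of_isSemisimple hS
    refine Module.End.isSemisimple_of_squarefree_aeval_eq_zero (p := minpoly K (ad K (End K L) S)) hss.minpoly_squarefree ?_
    ext v : 1
    apply hf
    have := LinearMap.congr_fun (gen _ _ hfP (minpoly K (ad K (End K L) S))) v
    rw [minpoly.aeval] at this
    simpa using this
  have hfN : f ∘ₗ (ad K L x - P) = (ad K (End K L) N) ∘ₗ f := by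
    rw [LinearMap.comp_sub, hfx, hfP, ← LinearMap.sub_comp, hx, map_add, add_sub_cancel_right]
  have hPN : IsNilpotent (ad K L x - P) := by
    obtain ⟨m, hm⟩ := LieAlgebra.ad_nilpotent_of_nilpotent (R := K) hN
    refine ⟨m, ?_⟩
    ext v : 1
    apply hf
    have := LinearMap.congr_fun (gen _ _ hfN (Polynomial.X ^ m)) v
    rw [map_pow, map_pow, Polynomial.aeval_X, Polynomial.aeval_X, hm] at this
    simpa using this
  have hcP : Commute (ad K L x - P) P := by
    have hb : Commute (ad K L x) P := by
      rw [hP]; exact ((Commute.all (Polynomial.X : Polynomial K) p).map (Polynomial.aeval (ad K L x))).symm.symm |> fun h => by simpa using h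
    exact hb.sub_left (Commute.refl P)
  obtain ⟨-, hPeq⟩ := Module.End.isNilpotent_isSemisimple_unique hPN hPS hN hS hcP hc (by rw [sub_add_cancel, hx])
  have hder : ∀ y, ad K L (S y) = ⁅S, ad K L y⁆ := by
    intro y
    have := LinearMap.congr_fun hfP y
    rw [hPeq] at this
    exact this
  have hleib : ∀ a b, S ⁅a, b⁆ = ⁅a, S b⁆ - ⁅b, S a⁆ := by
    intro a b
    have := LinearMap.congr_fun (hder a) b
    simp only [LieAlgebra.ad_apply, LieRing.of_associative_ring_bracket, LinearMap.sub_apply, Module.End.mul_apply] at this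
    rw [← lie_skew b, this]; abel
  let D : LieDerivation K L L := ⟨S, hleib⟩
  obtain ⟨s, hs⟩ := LieDerivation.IsKilling.exists_eq_ad D
  have hsS : ad K L s = S := by
    ext v
    have := congrArg (fun E : LieDerivation K L L => E v) hs
    simpa [D] using this
  have hnN : ad K L (x - s) = N := by rw [map_sub, hsS, hx, add_sub_cancel_right]
  refine ⟨s, x - s, by abel, by rw [hsS]; exact hS, by rw [hnN]; exact hN, ?_, ?_⟩
  swap
  · intro w c hw
    by_cases hw0 : w = 0
    · simp [hw0]
    have hev : Module.End.HasEigenvector (ad K L x) c w :=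
      ⟨Module.End.mem_eigenspace_iff.mpr hw, hw0⟩
    rw [Algebra.adjoin_singleton_eq_range_aeval] at hSa
    obtain ⟨q, hq⟩ := hSa
    replace hq : Polynomial.aeval (ad K L x) q = S := hq
    have h1 : S w = q.eval c • w := by rw [← hq]; exact Module.End.aeval_apply_of_hasEigenvector hev
    have h2 : N w = (c - q.eval c) • w := by
      have := LinearMap.congr_fun hx w
      rw [LinearMap.add_apply, h1] at this
      rw [sub_smul, ← hw]; exact eq_sub_of_add_eq this.symm
    have h3 : ∀ n, (N ^ n) w = (c - q.eval c) ^ n • w := by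
      intro n; induction n with
      | zero => simp
      | succ n ih => rw [pow_succ, Module.End.mul_apply, h2, map_smul, ih, smul_smul, pow_succ, mul_comm]
    obtain ⟨n, hn⟩ := hN
    have h4 := h3 n
    rw [hn, LinearMap.zero_apply, eq_comm, smul_eq_zero, or_iff_left hw0] at h4
    have h5 := sub_eq_zero.mp (eq_zero_of_pow_eq_zero h4)
    have : S w = ⁅s, w⁆ := by rw [← hsS]; rfl
    rw [← this, h1, ← h5]
  intro w hw
  have hcw : Commute (ad K L w) (ad K L x) := by
    rw [commute_iff_lie_eq, ← LieHom.map_lie, ← lie_skew, hw]; simp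
  have hcs : Commute (ad K L w) S := Algebra.commute_of_mem_adjoin_singleton_of_commute hSa hcw
  have : ⁅s, w⁆ = 0 := by
    apply hf
    rw [map_zero]
    change ad K L ⁅s, w⁆ = 0
    rw [LieHom.map_lie, hsS, ← commute_iff_lie_eq]; exact hcs.symm
  exact ⟨this, by rw [sub_lie, hw, this, sub_zero]⟩
end

end

section
open Module LieAlgebra

theorem CVdtrace {K V : Type*} [Field K] [AddCommGroup V] [Module K V] [FiniteDimensional K V]
    (d : Derivation ℤ K K) (B C : V →ₗ[K] V) (D : V →+ V)
    (hD : ∀ c v, D (c • v) = d c • v + c • D v) (hC : ∀ v, D (B v) = B (D v) + C v) :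
    LinearMap.trace K V C = d (LinearMap.trace K V B) := by
  classical
  let b := Module.finBasis K V
  let N : V →ₗ[K] V := b.constr K fun i => D (b i)
  have hN : ∀ i, N (b i) = D (b i) := fun i => by simp [N]
  let E : V →ₗ[K] V := b.constr K fun i => ∑ j, d (b.repr (B (b i)) j) • b j
  have hE : C = E + (N ∘ₗ B - B ∘ₗ N) := by
    apply b.ext
    intro i
    have h1 := hC (b i)
    have h2 : D (B (b i)) = E (b i) + N (B (b i)) := by
      have h3 : B (b i) = ∑ j, b.repr (B (b i)) j • b j := (b.sum_repr _).symm
      conv_lhs => rw [h3]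
      conv_rhs => rw [h3]
      simp only [E, Basis.constr_basis, map_sum, map_smul, hD, hN, Finset.sum_add_distrib]
    simp only [LinearMap.add_apply, LinearMap.sub_apply, LinearMap.comp_apply, hN]
    rw [← add_sub_assoc, ← h2, h1]; abel
  have h4 : LinearMap.trace K V E = d (LinearMap.trace K V B) := by
    rw [LinearMap.trace_eq_matrix_trace K b, LinearMap.trace_eq_matrix_trace K b B, Matrix.trace, Matrix.trace, map_sum]
    refine Finset.sum_congr rfl fun i _ => ?_
    simp [LinearMap.toMatrix_apply, E, Finsupp.single_apply]
  rw [hE, map_add, map_sub, LinearMap.trace_comp_comm', sub_self, add_zero, h4]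

section
variable (K : Type*) {L : Type*} [Field K] [LieRing L] [LieAlgebra K L]

/-- semilinear derivations -/
structure IsSD (D : L →+ L) : Prop where
  sl : ∃ d : Derivation ℤ K K, ∀ c v, D (c • v) = d c • v + c • D v
  lb : ∀ u v : L, D ⁅u, v⁆ = ⁅D u, v⁆ + ⁅u, D v⁆

variable {K}

theorem IsSD.ad_add {D : L →+ L} (h : IsSD K D) (u : L) : IsSD K (D + (ad K L u : L →ₗ[K] L).toAddMonoidHom) := by
  obtain ⟨⟨d, hd⟩, hl⟩ := h
  refine ⟨⟨d, fun c v => ?_⟩, fun a b => ?_⟩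
  · simp [hd, add_assoc]
  · simp [hl, lie_lie]; abel

theorem IsSD.ad (u : L) : IsSD K (ad K L u : L →ₗ[K] L).toAddMonoidHom :=
  ⟨⟨0, fun c v => by simp⟩, fun a b => by simp⟩

variable [FiniteDimensional K L]

theorem CVknil {a v : L} (ha : IsNilpotent (LieAlgebra.ad K L a)) (hv : ⁅a, v⁆ = 0) : killingForm K L a v = 0 := by
  rw [killingForm_apply_apply]
  have hc : Commute (LieAlgebra.ad K L a) (LieAlgebra.ad K L v) := by
    ext w; simp only [Module.End.mul_apply, ad_apply]; rw [leibniz_lie, hv]; simp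
  exact (LinearMap.isNilpotent_trace_of_isNilpotent (hc.isNilpotent_mul_right ha)).eq_zero

theorem CVkcomm (a b : L) : killingForm K L a b = killingForm K L b a := LieModule.traceForm_comm K L L a b

theorem CVkinv (a b c : L) : killingForm K L ⁅a, b⁆ c = killingForm K L a ⁅b, c⁆ :=
  LieModule.traceForm_apply_lie_apply K L L a b c

theorem IsSD.k1 {D : L →+ L} (h : IsSD K D) {a v : L} (ha : IsNilpotent (LieAlgebra.ad K L a)) (hv : ⁅a, v⁆ = 0) :
    killingForm K L a (D v) = 0 := by
  obtain ⟨⟨d, hd⟩, hl⟩ := h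
  rw [killingForm_apply_apply]
  refine CVtrace d _ (LieAlgebra.ad K L v) _ D ha ?_ hd (fun w => ?_)
  · ext w; simp only [LinearMap.comp_apply, ad_apply]; rw [leibniz_lie, hv]; simp
  · simp [hl]; abel

theorem IsSD.kd {D : L →+ L} (h : IsSD K D) : ∃ d : Derivation ℤ K K, ∀ a v,
    d (killingForm K L a v) = killingForm K L (D a) v + killingForm K L a (D v) := by
  obtain ⟨⟨d, hd⟩, hl⟩ := h
  refine ⟨d, fun a v => ?_⟩
  simp only [killingForm_apply_apply]
  rw [← map_add]; symm
  refine CVdtrace d _ _ D hd fun w => ?_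
  simp only [LinearMap.comp_apply, LinearMap.add_apply, ad_apply, hl, lie_add]; abel

theorem IsSD.k2 {D : L →+ L} (h : IsSD K D) {a v : L} (ha : IsNilpotent (LieAlgebra.ad K L a)) (hv : ⁅a, v⁆ = 0) :
    killingForm K L (D a) v = 0 := by
  obtain ⟨d, hd⟩ := h.kd
  have := hd a v
  rw [CVknil ha hv, h.k1 ha hv, map_zero] at this
  simpa using this.symm
end

end

section
open Module LieAlgebra

section endo
variable {K V : Type*} [Field K] [CharZero K] [AddCommGroup V] [Module K V] [FiniteDimensional K V]

attribute [local instance] LieRing.ofAssociativeRing in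
theorem CVcommNil (E U C : End K V) (hE : IsNilpotent E) (h1 : E * U = U * E + C) (h2 : E * C = C * E) :
    IsNilpotent C := by
  let δ : End K V → End K V := fun X => E * X - X * E
  have hδ : ∀ X Y, δ (X * Y) = δ X * Y + X * δ Y := fun X Y => by simp only [δ]; noncomm_ring
  have hU : δ U = C := by simp only [δ]; rw [h1]; abel
  have hCX : ∀ X, δ (C * X) = C * δ X := fun X => by
    rw [hδ]; have : δ C = 0 := by simp only [δ]; rw [h2, sub_self]
    rw [this]; simp
  have hadd : ∀ X Y, δ (X + Y) = δ X + δ Y := fun X Y => by simp only [δ]; noncomm_ring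
  have hns : ∀ (n : ℕ) X, δ (n • X) = n • δ X := fun n X => by simp only [δ]; rw [mul_smul_comm, smul_mul_assoc, smul_sub]
  have key : ∀ m X, δ^[m+1] (U * X) = U * δ^[m+1] X + (m+1) • (C * δ^[m] X) := by
    intro m; induction m with
    | zero => intro X; simp [hδ, hU]; abel
    | succ m ih =>
      intro X
      rw [Function.iterate_succ_apply' δ (m+1), ih, hadd, hδ, hU, hns, hCX, Function.iterate_succ_apply' δ (m+1) X, Function.iterate_succ_apply' δ m X]
      simp only [add_smul, one_smul]; abel
  have key2 : ∀ m, δ^[m] (U ^ m) = m.factorial • C ^ m ∧ δ^[m+1] (U^m) = 0 := by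
    intro m; induction m with
    | zero => simp [δ]
    | succ m ih =>
      constructor
      · rw [pow_succ', key, ih.2, ih.1, Nat.factorial_succ, pow_succ']; simp only [mul_zero, zero_add, mul_smul, mul_smul_comm]
      · rw [pow_succ', key (m+1), ih.2, Function.iterate_succ_apply', ih.2]; simp [δ]
  obtain ⟨N, hN⟩ := LieAlgebra.ad_nilpotent_of_nilpotent (R := K) hE
  have h3 : ∀ m A, δ^[m] A = ((ad K (End K V) E)^m) A := by
    intro m A; induction m with
    | zero => simp
    | succ m ih => rw [Function.iterate_succ_apply', ih, pow_succ' , Module.End.mul_apply]; rfl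
  refine ⟨N, ?_⟩
  have h4 := (key2 N).1
  rw [h3, hN, LinearMap.zero_apply, eq_comm, ← Nat.cast_smul_eq_nsmul K, smul_eq_zero] at h4
  exact h4.resolve_left (by exact_mod_cast N.factorial_ne_zero)

theorem CVtrEU (E U C : End K V) (hE : IsNilpotent E) (h1 : E * U = U * E + C) (h2 : E * C = C * E) :
    LinearMap.trace K V (E * U) = 0 := by
  obtain ⟨M, hM⟩ := CVcommNil E U C hE h1 h2
  have hEU : ∀ i, E ^ (i+1) * U = U * E ^ (i+1) + (i+1) • (C * E ^ i) := by
    intro i; induction i with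
    | zero => simpa using h1
    | succ i ih =>
      rw [pow_succ' E (i+1), mul_assoc, ih, mul_add, ← mul_assoc, h1, mul_smul_comm, ← mul_assoc, h2]
      simp only [add_smul, one_smul, pow_succ' E, add_mul, mul_assoc]
      abel
  -- on ker E^(i+1)
  have hst : ∀ i v, (E ^ (i+1)) v = 0 → ∀ m, (E ^ (i+1)) (((E * U) ^ m) v) = 0 ∧
      (E ^ i) (((E * U)^m) v) = ((i+1:ℕ):K)^m • (C ^ m) ((E ^ i) v) := by
    intro i v hv m
    induction m with
    | zero => simp [hv]
    | succ m ih =>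
      set w := ((E * U) ^ m) v with hw
      have e1 : ((E*U)^(m+1)) v = E (U w) := by rw [pow_succ', Module.End.mul_apply]; rfl
      have e2 : (E ^ i) (E (U w)) = (i+1) • C ((E^i) w) := by
        have := LinearMap.congr_fun (hEU i) w
        simp only [LinearMap.add_apply, Module.End.mul_apply, ih.1, LinearMap.smul_apply, map_zero, zero_add] at this
        rw [pow_succ, Module.End.mul_apply] at this
        exact this
      have hCi : ∀ u, E (C u) = C (E u) := fun u => LinearMap.congr_fun h2 u
      rw [e1]
      constructor
      · rw [pow_succ', Module.End.mul_apply, e2, map_nsmul, hCi, ← Module.End.mul_apply E, ← pow_succ', ih.1]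
        simp
      · rw [e2, ih.2, map_smul, pow_succ' C, Module.End.mul_apply, ← Nat.cast_smul_eq_nsmul K, smul_smul, pow_succ']
  have hnil : ∀ i v, (E ^ i) v = 0 → ((E*U)^(M*i)) v = 0 := by
    intro i; induction i with
    | zero => intro v hv; simpa using hv
    | succ i ih =>
      intro v hv
      rw [mul_add, mul_one, pow_add, Module.End.mul_apply]
      apply ih
      rw [(hst i v hv M).2, hM]; simp
  obtain ⟨N, hN⟩ := hE
  refine (LinearMap.isNilpotent_trace_of_isNilpotent ⟨M*N, ?_⟩).eq_zero
  ext v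
  exact hnil N v (by rw [hN]; rfl)

/-- representation identities -/
theorem CVsl2prod (E Z H : End K V) (N : ℕ) (hN : E ^ N = 0) (h1 : E * Z = Z * E + H) (h2 : H * E = E * H + 2 • E)
    (w : V) (μ : K) (hw0 : w ≠ 0) (hμ : H w = μ • w) (hw : E w = 0) :
    (∃ n : ℕ, μ = n) ∧ ((∃ u, w = E u) → ∃ n : ℕ, 1 ≤ n ∧ μ = n) := by
  have hm : ∀ m : ℕ, E ^ (m+1) * Z = Z * E ^ (m+1) + (m+1) • ((H - (m:K) • 1) * E ^ m) := by
    intro m; induction m with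
    | zero => simpa using h1
    | succ m ih =>
      have hEH : E * H = H * E - 2 • E := by rw [h2]; abel
      rw [pow_succ' E (m+1), mul_assoc, ih, mul_add, ← mul_assoc, h1, mul_smul_comm, ← mul_assoc, mul_sub, hEH]
      rw [← Nat.cast_smul_eq_nsmul K, ← Nat.cast_smul_eq_nsmul K, ← Nat.cast_smul_eq_nsmul K, pow_succ' E m]
      push_cast
      simp only [add_mul, sub_mul, smul_sub, smul_mul_assoc, mul_smul_comm, one_mul, mul_one, smul_smul, ← mul_assoc, add_smul, mul_add, sub_smul]
      module
  have hpr : ∀ (j i : ℕ) (v : V), E v = 0 → (∃ u, v = (E ^ i) u) → N ≤ i + j → H v = μ • v → v ≠ 0 →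
      ∃ n : ℕ, i ≤ n ∧ μ = n := by
    intro j; induction j with
    | zero =>
      rintro i v hv ⟨u, rfl⟩ hNi hμ hv0
      exact absurd (by rw [pow_eq_zero_of_le (by omega) hN]; rfl) hv0
    | succ j ih =>
      rintro i v hv ⟨u, hu⟩ hNi hμ hv0
      by_cases hi : μ = i
      · exact ⟨i, le_rfl, hi⟩
      have hEu : (E ^ (i+1)) u = 0 := by rw [pow_succ', Module.End.mul_apply, ← hu, hv]
      have h3 := LinearMap.congr_fun (hm i) u
      simp only [LinearMap.add_apply, Module.End.mul_apply, hEu, map_zero, zero_add, LinearMap.smul_apply, LinearMap.sub_apply, Module.End.one_apply, ← hu, hμ] at h3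
      rw [← sub_smul, ← Nat.cast_smul_eq_nsmul K, smul_smul] at h3
      obtain ⟨n, hn, hn'⟩ := ih (i+1) v hv ⟨((((i+1:ℕ):K) * (μ - i))⁻¹) • Z u, by
        rw [map_smul, h3, smul_smul, inv_mul_cancel₀, one_smul]
        exact mul_ne_zero (by exact_mod_cast i.succ_ne_zero) (sub_ne_zero.mpr hi)⟩ (by omega) hμ hv0
      exact ⟨n, by omega, hn'⟩
  refine ⟨?_, fun ⟨u, hu⟩ => hpr N 1 w hw ⟨u, by simpa using hu⟩ (by omega) hμ hw0⟩
  obtain ⟨n, -, h⟩ := hpr N 0 w hw ⟨w, rfl⟩ (by omega) hμ hw0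
  exact ⟨n, h⟩
end endo

end

section
open Module LieAlgebra

section
variable {K L : Type*} [Field K] [LieRing L] [LieAlgebra K L] [FiniteDimensional K L]

theorem CVss_kr {V : Type*} [AddCommGroup V] [Module K V] [FiniteDimensional K V] {f : End K V} (hf : f.IsSemisimple) {w : V} (h : f (f w) = 0) : f w = 0 := by
  have h1 := hf.isFinitelySemisimple.genEigenspace_eq_eigenspace 0 (k := 2) (by norm_num)
  have h2 : w ∈ f.genEigenspace 0 2 := by
    have : (2 : ℕ∞) = ((2:ℕ) : ℕ∞) := rfl
    rw [this, Module.End.mem_genEigenspace_nat]; simp [pow_two, h]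
  rw [h1, Module.End.mem_eigenspace_iff] at h2
  simpa using h2

theorem CVproj {s : L} (hs : (ad K L s).IsSemisimple) : ∃ P : L →ₗ[K] L, (∀ v, ⁅s, P v⁆ = 0) ∧
    (∀ v, ∃ w, v - P v = ⁅s, w⁆) ∧ (∀ u : L, ⁅s, u⁆ = 0 → ∀ v : L, P ⁅u, v⁆ = ⁅u, P v⁆) ∧ (∀ v, ⁅s, v⁆ = 0 → P v = v) := by
  set A := ad K L s
  have hdis : Disjoint (LinearMap.ker A) (LinearMap.range A) := by
    rw [Submodule.disjoint_def]
    rintro x hx ⟨w, rfl⟩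
    exact CVss_kr hs hx
  have hc : IsCompl (LinearMap.ker A) (LinearMap.range A) := by
    refine ⟨hdis, codisjoint_iff.mpr ?_⟩
    apply Submodule.eq_top_of_finrank_eq
    have h1 := Submodule.finrank_sup_add_finrank_inf_eq (LinearMap.ker A) (LinearMap.range A)
    rw [hdis.eq_bot, finrank_bot] at h1
    have := LinearMap.finrank_range_add_finrank_ker A
    omega
  have hmem : ∀ v, v ∈ LinearMap.ker A ↔ ⁅s, v⁆ = 0 := fun v => Iff.rfl
  let P := (LinearMap.ker A).subtype ∘ₗ (LinearMap.ker A).projectionOnto _ hc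
  have hP1 : ∀ v, ⁅s, P v⁆ = 0 := fun v => ((LinearMap.ker A).projectionOnto _ hc v).2
  have hP4 : ∀ v, ⁅s, v⁆ = 0 → P v = v := fun v hv => by
    have := Submodule.projectionOnto_apply_left hc ⟨v, hv⟩
    exact congrArg Subtype.val this
  have hP5 : ∀ w, P ⁅s, w⁆ = 0 := fun w => by
    have : (LinearMap.ker A).projectionOnto _ hc ⁅s, w⁆ = 0 := by
      rw [Submodule.projectionOnto_apply_eq_zero_iff]; exact ⟨w, rfl⟩
    exact congrArg Subtype.val this
  have hP2 : ∀ v, ∃ w, v - P v = ⁅s, w⁆ := fun v => by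
    have h0 : v ∈ LinearMap.ker A ⊔ LinearMap.range A := by rw [hc.sup_eq_top]; trivial
    obtain ⟨a, ha, b, ⟨w, hw⟩, hab⟩ := Submodule.mem_sup.mp h0
    refine ⟨w, ?_⟩
    have hw' : b = ⁅s, w⁆ := hw.symm
    rw [← hab, map_add, hP4 a ha, hw', hP5]; abel
  refine ⟨P, hP1, hP2, fun u hu v => ?_, hP4⟩
  obtain ⟨w, hw⟩ := hP2 v
  have : ⁅u, v⁆ = ⁅u, P v⁆ + ⁅s, ⁅u, w⁆⁆ := by
    rw [leibniz_lie s u w, hu, zero_lie, zero_add, ← hw, lie_sub]; abel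
  rw [this, map_add, hP5, add_zero, hP4]
  rw [leibniz_lie, hu, hP1]; simp

variable [IsKilling K L]

theorem CVknd (a : L) (h : ∀ v, killingForm K L a v = 0) : a = 0 := by
  have := LieAlgebra.IsKilling.ker_killingForm_eq_bot K L
  rw [LinearMap.ker_eq_bot'] at this
  exact this a (LinearMap.ext h)

/-- every functional is represented by the Killing form -/
theorem CVkrep (f : L →ₗ[K] K) : ∃ a, ∀ v, f v = killingForm K L a v := by
  have hinj : Function.Injective (killingForm K L) := by
    rw [← LinearMap.ker_eq_bot]; exact LieAlgebra.IsKilling.ker_killingForm_eq_bot K L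
  have hsur : Function.Surjective (killingForm K L) := by
    apply (LinearMap.injective_iff_surjective_of_finrank_eq_finrank _).mp hinj
    exact (Subspace.dual_finrank_eq).symm
  obtain ⟨a, ha⟩ := hsur f
  exact ⟨a, fun v => by rw [ha]⟩

/-- double-perp for the killing form -/
theorem CVkperp (W : Submodule K L) (a : L) (h : ∀ u, (∀ w ∈ W, killingForm K L u w = 0) → killingForm K L u a = 0) : a ∈ W := by
  by_contra ha
  obtain ⟨f, hfa, hf⟩ := Submodule.exists_le_ker_of_notMem ha
  obtain ⟨u, hu⟩ := CVkrep f
  exact hfa ((hu a).trans (h u fun w hw => (hu w).symm.trans (hf hw)))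

theorem CVim_perp (e a : L) (h : ∀ u, ⁅e, u⁆ = 0 → killingForm K L u a = 0) : ∃ w, a = ⁅e, w⁆ := by
  have : a ∈ LinearMap.range (ad K L e) := by
    apply CVkperp
    intro u hu
    apply h
    apply CVknd (K := K)
    intro v
    have := hu ⁅e, v⁆ ⟨v, rfl⟩
    rw [← CVkinv] at this
    rw [← lie_skew, map_neg, LinearMap.neg_apply, this, neg_zero]
  obtain ⟨w, hw⟩ := this
  exact ⟨w, hw.symm⟩

variable [CharZero K]

theorem CVJM0 (e : L) (he : IsNilpotent (ad K L e)) : ∃ z, ⁅e, ⁅e, z⁆⁆ = (-2 : K) • e := by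
  have : (-2 : K) • e ∈ LinearMap.range (ad K L e ∘ₗ ad K L e) := by
    apply CVkperp
    intro u hu
    have hu' : ⁅e, ⁅e, u⁆⁆ = 0 := by
      apply CVknd (K := K)
      intro v
      have := hu ⁅e, ⁅e, v⁆⁆ ⟨v, rfl⟩
      rw [← CVkinv, ← CVkinv] at this
      rw [← lie_skew e ⁅e, u⁆, ← lie_skew e u, neg_lie, neg_neg]
      exact this
    rw [map_smul, CVkcomm, killingForm_apply_apply]
    have := CVtrEU (ad K L e) (ad K L u) (ad K L ⁅e, u⁆) he (by ext v; simp) (by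
      ext v; simp only [Module.End.mul_apply, ad_apply]; rw [leibniz_lie, hu']; simp)
    rw [Module.End.mul_eq_comp] at this
    rw [this, smul_zero]
  obtain ⟨z, hz⟩ := this
  exact ⟨z, hz⟩

theorem CVJM (e a b c : L) (he : IsNilpotent (ad K L e)) (ha : (ad K L a).IsSemisimple) (hb : (ad K L b).IsSemisimple)
    (hc : (ad K L c).IsSemisimple) (hae : ⁅a, e⁆ = 0) (hbe : ⁅b, e⁆ = 0) (hce : ⁅c, e⁆ = 0) (hab : ⁅a, b⁆ = 0) (hac : ⁅a, c⁆ = 0)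
    (hbc : ⁅b, c⁆ = 0) : ∃ h : L, (ad K L h).IsSemisimple ∧ ⁅h, e⁆ = (2 : K) • e ∧ ⁅a, h⁆ = 0 ∧ ⁅b, h⁆ = 0 ∧ ⁅c, h⁆ = 0 ∧
    (∀ (v : L) (μ : K), v ≠ 0 → ⁅h, v⁆ = μ • v → (∃ n : ℤ, μ = n)) ∧
    (∀ (v : L) (μ : K), v ≠ 0 → ⁅h, v⁆ = μ • v → ⁅e, v⁆ = 0 → (∃ n : ℕ, μ = n) ∧ ((∃ u, v = ⁅e, u⁆) → ∃ n : ℕ, 1 ≤ n ∧ μ = n)) := by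
  obtain ⟨z0, hz0⟩ := CVJM0 (K := K) e he
  obtain ⟨Pa, a1, a2, a3, a4⟩ := CVproj ha
  obtain ⟨Pb, b1, b2, b3, b4⟩ := CVproj hb
  obtain ⟨Pc, c1, c2, c3, c4⟩ := CVproj hc
  set z := Pa (Pb (Pc z0)) with hz
  have hba : ⁅b, a⁆ = 0 := by rw [← lie_skew, hab, neg_zero]
  have hca : ⁅c, a⁆ = 0 := by rw [← lie_skew, hac, neg_zero]
  have hcb : ⁅c, b⁆ = 0 := by rw [← lie_skew, hbc, neg_zero]
  have hza : ⁅a, z⁆ = 0 := a1 _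
  have hzb : ⁅b, z⁆ = 0 := by rw [hz, ← a3 b hab, b1, map_zero]
  have hzc : ⁅c, z⁆ = 0 := by rw [hz, ← a3 c hac, ← b3 c hbc, c1, map_zero, map_zero]
  have hz2 : ⁅e, ⁅e, z⁆⁆ = (-2 : K) • e := by
    rw [hz, ← a3 e hae, ← a3 e hae, ← b3 e hbe, ← b3 e hbe, ← c3 e hce, ← c3 e hce, hz0]
    simp only [map_smul, c4 e hce, b4 e hbe, a4 e hae]
  set h0 := ⁅e, z⁆ with hh0
  have h0e : ⁅h0, e⁆ = (2 : K) • e := by rw [← lie_skew, hz2, neg_smul, neg_neg]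
  have comm0 : ∀ x : L, ⁅x, e⁆ = 0 → ⁅x, z⁆ = 0 → ⁅h0, x⁆ = 0 := fun x h1 h2 => by
    rw [← lie_skew, hh0, leibniz_lie, h1, h2]; simp
  have : PerfectField K := inferInstance
  obtain ⟨h, n, hhn, hs, hn, hcm, hev⟩ := CVjordan (K := K) h0
  have hhe := hev e 2 h0e
  have hne : ⁅n, e⁆ = 0 := by
    have : ⁅h + n, e⁆ = (2:K) • e := by rw [hhn, h0e]
    rw [add_lie, hhe] at this
    simpa using this
  have hhn' : ⁅h, n⁆ = 0 := by
    have h1 := (hcm h0 (lie_self _)).1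
    rw [← hhn, lie_add, lie_self, zero_add] at h1
    exact h1
  have main : ∀ (v : L) (μ : K), v ≠ 0 → ⁅h, v⁆ = μ • v → ⁅e, v⁆ = 0 → (∃ n : ℕ, μ = n) ∧ ((∃ u, v = ⁅e, u⁆) → ∃ n : ℕ, 1 ≤ n ∧ μ = n) := by
    intro v μ hv0 hv hev
    obtain ⟨M, hM⟩ := hn
    have hex : ∃ j, ((ad K L n) ^ j) v = 0 := ⟨M, by rw [hM]; rfl⟩
    classical
    have hj := Nat.find_spec hex
    have hj0 : Nat.find hex ≠ 0 := by
      intro h0; rw [h0] at hj; exact hv0 (by simpa using hj)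
    obtain ⟨j, hjj⟩ := Nat.exists_eq_succ_of_ne_zero hj0
    have hjm := Nat.find_min hex (m := j) (by omega)
    rw [hjj, Nat.succ_eq_add_one, pow_succ', Module.End.mul_apply] at hj
    set w := ((ad K L n) ^ j) v with hw
    have hcom : ∀ (y u : L), ⁅n, y⁆ = 0 → ⁅y, ((ad K L n) ^ j) u⁆ = ((ad K L n) ^ j) ⁅y, u⁆ := by
      intro y u hy
      have : Commute (ad K L y) (ad K L n) := by
        ext q; simp only [Module.End.mul_apply, ad_apply]; rw [leibniz_lie n, hy]; simp
      exact LinearMap.congr_fun (this.pow_right j) u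
    have hnh : ⁅n, h⁆ = 0 := by rw [← lie_skew, hhn', neg_zero]
    have hw1 : ⁅h, w⁆ = μ • w := by rw [hw, hcom h v hnh, hv, map_smul]
    have hw2 : ⁅h0, w⁆ = μ • w := by
      rw [← hhn, add_lie, hw1]; simpa using hj
    have hw3 : ⁅e, w⁆ = 0 := by rw [hw, hcom e v hne, hev, map_zero]
    obtain ⟨N, hN⟩ := he
    have := CVsl2prod (ad K L e) (ad K L z) (ad K L h0) N hN (by ext v; simp [hh0]) (by
      ext v
      simp only [Module.End.mul_apply, ad_apply, LinearMap.add_apply, LinearMap.smul_apply]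
      rw [leibniz_lie, h0e, smul_lie, ← Nat.cast_smul_eq_nsmul K]; push_cast; abel) w μ hjm hw2 hw3
    refine ⟨this.1, fun ⟨u, hu⟩ => this.2 ⟨((ad K L n) ^ j) u, ?_⟩⟩
    rw [hw, hu, ← hcom e u hne]; rfl
  refine ⟨h, hs, hhe, ?_, ?_, ?_, ?_, main⟩
  · rw [← lie_skew, (hcm a (comm0 a hae hza)).1, neg_zero]
  · rw [← lie_skew, (hcm b (comm0 b hbe hzb)).1, neg_zero]
  · rw [← lie_skew, (hcm c (comm0 c hce hzc)).1, neg_zero]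
  · intro v μ hv0 hv
    obtain ⟨N, hN⟩ := he
    have hex : ∃ j, ((ad K L e) ^ j) v = 0 := ⟨N, by rw [hN]; rfl⟩
    classical
    have hj := Nat.find_spec hex
    have hj0 : Nat.find hex ≠ 0 := by
      intro h0; rw [h0] at hj; exact hv0 (by simpa using hj)
    obtain ⟨j, hjj⟩ := Nat.exists_eq_succ_of_ne_zero hj0
    have hjm := Nat.find_min hex (m := j) (by omega)
    rw [hjj, Nat.succ_eq_add_one, pow_succ', Module.End.mul_apply] at hj
    have hlev : ∀ j : ℕ, ⁅h, ((ad K L e) ^ j) v⁆ = (μ + 2 * j) • ((ad K L e) ^ j) v := by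
      intro j; induction j with
      | zero => simpa using hv
      | succ j ih =>
        rw [pow_succ', Module.End.mul_apply, ad_apply, leibniz_lie, hhe, ih, lie_smul, smul_lie, ← add_smul]
        congr 1; push_cast; ring
    obtain ⟨⟨n, hn⟩, -⟩ := main _ _ hjm (hlev j) hj
    refine ⟨(n:ℤ) - 2 * j, ?_⟩
    push_cast; rw [← hn]; ring
end

end

section
open Module LieAlgebra

/-- Elementary root data. -/
structure RD (K L : Type*) [Field K] [LieRing L] [LieAlgebra K L] [FiniteDimensional K L] (R : Type*) [Fintype R] where
  H : Submodule K L
  t : R → L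
  rv : R → L
  neg : R → R
  p : R → R → ℤ
  tH : ∀ α, t α ∈ H
  Hab : ∀ a ∈ H, ∀ b ∈ H, ⁅a, b⁆ = 0
  rv_ne : ∀ α, rv α ≠ 0
  rv_eig : ∀ α, ∀ h ∈ H, ⁅h, rv α⁆ = killingForm K L (t α) h • rv α
  dec : ∀ v : L, ∃ h ∈ H, ∃ c : R → K, v = h + ∑ α, c α • rv α
  tinj : ∀ α β, t α = t β → α = β
  tne : ∀ α, t α ≠ 0
  tneg : ∀ α, t (neg α) = - t α
  hzero : ∀ h ∈ H, (∀ α, killingForm K L (t α) h = 0) → h = 0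
  pq : ∀ α β, 2 * killingForm K L (t α) (t β) = p α β * killingForm K L (t β) (t β)
  rat : ∀ β, ∃ q : ℚ, 0 < q ∧ killingForm K L (t β) (t β) = q
  refl : ∀ α β, ∃ γ, t γ = t α - p α β • t β
  str : ∀ α β (n i : ℤ), p α β ≤ -n → 0 ≤ i → i ≤ n → t α + i • t β ≠ 0 → ∃ γ, t γ = t α + i • t β
  red : ∀ α β (c : K), t α = c • t β → c = 1 ∨ c = -1
  br : ∀ α γ, p γ α < 0 → ⁅rv α, rv γ⁆ ≠ 0
  brn : ∀ α, ∃ c : K, c ≠ 0 ∧ ⁅rv α, rv (neg α)⁆ = c • t α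

section
variable {K L : Type*} [Field K] [IsAlgClosed K] [CharZero K] [LieRing L] [LieAlgebra K L] [FiniteDimensional K L] [IsKilling K L]

open LieModule LieAlgebra.IsKilling

variable (H : LieSubalgebra K L) [H.IsCartanSubalgebra]

theorem CVa_k (α : Weight K H L) (h : H) : killingForm K L ((cartanEquivDual H).symm α.toLinear : H) h = α h := by
  have : cartanEquivDual H ((cartanEquivDual H).symm α.toLinear) h = α h := by
    rw [LinearEquiv.apply_symm_apply, Weight.toLinear_apply]
  rw [← this]
  rw [cartanEquivDual_apply_apply]
  rfl

theorem CVpp (α β : Weight K H L) (hβ : β.IsNonZero) : 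
   2 * α ((cartanEquivDual H).symm β.toLinear) = ((chainBotCoeff β α - chainTopCoeff β α : ℤ) : K) * β ((cartanEquivDual H).symm β.toLinear) := by
  rw [← apply_coroot_eq_cast, coroot]
  have := root_apply_cartanEquivDual_symm_ne_zero hβ
  have h1 : ∀ (c : K) (h : H), α (c • h) = c * α h := fun c h => (α.toLinear).map_smul c h
  have h2 : ∀ (h : H), α (2 • h) = 2 * α h := fun h => by
    have := map_nsmul (α.toLinear) 2 h
    simpa using! this
  rw [h2, h1]
  field_simp

omit [IsAlgClosed K] [CharZero K] [LieRing L] [LieAlgebra K L] [FiniteDimensional K L] [IsKilling K L] [H.IsCartanSubalgebra] in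
theorem CVgensup {K V ι κ : Type*} [Field K] [AddCommGroup V] [Module K V] [Fintype ι] (W : Submodule K V) (N : ι → Submodule K V)
    (M : κ → Submodule K V) (hM : ∀ j, M j ≤ W ∨ ∃ i, M j ≤ N i) (ht : ⨆ j, M j = ⊤) (v : V) :
    ∃ h ∈ W, ∃ c : ι → V, (∀ i, c i ∈ N i) ∧ v = h + ∑ i, c i := by
  have h1 : ⨆ j, M j ≤ W ⊔ ⨆ i, N i := by
    refine iSup_le fun j => ?_
    rcases hM j with h | ⟨i, h⟩
    · exact h.trans le_sup_left
    · exact (h.trans (le_iSup N i)).trans le_sup_right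
  rw [ht] at h1
  obtain ⟨h, hh, u, hu, rfl⟩ := Submodule.mem_sup.1 (h1 (Submodule.mem_top (x := v)))
  obtain ⟨f, hf, rfl⟩ := (Submodule.mem_iSup_iff_exists_finsupp N u).1 hu
  refine ⟨h, hh, f, hf, ?_⟩
  rw [Finsupp.sum_fintype]
  simp

theorem CVtopd (v : L) : ∃ h ∈ H, ∃ c : H.root → L, (∀ α, c α ∈ rootSpace H α.1) ∧ v = h + ∑ α, c α := by
  have h := LieModule.iSup_genWeightSpace_eq_top' K H L
  have h' := congrArg LieSubmodule.toSubmodule h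
  rw [LieSubmodule.iSup_toSubmodule, LieSubmodule.top_toSubmodule] at h'
  refine CVgensup H.toSubmodule (fun α : H.root => (rootSpace H α.1).toSubmodule) _ ?_ h' v
  intro χ
  by_cases hχ : χ.IsZero
  · left
    intro x hx
    have : (χ : H → K) = 0 := hχ
    have hx' : x ∈ rootSpace H χ := hx
    rw [this] at hx'
    simpa using hx'
  · right
    exact ⟨⟨χ, by simpa [LieSubalgebra.root] using hχ⟩, le_rfl⟩

theorem CVrat (β : H.root) : ∃ q : ℚ, 0 < q ∧ killingForm K L ((cartanEquivDual H).symm β.1.toLinear : H) ((cartanEquivDual H).symm β.1.toLinear : H) = q := by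
  set b := (cartanEquivDual H).symm β.1.toLinear
  have hβ : β.1.IsNonZero := H.isNonZero_coe_root β
  have h0 := root_apply_cartanEquivDual_symm_ne_zero hβ
  change β.1 b ≠ 0 at h0
  have h1 : killingForm K L b b = β.1 b := CVa_k H β.1 b
  have h2 := congrArg (fun f => f b b) (restrict_killingForm_eq_sum (H := H) (K := K) (L := L))
  simp only [LinearMap.sum_apply] at h2
  have h3 : killingForm K L b b = ∑ α ∈ H.root, (α b) * (α b) := by
    refine Eq.trans ?_ (h2.trans ?_)
    · rfl
    · refine Finset.sum_congr rfl fun a _ => ?_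
      simp only [LinearMap.smulRight_apply, LinearMap.smul_apply, smul_eq_mul]; rfl
  have h4 : ∑ α ∈ H.root, (α b) * (α b) = (β.1 b)^2 / 4 * (((∑ α ∈ H.root, ((chainBotCoeff β.1 α - chainTopCoeff β.1 α : ℤ)^2) : ℤ)) : K) := by
    push_cast
    rw [Finset.mul_sum]
    refine Finset.sum_congr rfl fun a _ => ?_
    have := CVpp H a β.1 hβ
    have h5 : a b = ((chainBotCoeff β.1 a - chainTopCoeff β.1 a : ℤ) : K) * β.1 b / 2 := by
      rw [← this]; field_simp; rfl
    rw [h5]; push_cast; ring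
  set S := ∑ α ∈ H.root, ((chainBotCoeff β.1 α - chainTopCoeff β.1 α : ℤ)^2) 
  have hS : 0 ≤ S := Finset.sum_nonneg fun _ _ => sq_nonneg _
  have h6 : β.1 b = (β.1 b)^2 / 4 * (S : K) := by rw [← h4, ← h3, h1]
  have h7 : β.1 b * (S : K) = 4 := by
    have : β.1 b * (β.1 b * S) = β.1 b * 4 := by linear_combination (-4) * h6
    exact mul_left_cancel₀ h0 this
  have hS' : S ≠ 0 := by rintro h; rw [h] at h7; simp at h7
  refine ⟨4 / S, by positivity, ?_⟩
  rw [h1]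
  have : (S : K) ≠ 0 := by exact_mod_cast hS'
  push_cast
  field_simp
  exact h7
end

end

section
open Module LieAlgebra

section
variable {K L : Type*} [Field K] [IsAlgClosed K] [CharZero K] [LieRing L] [LieAlgebra K L] [FiniteDimensional K L] [IsKilling K L]

open LieModule LieAlgebra.IsKilling

variable (H : LieSubalgebra K L) [H.IsCartanSubalgebra]

def CVt (α : Weight K H L) : L := ((cartanEquivDual H).symm α.toLinear : H)

theorem CVt_k (α : Weight K H L) (h : L) (hh : h ∈ H) : killingForm K L (CVt H α) h = α ⟨h, hh⟩ :=
  CVa_k H α ⟨h, hh⟩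

theorem CVt_mem (α : Weight K H L) : CVt H α ∈ H := Subtype.property _

theorem CVt_lin (α β γ : Weight K H L) (i : ℤ) : (γ : H → K) = (α : H → K) + i • (β : H → K) ↔ CVt H γ = CVt H α + i • CVt H β := by
  have h1 : CVt H α + i • CVt H β = (((cartanEquivDual H).symm (α.toLinear + i • β.toLinear) : H) : L) := by
    simp [CVt]
  rw [h1, CVt, Subtype.coe_inj, (cartanEquivDual H).symm.injective.eq_iff]
  constructor
  · intro h; ext x; exact congrFun h x
  · intro h; ext x; exact congrArg (fun f => f x) h

theorem CVt_smul (α β : Weight K H L) (c : K) : (α : H → K) = c • (β : H → K) ↔ CVt H α = c • CVt H β := by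
  have h1 : c • CVt H β = (((cartanEquivDual H).symm (c • β.toLinear) : H) : L) := by
    simp [CVt]
  rw [h1, CVt, Subtype.coe_inj, (cartanEquivDual H).symm.injective.eq_iff]
  constructor
  · intro h; ext x; exact congrFun h x
  · intro h; ext x; exact congrArg (fun f => f x) h

theorem CVt_ne (α : Weight K H L) (h : α.IsNonZero) : CVt H α ≠ 0 := by
  intro h0
  have := root_apply_cartanEquivDual_symm_ne_zero h
  rw [← CVa_k] at this
  change (killingForm K L (CVt H α) (CVt H α)) ≠ 0 at this
  rw [h0] at this; simp at this

def CVp (α β : Weight K H L) : ℤ := chainBotCoeff β α - chainTopCoeff β α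

def CVrv (α : Weight K H L) : L := α.exists_ne_zero.choose

theorem CVrv_mem (α : Weight K H L) : CVrv H α ∈ rootSpace H α := α.exists_ne_zero.choose_spec.1
theorem CVrv_ne (α : Weight K H L) : CVrv H α ≠ 0 := α.exists_ne_zero.choose_spec.2

theorem CVrv_span (α : Weight K H L) (h : α.IsNonZero) (v : L) (hv : v ∈ rootSpace H α) : ∃ c : K, v = c • CVrv H α := by
  obtain ⟨c, hc⟩ := (finrank_eq_one_iff_of_nonzero' (⟨CVrv H α, CVrv_mem H α⟩ : rootSpace H α) (by
    intro h; exact CVrv_ne H α (congrArg Subtype.val h))).1 (finrank_rootSpace_eq_one α h) ⟨v, hv⟩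
  exact ⟨c, (congrArg Subtype.val hc).symm⟩

theorem CVbr (α γ : Weight K H L) (hα : α.IsNonZero) (hp : CVp H γ α < 0) : ⁅CVrv H α, CVrv H γ⁆ ≠ 0 := by
  intro h0
  obtain ⟨h, e, f, ht, he, hf⟩ := exists_isSl2Triple_of_weight_isNonZero hα
  have hc := ht.h_eq_coroot hα he hf
  obtain ⟨c, rfl⟩ := CVrv_span H α hα e he
  have P : ht.HasPrimitiveVectorWith (CVrv H γ) ((CVp H γ α : ℤ) : K) := by
    refine ⟨CVrv_ne H γ, ?_, ?_⟩
    · rw [CVp, ← apply_coroot_eq_cast, hc]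
      exact lie_eq_smul_of_mem_rootSpace (CVrv_mem H γ) _
    · rw [smul_lie, h0, smul_zero]
  obtain ⟨n, hn⟩ := P.exists_nat
  have : CVp H γ α = n := by exact_mod_cast hn
  omega

theorem CVbrn (α : Weight K H L) (hα : α.IsNonZero) : ∃ c : K, c ≠ 0 ∧ ⁅CVrv H α, CVrv H (-α)⁆ = c • CVt H α := by
  have h1 := lie_eq_killingForm_smul_of_mem_rootSpace_of_mem_rootSpace_neg (CVrv_mem H α) (CVrv_mem H (-α))
  refine ⟨_, ?_, h1⟩
  intro h2
  apply CVrv_ne H α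
  have h3 := mem_ker_killingForm_of_mem_rootSpace_of_forall_rootSpace_neg K L H (CVrv_mem H α) (by
    intro y hy
    obtain ⟨c, rfl⟩ := CVrv_span H (-α) (by simpa using hα) y hy
    rw [map_smul, h2, smul_zero])
  simpa using h3

theorem CVstr (α β : Weight K H L) (hβ : β.IsNonZero) (n i : ℤ) (hp : CVp H α β ≤ -n) (h0 : 0 ≤ i) (hn : i ≤ n)
   : ∃ γ : Weight K H L, CVt H γ = CVt H α + i • CVt H β := by
  have h1 : rootSpace H (i • (β : H → K) + α) ≠ ⊥ := by
    rw [rootSpace_zsmul_add_ne_bot_iff β α hβ i]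
    unfold CVp at hp
    omega
  refine ⟨⟨_, h1⟩, (CVt_lin H _ _ _ _).1 ?_⟩
  change i • (β : H → K) + α = _
  rw [add_comm]

theorem CVz (h : L) (hh : h ∈ H) (h0 : ∀ α : H.root, killingForm K L (CVt H α.1) h = 0) : h = 0 := by
  have h2 : ∀ f : Module.Dual K H, f ⟨h, hh⟩ = 0 := by
    intro f
    have hf : f ∈ (⊤ : Submodule K (Module.Dual K H)) := trivial
    rw [← span_weight_isNonZero_eq_top (K := K) (L := L) (H := H)] at hf
    refine Submodule.span_induction ?_ ?_ ?_ ?_ hf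
    · rintro _ ⟨α, hα, rfl⟩
      have := h0 ⟨α, by simpa [LieSubalgebra.root] using hα⟩
      rw [CVt_k H _ _ hh] at this
      exact this
    · simp
    · intro x y _ _ hx hy; simp [hx, hy]
    · intro c x _ hx; simp [hx]
  have := (Module.forall_dual_apply_eq_zero_iff K (⟨h, hh⟩ : H)).1 h2
  exact congrArg Subtype.val this

theorem CVlift (α : Weight K H L) (h : CVt H α ≠ 0) : α ∈ H.root := by
  simp only [LieSubalgebra.root, Finset.mem_filter, Finset.mem_univ, true_and]
  intro h0
  apply h
  have := (CVt_lin H α α α 1)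
  have h1 : CVt H α = CVt H α + (1:ℤ) • CVt H α := by
    rw [← this]
    have : (α : H → K) = 0 := h0
    rw [this]; simp
  simpa using h1

omit [IsAlgClosed K] [CharZero K] in
theorem CVHab (a : L) (ha : a ∈ H) (b : L) (hb : b ∈ H) : ⁅a, b⁆ = 0 := by
  have h := LieModule.IsTrivial.trivial (⟨a, ha⟩ : H) (⟨b, hb⟩ : H)
  have := congrArg (Subtype.val) h
  simpa using this

theorem CVeig (α : Weight K H L) (h : L) (hh : h ∈ H) : ⁅h, CVrv H α⁆ = killingForm K L (CVt H α) h • CVrv H α := by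
  rw [CVt_k H _ _ hh]
  exact lie_eq_smul_of_mem_rootSpace (CVrv_mem H α) ⟨h, hh⟩

theorem CVdec (v : L) : ∃ h ∈ H.toSubmodule, ∃ c : H.root → K, v = h + ∑ α : H.root, c α • CVrv H α.1 := by
  obtain ⟨h, hh, c, hc, hv⟩ := CVtopd H v
  have h1 : ∀ α : H.root, ∃ d : K, c α = d • CVrv H α.1 := fun α => CVrv_span H α.1 (H.isNonZero_coe_root α) (c α) (hc α)
  choose d hd using h1
  refine ⟨h, hh, d, ?_⟩
  rw [hv, Finset.sum_congr rfl fun α _ => hd α]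

/-- The root data of a Cartan subalgebra. -/
def CVRD : RD K L H.root where
  H := H.toSubmodule
  t α := CVt H α.1
  rv α := CVrv H α.1
  neg α := ⟨-α.1, by simpa [LieSubalgebra.root] using H.isNonZero_coe_root α⟩
  p α β := CVp H α.1 β.1
  tH α := CVt_mem H α.1
  Hab a ha b hb := CVHab H a ha b hb
  rv_ne α := CVrv_ne H α.1
  rv_eig α h hh := CVeig H α.1 h hh
  dec v := CVdec H v
  tinj α β h := by
    have := (CVt_smul H α.1 β.1 1).2 (by simpa using h)
    apply Subtype.ext
    exact Weight.ext fun x => by simpa using congrFun this x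
  tne α := CVt_ne H α.1 (H.isNonZero_coe_root α)
  tneg α := by
    have := (CVt_smul H (-α.1) α.1 (-1)).1 (by simp)
    simpa using this
  hzero h hh h0 := CVz H h hh h0
  pq α β := by
    rw [CVt_k H _ _ (CVt_mem H _), CVt_k H _ _ (CVt_mem H _)]
    exact CVpp H α.1 β.1 (H.isNonZero_coe_root β)
  rat β := CVrat H β
  refl α β := by
    have h1 := (CVt_lin H α.1 β.1 (reflectRoot β.1 α.1) (- CVp H α.1 β.1)).1 (by
      change (α.1 : H → K) - α.1 (coroot β.1) • (β.1 : H → K) = _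
      rw [apply_coroot_eq_cast, Int.cast_smul_eq_zsmul, neg_smul, sub_eq_add_neg]; rfl)
    refine ⟨⟨reflectRoot β.1 α.1, CVlift H _ (CVt_ne H _ (reflectRoot_isNonZero _ _ (H.isNonZero_coe_root α)))⟩, ?_⟩
    change CVt H (reflectRoot β.1 α.1) = _
    rw [h1, neg_smul, sub_eq_add_neg]
  str α β n i hp h0 hn hne := by
    obtain ⟨γ, hγ⟩ := CVstr H α.1 β.1 (H.isNonZero_coe_root β) n i hp h0 hn
    exact ⟨⟨γ, CVlift H γ (by rw [hγ]; exact hne)⟩, hγ⟩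
  red α β c h := by
    have h1 := (CVt_smul H α.1 β.1 c).2 h
    rcases eq_neg_one_or_eq_zero_or_eq_one_of_eq_smul β.1 α.1 (H.isNonZero_coe_root β) c h1 with h | h | h
    · right; exact h
    · rw [h, zero_smul] at h1
      exact absurd h1 (H.isNonZero_coe_root α)
    · left; exact h
  br α γ h := CVbr H α.1 γ.1 (H.isNonZero_coe_root α) h
  brn α := CVbrn H α.1 (H.isNonZero_coe_root α)
end

section
variable {K L : Type*} [Field K] [CharZero K] [LieRing L] [LieAlgebra K L] [FiniteDimensional K L]

theorem CVCartan3 {a b c : L} (ha : (ad K L a).IsSemisimple) (hb : (ad K L b).IsSemisimple) (hc : (ad K L c).IsSemisimple)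
    (hab : ⁅a, b⁆ = 0) (hac : ⁅a, c⁆ = 0) (hbc : ⁅b, c⁆ = 0) :
    ∃ H : LieSubalgebra K L, H.IsCartanSubalgebra ∧ a ∈ H ∧ b ∈ H ∧ c ∈ H := by
  have hj : ∀ u v w : L, ⁅u, v⁆ = 0 → ⁅u, w⁆ = 0 → ⁅u, ⁅v, w⁆⁆ = 0 := by
    intro u v w h1 h2; rw [leibniz_lie, h1, h2]; simp
  let M : LieSubalgebra K L :=
    { carrier := {v | ⁅a, v⁆ = 0 ∧ ⁅b, v⁆ = 0 ∧ ⁅c, v⁆ = 0}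
      add_mem' := fun {x y} hx hy => by simp only [Set.mem_setOf_eq] at *; simp [hx, hy]
      zero_mem' := by simp
      smul_mem' := fun r x hx => by simp only [Set.mem_setOf_eq] at *; simp [hx]
      lie_mem' := fun {x y} hx hy => ⟨hj _ _ _ hx.1 hy.1, hj _ _ _ hx.2.1 hy.2.1, hj _ _ _ hx.2.2 hy.2.2⟩ }
  obtain ⟨x, hx⟩ := exists_isCartanSubalgebra_engel K M
  set N := LieSubalgebra.engel K x
  have hcen : ∀ u : M, (∀ v : M, ⁅u, v⁆ = 0) → u ∈ N := by
    intro u hu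
    rw [← hx.self_normalizing, LieSubalgebra.mem_normalizer_iff]
    intro y _
    rw [hu]; exact zero_mem _
  have hba : ⁅b, a⁆ = 0 := by rw [← lie_skew, hab, neg_zero]
  have hca : ⁅c, a⁆ = 0 := by rw [← lie_skew, hac, neg_zero]
  have hcb : ⁅c, b⁆ = 0 := by rw [← lie_skew, hbc, neg_zero]
  have aM : a ∈ M := ⟨lie_self a, hba, hca⟩
  have bM : b ∈ M := ⟨hab, lie_self b, hcb⟩
  have cM : c ∈ M := ⟨hac, hbc, lie_self c⟩
  have aN := hcen ⟨a, aM⟩ fun v => Subtype.ext v.2.1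
  have bN := hcen ⟨b, bM⟩ fun v => Subtype.ext v.2.2.1
  have cN := hcen ⟨c, cM⟩ fun v => Subtype.ext v.2.2.2
  refine ⟨N.map M.incl, ⟨?_, ?_⟩, ⟨_, aN, rfl⟩, ⟨_, bN, rfl⟩, ⟨_, cN, rfl⟩⟩
  · have hnil := hx.nilpotent
    have e : N ≃ₗ⁅K⁆ N.map M.incl := LieSubalgebra.equivMapOfInjective M.incl N Subtype.val_injective
    exact (LieEquiv.nilpotent_iff_equiv_nilpotent e).1 hnil
  · refine le_antisymm ?_ (LieSubalgebra.le_normalizer _)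
    intro v hv
    rw [LieSubalgebra.mem_normalizer_iff] at hv
    have key : ∀ s : L, (ad K L s).IsSemisimple → s ∈ N.map M.incl → (∀ m ∈ M, ⁅s, m⁆ = 0) → ⁅s, v⁆ = 0 := by
      intro s hs hsN hsM
      apply CVss_kr hs (w := v)
      change ⁅s, ⁅s, v⁆⁆ = 0
      have h1 := hv s hsN
      obtain ⟨m, hm, h2⟩ := h1
      have : ⁅s, ⁅v, s⁆⁆ = 0 := by
        apply hsM
        rw [← h2]; exact m.2
      rw [← lie_skew s v, lie_neg, this, neg_zero]
    have vM : v ∈ M := ⟨key a ha ⟨_, aN, rfl⟩ fun m hm => hm.1, key b hb ⟨_, bN, rfl⟩ fun m hm => hm.2.1,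
      key c hc ⟨_, cN, rfl⟩ fun m hm => hm.2.2⟩
    refine ⟨⟨v, vM⟩, ?_, rfl⟩
    change (⟨v, vM⟩ : M) ∈ N
    rw [← hx.self_normalizing, LieSubalgebra.mem_normalizer_iff]
    intro y hy
    obtain ⟨m, hm, h2⟩ := hv y ⟨y, hy, rfl⟩
    have : m = ⁅(⟨v, vM⟩ : M), y⁆ := Subtype.ext h2
    rw [← this]; exact hm
end

end

section
open Module LieAlgebra

namespace RD
variable {K L : Type*} [Field K] [CharZero K] [LieRing L] [LieAlgebra K L] [FiniteDimensional K L]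
  {R : Type*} [Fintype R] (D : RD K L R)

local notation "κ" => killingForm K L

theorem kHr {h : L} (hh : h ∈ D.H) (α : R) : κ (D.rv α) h = 0 := by
  obtain ⟨q, hq, hq'⟩ := D.rat α
  have h1 : κ ⁅D.t α, D.rv α⁆ h = 0 := by
    rw [← lie_skew, map_neg, LinearMap.neg_apply, CVkinv, D.Hab _ (D.tH α) _ hh]; simp
  rw [D.rv_eig α _ (D.tH α), map_smul, LinearMap.smul_apply, hq'] at h1
  have : (q : K) ≠ 0 := by exact_mod_cast hq.ne'
  simpa [this] using h1

theorem krr {α β : R} (h : D.t α + D.t β ≠ 0) : κ (D.rv α) (D.rv β) = 0 := by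
  by_contra hk
  apply h
  refine D.hzero _ (add_mem (D.tH α) (D.tH β)) fun δ => ?_
  have h1 : κ ⁅D.t δ, D.rv α⁆ (D.rv β) = - κ (D.rv α) ⁅D.t δ, D.rv β⁆ := by
    rw [← lie_skew, map_neg, LinearMap.neg_apply, CVkinv]
  rw [D.rv_eig _ _ (D.tH δ), D.rv_eig _ _ (D.tH δ), map_smul, map_smul, LinearMap.smul_apply, smul_eq_mul, smul_eq_mul] at h1
  have h2 : (κ (D.t α) (D.t δ) + κ (D.t β) (D.t δ)) * κ (D.rv α) (D.rv β) = 0 := by linear_combination h1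
  rcases mul_eq_zero.1 h2 with h3 | h3
  · rw [map_add, CVkcomm, CVkcomm (D.t δ)]; exact h3
  · exact absurd h3 hk

theorem ktt_ne (α : R) : κ (D.t α) (D.t α) ≠ 0 := by
  obtain ⟨q, hq, hq'⟩ := D.rat α
  rw [hq']; exact_mod_cast hq.ne'

theorem krn (α : R) : κ (D.rv α) (D.rv (D.neg α)) ≠ 0 := by
  obtain ⟨c, hc, h⟩ := D.brn α
  intro h0
  have h1 : κ ⁅D.rv α, D.rv (D.neg α)⁆ (D.t α) = 0 := by
    rw [CVkinv, ← lie_skew, D.rv_eig _ _ (D.tH α)]; simp [h0]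
  rw [h] at h1
  simp [hc, D.ktt_ne] at h1

theorem neg_neg (α : R) : D.neg (D.neg α) = α := D.tinj _ _ (by simp [D.tneg])

theorem krn' (α : R) : κ (D.rv (D.neg α)) (D.rv α) ≠ 0 := by
  rw [CVkcomm]; exact D.krn α

/-- unnormalised coordinates -/
def cf (α : R) : L →ₗ[K] K := κ (D.rv (D.neg α))

theorem cf_H (α : R) {h : L} (hh : h ∈ D.H) : D.cf α h = 0 := D.kHr hh _

theorem cf_self (α : R) : D.cf α (D.rv α) ≠ 0 := D.krn' α

theorem cf_ne {α β : R} (h : β ≠ α) : D.cf α (D.rv β) = 0 := by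
  apply D.krr
  rw [D.tneg]
  intro h0
  exact h (D.tinj _ _ (neg_add_eq_zero.1 h0).symm)

theorem cf_lie (α : R) {h : L} (hh : h ∈ D.H) (v : L) : D.cf α ⁅h, v⁆ = κ (D.t α) h * D.cf α v := by
  unfold cf
  rw [← CVkinv, ← lie_skew, D.rv_eig _ _ hh, D.tneg]
  simp

theorem cf_sum [DecidableEq R] (α : R) {h : L} (hh : h ∈ D.H) (c : R → K) : D.cf α (h + ∑ β, c β • D.rv β) = c α * D.cf α (D.rv α) := by
  rw [map_add, D.cf_H α hh, zero_add, map_sum, Finset.sum_eq_single α]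
  · simp
  · intro β _ hβ; simp [D.cf_ne hβ]
  · simp

theorem dec' (v : L) : ∃ h ∈ D.H, v = h + ∑ β, (D.cf β v / D.cf β (D.rv β)) • D.rv β := by
  classical
  obtain ⟨h, hh, c, rfl⟩ := D.dec v
  refine ⟨h, hh, ?_⟩
  congr 1
  refine Finset.sum_congr rfl fun β _ => ?_
  rw [D.cf_sum β hh, mul_div_cancel_right₀ _ (D.cf_self β)]

theorem mem_H {v : L} (h : ∀ α, D.cf α v = 0) : v ∈ D.H := by
  obtain ⟨h', hh, e⟩ := D.dec' v
  rw [e]; simpa [h] using hh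

theorem selfcent {v : L} (h : ∀ a ∈ D.H, ⁅a, v⁆ = 0) : v ∈ D.H := by
  refine D.mem_H fun α => ?_
  have h1 := D.cf_lie α (D.tH α) v
  rw [h _ (D.tH α), map_zero] at h1
  simpa [D.ktt_ne] using h1.symm

/-- lie of H with v is determined by coords -/
theorem lie_zero {a v : L} (ha : a ∈ D.H) : ⁅a, v⁆ = 0 ↔ ∀ α, κ (D.t α) a ≠ 0 → D.cf α v = 0 := by
  constructor
  · intro h α hα
    have h1 := D.cf_lie α ha v
    rw [h, map_zero] at h1
    simpa [hα] using h1.symm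
  · intro h
    obtain ⟨h', hh, e⟩ := D.dec' v
    rw [e, lie_add, D.Hab _ ha _ hh, zero_add, lie_sum]
    refine Finset.sum_eq_zero fun β _ => ?_
    rw [lie_smul, D.rv_eig _ _ ha]
    by_cases hb : κ (D.t β) a = 0
    · simp [hb]
    · simp [h β hb]

theorem ss (a : L) (ha : a ∈ D.H) (v : L) (μ : K) (α : R) (h : ⁅a, v⁆ = μ • v) (hc : D.cf α v ≠ 0) : κ (D.t α) a = μ := by
  have h1 := D.cf_lie α ha v
  rw [h, map_smul, smul_eq_mul] at h1
  exact (mul_right_cancel₀ hc h1).symm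

theorem eig_of (a : L) (ha : a ∈ D.H) (v : L) (μ : K) (hμ : μ ≠ 0) (h : ⁅a, v⁆ = μ • v) :
    v = ∑ β, (D.cf β v / D.cf β (D.rv β)) • D.rv β := by
  obtain ⟨h', hh, e⟩ := D.dec' v
  have h0 : h' = 0 := by
    refine D.hzero _ hh fun α => ?_
    have e2 : h' = v - ∑ β, (D.cf β v / D.cf β (D.rv β)) • D.rv β := by rw [eq_sub_iff_add_eq]; exact e.symm
    have h1 : κ (D.t α) v = 0 := by
      have : κ (D.t α) ⁅a, v⁆ = 0 := by rw [← CVkinv, D.Hab _ (D.tH α) _ ha]; simp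
      rw [h] at this; simpa [hμ] using this
    rw [e2, map_sub, h1, zero_sub, neg_eq_zero, map_sum]
    refine Finset.sum_eq_zero fun β _ => ?_
    rw [map_smul, CVkcomm, D.kHr (D.tH α), smul_zero]
  rw [h0, zero_add] at e; exact e

/-- span of H and the root vectors in S -/
def U (S : Finset R) : Submodule K L := ⨅ α ∈ {α | α ∉ S}, LinearMap.ker (D.cf α)

theorem mem_U (S : Finset R) (v : L) : v ∈ D.U S ↔ ∀ α, α ∉ S → D.cf α v = 0 := by
  simp [U, Submodule.mem_iInf]

theorem finrank_U (S : Finset R) : finrank K (D.U S) = finrank K D.H + S.card := by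
  classical
  let f : D.U S →ₗ[K] (S → K) := LinearMap.pi fun α => D.cf α.1 ∘ₗ (D.U S).subtype
  have hs : Function.Surjective f := by
    intro c
    let c' : R → K := fun α => if h : α ∈ S then c ⟨α, h⟩ / D.cf α (D.rv α) else 0
    refine ⟨⟨0 + ∑ β, c' β • D.rv β, ?_⟩, ?_⟩
    · rw [D.mem_U]
      intro α hα
      rw [D.cf_sum α (zero_mem _)]
      simp [c', hα]
    · ext α
      change D.cf α.1 (0 + ∑ β, c' β • D.rv β) = _
      rw [D.cf_sum α.1 (zero_mem _)]
      simp [c', div_mul_cancel₀ _ (D.cf_self α.1)]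
  have h1 := LinearMap.finrank_range_add_finrank_ker f
  rw [LinearMap.range_eq_top.2 hs, finrank_top, Module.finrank_fintype_fun_eq_card, Fintype.card_coe] at h1
  have h2 : LinearMap.ker f = D.H.comap (D.U S).subtype := by
    ext v
    rw [LinearMap.mem_ker, Submodule.mem_comap]
    constructor
    · intro h
      refine D.mem_H fun α => ?_
      by_cases hα : α ∈ S
      · exact congrFun h ⟨α, hα⟩
      · exact (D.mem_U S _).1 v.2 α hα
    · intro h
      ext α
      exact D.cf_H _ h
  have h3 : D.H ≤ D.U S := fun v hv => (D.mem_U S v).2 fun α _ => D.cf_H α hv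
  have h4 := LinearEquiv.finrank_eq (Submodule.comapSubtypeEquivOfLe h3)
  rw [h2, h4] at h1
  omega

theorem p_self (α : R) : D.p α α = 2 := by
  have := D.pq α α
  have h := mul_right_cancel₀ (D.ktt_ne α) this
  exact_mod_cast h.symm

theorem p_lin (α β γ δ : R) (m n : ℤ) (h : D.t δ = m • D.t α + n • D.t β) : D.p δ γ = m * D.p α γ + n * D.p β γ := by
  have h0 := D.pq δ γ
  have h1 := D.pq α γ
  have h2 := D.pq β γ
  rw [h] at h0
  simp only [map_add, map_zsmul, LinearMap.add_apply, LinearMap.smul_apply, zsmul_eq_mul] at h0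
  have h3 : (D.p δ γ : K) * κ (D.t γ) (D.t γ) = ((m * D.p α γ + n * D.p β γ : ℤ) : K) * κ (D.t γ) (D.t γ) := by
    push_cast; linear_combination -h0 + m * h1 + n * h2
  exact_mod_cast mul_right_cancel₀ (D.ktt_ne γ) h3

theorem p_neg_left (α β : R) : D.p (D.neg α) β = - D.p α β := by
  have := D.p_lin α α β (D.neg α) (-1) 0 (by simp [D.tneg])
  simpa using this

theorem p_neg_right (α β : R) : D.p α (D.neg β) = - D.p α β := by
  have h1 := D.pq α β
  have h2 := D.pq α (D.neg β)
  rw [D.tneg] at h2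
  simp only [map_neg, LinearMap.neg_apply, _root_.neg_neg] at h2
  have h3 : (D.p α (D.neg β) : K) * κ (D.t β) (D.t β) = ((- D.p α β : ℤ) : K) * κ (D.t β) (D.t β) := by
    push_cast; linear_combination -h1 - h2
  exact_mod_cast mul_right_cancel₀ (D.ktt_ne β) h3

theorem t_ne_t {α β : R} (h : α ≠ β) (h' : α ≠ D.neg β) (c : K) : D.t α ≠ c • D.t β := by
  intro h0
  rcases D.red _ _ _ h0 with rfl | rfl
  · exact h (D.tinj _ _ (by simpa using h0))
  · exact h' (D.tinj _ _ (by simpa [D.tneg] using h0))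

theorem p_ratio (α β : R) : ∃ q : ℚ, 0 < q ∧ (D.p α β : ℚ) = q * D.p β α := by
  obtain ⟨a, ha, ha'⟩ := D.rat α
  obtain ⟨b, hb, hb'⟩ := D.rat β
  refine ⟨a / b, by positivity, ?_⟩
  have h1 := D.pq α β
  have h2 := D.pq β α
  rw [hb'] at h1; rw [ha', CVkcomm] at h2
  have h3 : ((D.p α β * b : ℚ) : K) = ((D.p β α * a : ℚ) : K) := by push_cast; rw [← h1, ← h2]
  have h4 : (D.p α β * b : ℚ) = D.p β α * a := by exact_mod_cast h3
  field_simp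
  linarith

theorem p_pos {α β : R} : 0 < D.p α β ↔ 0 < D.p β α := by
  obtain ⟨q, hq, h⟩ := D.p_ratio α β
  constructor
  · intro h1
    have : (0:ℚ) < q * D.p β α := by rw [← h]; exact_mod_cast h1
    exact_mod_cast pos_of_mul_pos_right this hq.le
  · intro h1
    have : (0:ℚ) < D.p α β := by rw [h]; have : (0:ℚ) < D.p β α := by exact_mod_cast h1
                                 positivity
    exact_mod_cast this

theorem p_zero {α β : R} : D.p α β = 0 ↔ D.p β α = 0 := by
  obtain ⟨q, hq, h⟩ := D.p_ratio α β
  constructor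
  · intro h1
    rw [h1] at h
    have : (D.p β α : ℚ) = 0 := by
      rcases mul_eq_zero.1 h.symm with h2 | h2
      · exact absurd h2 hq.ne'
      · exact h2
    exact_mod_cast this
  · intro h1
    rw [h1] at h; simp at h; exact h

/-- There is a root string `α, α+β, …, α+nβ`. -/
def P (n : ℕ) : Prop := ∃ α β, ∀ i : ℕ, 1 ≤ i → i ≤ n → ∃ γ, D.t γ = D.t α + i • D.t β ∧ D.t α ≠ D.t β ∧ D.t α ≠ - D.t β

theorem str' {α β : R} (h : α ≠ β) (h' : α ≠ D.neg β) (i : ℤ) (h0 : 0 ≤ i) (hp : D.p α β ≤ -i) : ∃ γ, D.t γ = D.t α + i • D.t β := by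
  refine D.str α β i i hp h0 le_rfl fun h2 => ?_
  refine D.t_ne_t h h' (-i : K) ?_
  rw [eq_neg_of_add_eq_zero_left h2, neg_smul, Int.cast_smul_eq_zsmul]

theorem p_ge {n : ℕ} (hP : ¬ D.P (n+1)) {α β : R} (h : α ≠ β) (h' : α ≠ D.neg β) : -(n:ℤ) ≤ D.p α β := by
  by_contra hc
  apply hP
  refine ⟨α, β, fun i h1 h2 => ?_⟩
  obtain ⟨γ, hγ⟩ := D.str' h h' (i : ℤ) (by omega) (by omega)
  refine ⟨γ, by simpa using hγ, ?_, ?_⟩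
  · simpa using D.t_ne_t h h' 1
  · simpa using D.t_ne_t h h' (-1)

theorem p_le {n : ℕ} (hP : ¬ D.P (n+1)) {α β : R} (h : α ≠ β) (h' : α ≠ D.neg β) : D.p α β ≤ n := by
  have := D.p_ge hP (α := α) (β := D.neg β) h' (by rwa [D.neg_neg])
  rw [D.p_neg_right] at this
  omega

/-- difference of roots with positive pairing -/
theorem sub_root {α β : R} (h : α ≠ β) (h' : α ≠ D.neg β) (hp : 0 < D.p α β) : ∃ γ, D.t γ = D.t α - D.t β := by
  obtain ⟨γ, hγ⟩ := D.str' (β := D.neg β) h' (by rwa [D.neg_neg]) 1 (by norm_num) (by rw [D.p_neg_right]; omega)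
  refine ⟨γ, ?_⟩
  rw [hγ, D.tneg]; simp [sub_eq_add_neg]

theorem sub2_root {α β : R} (h : α ≠ β) (h' : α ≠ D.neg β) (hp : 2 ≤ D.p α β) : ∃ γ, D.t γ = D.t α - (2:ℤ) • D.t β := by
  obtain ⟨γ, hγ⟩ := D.str' (β := D.neg β) h' (by rwa [D.neg_neg]) 2 (by norm_num) (by rw [D.p_neg_right]; omega)
  refine ⟨γ, ?_⟩
  rw [hγ, D.tneg]; simp [sub_eq_add_neg]

/-- simply laced symmetric -/
theorem p_symm (hP : ¬ D.P 2) {α β : R} (h : α ≠ β) (h' : α ≠ D.neg β) : D.p α β = D.p β α := by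
  have h1 := D.p_ge (n := 1) hP h h'
  have h2 := D.p_le (n := 1) hP h h'
  have h3 := D.p_ge (n := 1) hP h.symm (fun e => h' (by rw [e, D.neg_neg]))
  have h4 := D.p_le (n := 1) hP h.symm (fun e => h' (by rw [e, D.neg_neg]))
  have h5 := D.p_pos (α := α) (β := β)
  have h6 := D.p_zero (α := α) (β := β)
  push_cast at *
  omega

/-- Coordinates of a bracket -/
theorem cf_br {u v : L} {γ : R} (h : D.cf γ ⁅u, v⁆ ≠ 0) (hu : u = ∑ β, (D.cf β u / D.cf β (D.rv β)) • D.rv β) (hv : v = ∑ β, (D.cf β v / D.cf β (D.rv β)) • D.rv β) :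
    ∃ α β, D.cf α u ≠ 0 ∧ D.cf β v ≠ 0 ∧ D.t γ = D.t α + D.t β := by
  by_contra hc
  push Not at hc
  apply h
  conv_lhs => rw [hu, hv, sum_lie_sum, map_sum]
  refine Finset.sum_eq_zero fun α _ => ?_
  rw [map_sum]
  refine Finset.sum_eq_zero fun β _ => ?_
  by_cases h1 : D.cf α u = 0
  · simp [h1]
  by_cases h2 : D.cf β v = 0
  · simp [h2]
  rw [smul_lie, lie_smul, map_smul, map_smul]
  suffices D.cf γ ⁅D.rv α, D.rv β⁆ = 0 by simp [this]
  by_contra h3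
  have h4 := hc α β h1 h2
  apply h4
  rw [← sub_eq_zero]
  refine D.hzero _ (sub_mem (D.tH _) (add_mem (D.tH _) (D.tH _))) fun δ => ?_
  have h5 : ⁅D.t δ, ⁅D.rv α, D.rv β⁆⁆ = (κ (D.t α + D.t β) (D.t δ)) • ⁅D.rv α, D.rv β⁆ := by
    rw [leibniz_lie, D.rv_eig _ _ (D.tH δ), D.rv_eig _ _ (D.tH δ), smul_lie, lie_smul, ← add_smul, map_add, LinearMap.add_apply]
  have h6 := D.ss _ (D.tH δ) _ _ _ h5 h3
  rw [CVkcomm, map_sub, LinearMap.sub_apply, h6, sub_self]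
end RD

end

section
open Module LieAlgebra

section
variable (K : Type*) {L : Type*} [Field K] [LieRing L] [LieAlgebra K L]
/-- center of the centralizer -/
def zl (s : L) : Submodule K L where
  carrier := {w | ∀ v : L, ⁅s, v⁆ = 0 → ⁅w, v⁆ = 0}
  add_mem' := fun ha hb v hv => by rw [add_lie, ha v hv, hb v hv, add_zero]
  zero_mem' := fun v _ => zero_lie v
  smul_mem' := fun c a ha v hv => by rw [smul_lie, ha v hv, smul_zero]

variable {K}
theorem mem_zl {s w : L} : w ∈ zl K s ↔ ∀ v : L, ⁅s, v⁆ = 0 → ⁅w, v⁆ = 0 := Iff.rfl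
theorem zl_self (s : L) : s ∈ zl K s := fun _ h => h
theorem zl_l {s w : L} (h : w ∈ zl K s) : ⁅s, w⁆ = 0 := by
  rw [← lie_skew, h s (lie_self s), neg_zero]
end

namespace RD
variable {K L : Type*} [Field K] [CharZero K] [LieRing L] [LieAlgebra K L] [FiniteDimensional K L]
  {R : Type*} [Fintype R] (D : RD K L R)

local notation "κ" => killingForm K L

theorem zl_H {s w : L} (hs : s ∈ D.H) (hw : w ∈ zl K s) : w ∈ D.H := by
  refine D.selfcent fun a ha => ?_
  rw [← lie_skew, hw a (D.Hab _ hs _ ha), neg_zero]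

theorem zl_iff {s w : L} (hs : s ∈ D.H) : w ∈ zl K s ↔ w ∈ D.H ∧ ∀ α, κ (D.t α) s = 0 → κ (D.t α) w = 0 := by
  constructor
  · intro hw
    have hH := D.zl_H hs hw
    refine ⟨hH, fun α hα => ?_⟩
    have h1 := hw (D.rv α) (by rw [D.rv_eig _ _ hs, hα, zero_smul])
    rw [D.rv_eig _ _ hH] at h1
    exact (smul_eq_zero.1 h1).resolve_right (D.rv_ne α)
  · rintro ⟨hH, h⟩ v hv
    rw [D.lie_zero hs] at hv
    rw [D.lie_zero hH]
    exact fun α hα => hv α fun h0 => hα (h α h0)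

def S (s : L) : Submodule K L := Submodule.span K {v | ∃ α, κ (D.t α) s = 0 ∧ v = D.t α}

theorem S_H (s : L) : D.S s ≤ D.H := Submodule.span_le.2 (by rintro _ ⟨α, -, rfl⟩; exact D.tH α)

theorem t_S {s : L} {α : R} (h : κ (D.t α) s = 0) : D.t α ∈ D.S s := Submodule.subset_span ⟨α, h, rfl⟩

theorem S_inf {s w : L} (hs : s ∈ D.H) (hw : w ∈ zl K s) (hw' : w ∈ D.S s) : w = 0 := by
  classical
  obtain ⟨hH, hw0⟩ := (D.zl_iff hs).1 hw
  refine D.hzero _ hH fun α => ?_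
  by_contra hne
  let F : Finset R := Finset.univ.filter fun γ => κ (D.t γ) w = κ (D.t α) w
  let Tr : L →ₗ[K] K := ∑ γ ∈ F, κ (D.t γ)
  have h1 : D.S s ≤ LinearMap.ker Tr := by
    refine Submodule.span_le.2 ?_
    rintro _ ⟨β, hβ, rfl⟩
    choose r hr using D.refl
    have hk : ∀ γ, κ (D.t (r γ β)) (D.t β) = - κ (D.t γ) (D.t β) := fun γ => by
      have := D.pq γ β
      rw [hr, map_sub, LinearMap.sub_apply, map_zsmul, LinearMap.smul_apply, zsmul_eq_mul]
      linear_combination this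
    have hw1 : ∀ γ, κ (D.t (r γ β)) w = κ (D.t γ) w := fun γ => by
      rw [hr, map_sub, LinearMap.sub_apply, map_zsmul, LinearMap.smul_apply, hw0 β hβ]; simp
    have hrr : ∀ γ, r (r γ β) β = γ := fun γ => by
      apply D.tinj
      have h2 : D.p (r γ β) β = - D.p γ β := by
        have := D.p_lin γ β β (r γ β) 1 (- D.p γ β) (by rw [hr]; simp [sub_eq_add_neg])
        rw [D.p_self] at this; linarith
      rw [hr, h2, hr]; simp
    change Tr (D.t β) = 0
    simp only [Tr, LinearMap.sum_apply]
    refine Finset.sum_involution (fun γ _ => r γ β) ?_ ?_ ?_ ?_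
    · intro γ _; rw [hk]; ring
    · intro γ _ h0 he
      have := hk γ
      rw [he] at this
      exact h0 (self_eq_neg.1 this)
    · intro γ hγ
      simp only [F, Finset.mem_filter, Finset.mem_univ, true_and] at hγ ⊢
      rw [hw1, hγ]
    · intro γ _; exact hrr γ
  have h2 := h1 hw'
  simp only [Tr, LinearMap.mem_ker, LinearMap.sum_apply] at h2
  rw [Finset.sum_congr rfl (g := fun _ => κ (D.t α) w) (fun γ hγ => (Finset.mem_filter.1 hγ).2)] at h2
  rw [Finset.sum_const, nsmul_eq_mul, mul_eq_zero] at h2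
  have h3 : α ∈ F := by simp [F]
  rcases h2 with h2 | h2
  · have : F.card = 0 := by exact_mod_cast h2
    rw [Finset.card_eq_zero] at this
    rw [this] at h3; simp at h3
  · exact hne h2

theorem S_dim {s : L} (hs : s ∈ D.H) : finrank K (D.S s) + finrank K (zl K s) ≤ finrank K D.H := by
  rw [← Submodule.finrank_sup_add_finrank_inf_eq]
  have : D.S s ⊓ zl K s = ⊥ := by
    rw [Submodule.eq_bot_iff]
    exact fun w hw => D.S_inf hs hw.2 hw.1
  rw [this, finrank_bot, add_zero]
  exact Submodule.finrank_mono (sup_le (D.S_H s) fun w hw => D.zl_H hs hw)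

variable [IsKilling K L]

theorem perp_S {s w : L} (hs : s ∈ D.H) (hw : w ∈ D.H) (h : ∀ a ∈ zl K s, κ w a = 0) : w ∈ D.S s := by
  apply CVkperp
  intro u hu
  obtain ⟨uH, huH, e⟩ := D.dec' u
  have hk : ∀ a ∈ D.H, κ u a = κ uH a := fun a ha => by
    rw [e, map_add, LinearMap.add_apply, map_sum, LinearMap.sum_apply]
    rw [Finset.sum_eq_zero, add_zero]
    intro β _
    rw [map_smul, LinearMap.smul_apply, D.kHr ha, smul_zero]
  rw [hk w hw, CVkcomm]
  apply h
  rw [D.zl_iff hs]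
  refine ⟨huH, fun α hα => ?_⟩
  rw [CVkcomm, ← hk _ (D.tH α)]
  exact hu _ (D.t_S hα)

theorem lemZ {s w : L} (hs : s ∈ D.H) (hw : w ∈ zl K s) (h : ∀ a ∈ zl K s, κ w a = 0) : w = 0 :=
  D.S_inf hs hw (D.perp_S hs (D.zl_H hs hw) h)
end RD

end

section
open Module LieAlgebra

variable (K : Type*) {L : Type*} [Field K] [LieRing L] [LieAlgebra K L]

/-- Normal form of a commuting pair `(xs+xn, ys+yn)`. -/
structure Stp (xs xn ys yn : L) : Prop where
  ss1 : (ad K L xs).IsSemisimple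
  ss2 : (ad K L ys).IsSemisimple
  n1 : IsNilpotent (ad K L xn)
  n2 : IsNilpotent (ad K L yn)
  c1 : ⁅xs, xn⁆ = 0
  c2 : ⁅xs, ys⁆ = 0
  c3 : ⁅xs, yn⁆ = 0
  c4 : ⁅xn, ys⁆ = 0
  c5 : ⁅xn, yn⁆ = 0
  c6 : ⁅ys, yn⁆ = 0
  g1 : ∀ v : L, ⁅xs, v⁆ = 0 → ⁅ys, v⁆ = 0

/-- The span of all values of semilinear derivations. -/
def TT (x y : L) : Submodule K (L × L) := Submodule.span K {p | ∃ D : L →+ L, IsSD K D ∧ p = (D x, D y)}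

/-- good derivations -/
structure GD (xs xn ys yn : L) (D : L →+ L) : Prop where
  sd : IsSD K D
  zs : D xs ∈ zl K xs
  zy : D ys ∈ zl K xs
  xn0 : D xn = 0
  ynl : ⁅xs, D yn⁆ = 0
  ynx : ⁅xn, D yn⁆ = 0

def phi (x y : L) : L →ₗ[K] L × L := LinearMap.prod (- ad K L x) (- ad K L y)

def BB (xs xn ys yn : L) : Submodule K L := Submodule.span K {b | ∃ D : L →+ L, GD K xs xn ys yn D ∧ b = D yn}

def T1 (xs xn ys yn : L) : Submodule K (L × L) :=
  LinearMap.range (phi K (xs + xn) (ys + yn)) ⊔ (BB K xs xn ys yn).map (LinearMap.inr K L L)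

variable {K} [FiniteDimensional K L] [IsKilling K L]
local notation "κ" => killingForm K L

theorem IsSD.eqv {D : L →+ L} (h : IsSD K D) (u v : L) (huv : ⁅u, v⁆ = 0) : ⁅D u, v⁆ + ⁅u, D v⁆ = 0 := by
  rw [← h.lb, huv, map_zero]

section
variable {xs xn ys yn : L} (h : Stp K xs xn ys yn)
include h

theorem Stp.l_lie {u v : L} (hu : ⁅xs, u⁆ = 0) (hv : ⁅xs, v⁆ = 0) : ⁅xs, ⁅u, v⁆⁆ = 0 := by
  rw [leibniz_lie, hu, hv]; simp

theorem Stp.s2 {D : L →+ L} (hD : IsSD K D) : ∃ w : L, GD K xs xn ys yn (D + (ad K L w : L →ₗ[K] L).toAddMonoidHom) := by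
  obtain ⟨P, hP1, hP2, hP3, hP4⟩ := CVproj h.ss1
  obtain ⟨w, hw⟩ := hP2 (D xs)
  set D1 := D + (ad K L w : L →ₗ[K] L).toAddMonoidHom with hD1
  have sd1 : IsSD K D1 := hD.ad_add w
  have e1 : D1 xs = P (D xs) := by
    simp only [hD1, AddMonoidHom.add_apply, LinearMap.toAddMonoidHom_coe, ad_apply]
    rw [← lie_skew, ← hw]; abel
  have key : ∀ v : L, ⁅xs, v⁆ = 0 → ⁅D1 xs, v⁆ = 0 ∧ ⁅xs, D1 v⁆ = 0 := by
    intro v hv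
    have h1 := sd1.eqv _ _ hv
    have h2 : ⁅xs, ⁅D1 xs, v⁆⁆ = 0 := by rw [e1]; exact h.l_lie (hP1 _) hv
    have h3 : ⁅xs, D1 v⁆ = 0 := by
      apply CVss_kr h.ss1
      have : ⁅xs, D1 v⁆ = - ⁅D1 xs, v⁆ := eq_neg_of_add_eq_zero_right h1
      rw [ad_apply, ad_apply, this, lie_neg, h2, neg_zero]
    rw [h3, add_zero] at h1
    exact ⟨h1, h3⟩
  have kz : ∀ w ∈ zl K xs, D1 w ∈ zl K xs := by
    intro w hw v hv
    have h1 := sd1.eqv _ _ (hw v hv)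
    rwa [hw _ (key v hv).2, add_zero] at h1
  obtain ⟨w', hw'⟩ := CVim_perp (K := K) xn (D1 xn) (fun u hu => by rw [CVkcomm]; exact sd1.k2 h.n1 hu)
  have e2 : D1 xn = ⁅xn, P w'⁆ := by
    rw [← hP3 xn h.c1, ← hw', hP4]
    exact (key _ h.c1).2
  refine ⟨w + P w', ?_⟩
  have e3 : D + (ad K L (w + P w') : L →ₗ[K] L).toAddMonoidHom = D1 + (ad K L (P w') : L →ₗ[K] L).toAddMonoidHom := by
    ext v; simp [hD1, add_assoc]
  rw [e3]
  have hl : ∀ v : L, ⁅xs, v⁆ = 0 → ⁅xs, ⁅P w', v⁆⁆ = 0 := fun v hv => h.l_lie (hP1 _) hv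
  have sd2 := sd1.ad_add (P w')
  have xn0 : (D1 + (ad K L (P w') : L →ₗ[K] L).toAddMonoidHom) xn = 0 := by
    simp only [AddMonoidHom.add_apply, LinearMap.toAddMonoidHom_coe, ad_apply]
    rw [e2, ← lie_skew]; abel
  refine ⟨sd2, ?_, ?_, xn0, ?_, ?_⟩
  · simp only [AddMonoidHom.add_apply, LinearMap.toAddMonoidHom_coe, ad_apply]
    rw [← lie_skew, hP1, neg_zero, add_zero]
    exact kz _ (zl_self _)
  · simp only [AddMonoidHom.add_apply, LinearMap.toAddMonoidHom_coe, ad_apply]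
    rw [← lie_skew, h.g1 _ (hP1 _), neg_zero, add_zero]
    exact kz _ h.g1
  · simp only [AddMonoidHom.add_apply, LinearMap.toAddMonoidHom_coe, ad_apply]
    rw [lie_add, (key _ h.c3).2, hl _ h.c3, add_zero]
  · have := sd2.eqv _ _ h.c5
    rwa [xn0, zero_lie, zero_add] at this

theorem Stp.TT_le : TT K (xs + xn) (ys + yn) ≤ T1 K xs xn ys yn ⊔ (zl K xs).prod (zl K xs) := by
  refine Submodule.span_le.2 ?_
  rintro _ ⟨D, hD, rfl⟩
  obtain ⟨w, hw⟩ := h.s2 hD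
  set D2 := D + (ad K L w : L →ₗ[K] L).toAddMonoidHom with hD2
  have e : ∀ v, D v = D2 v + ⁅v, w⁆ := fun v => by
    simp only [hD2, AddMonoidHom.add_apply, LinearMap.toAddMonoidHom_coe, ad_apply]
    rw [← lie_skew w v]; abel
  have e2 : (D (xs + xn), D (ys + yn)) = (phi K (xs + xn) (ys + yn) (-w) + (0, D2 yn)) + (D2 xs, D2 ys) := by
    rw [e, e, map_add, map_add, hw.xn0]
    simp only [phi, LinearMap.prod_apply, Function.prod, LinearMap.neg_apply, ad_apply, lie_neg, _root_.neg_neg, Prod.mk_add_mk, add_zero, add_lie]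
    refine Prod.ext ?_ ?_ <;> simp <;> abel
  rw [e2]
  refine add_mem (Submodule.mem_sup_left (add_mem (Submodule.mem_sup_left ⟨_, rfl⟩) (Submodule.mem_sup_right ?_))) (Submodule.mem_sup_right ⟨hw.zs, hw.zy⟩)
  exact ⟨D2 yn, Submodule.subset_span ⟨D2, hw, rfl⟩, rfl⟩

theorem Stp.comm : ⁅xs + xn, ys + yn⁆ = 0 := by
  simp [h.c2, h.c3, h.c4, h.c5]

theorem Stp.BB_l {b : L} (hb : b ∈ BB K xs xn ys yn) : ⁅xs, b⁆ = 0 ∧ ⁅xn, b⁆ = 0 := by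
  have : BB K xs xn ys yn ≤ LinearMap.ker (ad K L xs) ⊓ LinearMap.ker (ad K L xn) := by
    refine Submodule.span_le.2 ?_
    rintro _ ⟨D, hD, rfl⟩
    exact ⟨hD.ynl, hD.ynx⟩
  exact this hb

theorem Stp.BB_k [CharZero K] {b v : L} (hb : b ∈ BB K xs xn ys yn) (c : ℕ) (hv : ⁅xn + c • yn, v⁆ = 0) : (c:K) * κ b v = 0 := by
  have : BB K xs xn ys yn ≤ LinearMap.ker ((c : K) • (κ).flip v) := by
    refine Submodule.span_le.2 ?_
    rintro _ ⟨D, hD, rfl⟩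
    have hn : IsNilpotent (ad K L (xn + c • yn)) := by
      rw [map_add, map_nsmul]
      have hc : Commute (ad K L xn) (ad K L yn) := by
        change _ * _ = _ * _
        ext w; simp only [Module.End.mul_apply, ad_apply]; rw [leibniz_lie, h.c5]; simp
      refine Commute.isNilpotent_add (hc.smul_right c) h.n1 ?_
      rw [nsmul_eq_mul]
      exact (Nat.commute_cast (ad K L yn) c).symm.isNilpotent_mul_left h.n2
    have h1 := hD.sd.k2 hn hv
    rw [map_add, hD.xn0, zero_add, map_nsmul] at h1
    simp only [SetLike.mem_coe, LinearMap.mem_ker, LinearMap.smul_apply, LinearMap.flip_apply, smul_eq_mul]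
    simpa using h1
  exact this hb

/-- symplectic form -/
def om (p q : L × L) : K := κ p.1 q.2 - κ p.2 q.1

omit [IsKilling K L] h in
theorem om_phi {x y : L} (u : L) (q : L × L) : om (phi K x y u) q = κ u (⁅x, q.2⁆ - ⁅y, q.1⁆) := by
  simp only [om, phi, LinearMap.prod_apply, Function.prod, LinearMap.neg_apply, ad_apply]
  rw [lie_skew, lie_skew, CVkinv, CVkinv, map_sub]

end

def OM : LinearMap.BilinForm K (L × L) := LinearMap.mk₂ K om
  (fun a b c => by simp [om]; ring) (fun c a b => by simp [om]; ring) (fun a b c => by simp [om]; ring) (fun c a b => by simp [om]; ring)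

omit [IsKilling K L] in
theorem om_swap (p q : L × L) : om (K := K) p q = - om q p := by
  simp only [om]; rw [CVkcomm q.1, CVkcomm q.2]; ring

omit [IsKilling K L] in
theorem OM_ap (p q : L × L) : OM (K := K) p q = om p q := rfl

theorem OM_ker : LinearMap.ker (OM (K := K) (L := L)) = ⊥ := by
  rw [Submodule.eq_bot_iff]
  intro p hp
  have hp' : ∀ q, om (K := K) p q = 0 := fun q => congrArg (fun f => f q) hp
  refine Prod.ext (CVknd (K := K) _ fun v => ?_) (CVknd (K := K) _ fun v => ?_)
  · simpa [om] using hp' (0, v)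
  · simpa [om] using hp' (v, 0)

def pp (W : Submodule K (L × L)) : Submodule K (L × L) := OM.orthogonal W

omit [IsKilling K L] in
theorem mem_pp {W : Submodule K (L × L)} {q : L × L} : q ∈ pp W ↔ ∀ p ∈ W, om (K := K) p q = 0 := Iff.rfl

theorem pp_dim (W : Submodule K (L × L)) : finrank K W + finrank K (pp W) = 2 * finrank K L := by
  have := LinearMap.BilinForm.finrank_add_finrank_orthogonal' (B := OM (K := K) (L := L)) W
  rw [OM_ker, inf_bot_eq, finrank_bot, add_zero, Module.finrank_prod] at this
  rw [two_mul]; exact this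

theorem iso_dim (W : Submodule K (L × L)) (h : W ≤ pp W) : finrank K W ≤ finrank K L := by
  have h1 := pp_dim W
  have h2 := Submodule.finrank_mono h
  omega

section
variable {xs xn ys yn : L} (h : Stp K xs xn ys yn)
include h

theorem Stp.mem_ppT1 (q : L × L) (h1 : ⁅xs + xn, q.2⁆ = ⁅ys + yn, q.1⁆) (h2 : ∀ b ∈ BB K xs xn ys yn, κ b q.1 = 0) : q ∈ pp (T1 K xs xn ys yn) := by
  rw [mem_pp]
  intro p hp
  obtain ⟨_, ⟨u, rfl⟩, _, ⟨b, hb, rfl⟩, rfl⟩ := Submodule.mem_sup.1 hp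
  have : om (K := K) (phi K (xs + xn) (ys + yn) u + LinearMap.inr K L L b) q = om (K := K) (phi K (xs + xn) (ys + yn) u) q + om (K := K) (LinearMap.inr K L L b) q := by
    rw [← OM_ap, map_add]; rfl
  rw [this, om_phi, h1, sub_self, map_zero, zero_add]
  simp [om, h2 b hb]

theorem Stp.T1_iso : T1 K xs xn ys yn ≤ pp (T1 K xs xn ys yn) := by
  refine sup_le ?_ ?_
  · rintro _ ⟨u, rfl⟩
    refine h.mem_ppT1 _ ?_ ?_
    · simp only [phi, LinearMap.prod_apply, Function.prod, LinearMap.neg_apply, ad_apply, lie_neg]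
      rw [leibniz_lie, h.comm, zero_lie, zero_add]
    · intro b hb
      simp only [phi, LinearMap.prod_apply, Function.prod, LinearMap.neg_apply, ad_apply]
      rw [lie_skew, ← lie_skew, map_neg, ← CVkinv, ← lie_skew, add_lie, (h.BB_l hb).1, (h.BB_l hb).2]
      simp
  · rintro _ ⟨b, hb, rfl⟩
    refine h.mem_ppT1 _ ?_ ?_
    · simp [(h.BB_l hb).1, (h.BB_l hb).2]
    · intro b _; simp

theorem Stp.BB_k0 {b v : L} (hb : b ∈ BB K xs xn ys yn) (hv : ⁅yn, v⁆ = 0) : κ b v = 0 := by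
  have : BB K xs xn ys yn ≤ LinearMap.ker ((κ).flip v) := by
    refine Submodule.span_le.2 ?_
    rintro _ ⟨D, hD, rfl⟩
    exact hD.sd.k2 h.n2 hv
  exact this hb

theorem Stp.z_comm {a : L} (ha : a ∈ zl K xs) : ⁅xs, a⁆ = 0 ∧ ⁅xn, a⁆ = 0 ∧ ⁅ys, a⁆ = 0 ∧ ⁅yn, a⁆ = 0 := by
  refine ⟨zl_l ha, ?_, ?_, ?_⟩
  · rw [← lie_skew, ha _ h.c1, neg_zero]
  · rw [← lie_skew, ha _ h.c2, neg_zero]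
  · rw [← lie_skew, ha _ h.c3, neg_zero]

theorem Stp.z_pp : (zl K xs).prod (zl K xs) ≤ pp (T1 K xs xn ys yn) := by
  rintro ⟨a, b⟩ ⟨ha, hb⟩
  obtain ⟨h1, h2, h3, h4⟩ := h.z_comm ha
  obtain ⟨h1', h2', h3', h4'⟩ := h.z_comm hb
  refine h.mem_ppT1 _ ?_ ?_
  · simp [h1', h2', h3, h4]
  · exact fun c hc => h.BB_k0 hc h4

variable [CharZero K] [IsAlgClosed K]

theorem Stp.lemZ {w : L} (hw : w ∈ zl K xs) (h0 : ∀ a ∈ zl K xs, κ w a = 0) : w = 0 := by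
  obtain ⟨H, hH, ha, -, -⟩ := CVCartan3 h.ss1 h.ss1 h.ss1 (lie_self xs) (lie_self xs) (lie_self xs)
  exact (CVRD H).lemZ ha hw h0

theorem Stp.T1_z {p : L × L} (hp : p ∈ T1 K xs xn ys yn) (hz : p ∈ (zl K xs).prod (zl K xs)) : p = 0 := by
  have h1 : ∀ q ∈ (zl K xs).prod (zl K xs), om (K := K) p q = 0 := fun q hq => mem_pp.1 (h.z_pp hq) p hp
  refine Prod.ext (h.lemZ hz.1 fun a ha => ?_) (h.lemZ hz.2 fun a ha => ?_)
  · simpa [om] using h1 (0, a) ⟨zero_mem _, ha⟩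
  · simpa [om] using h1 (a, 0) ⟨ha, zero_mem _⟩

omit h [IsKilling K L] [CharZero K] [IsAlgClosed K] in
theorem om_add_l (p p' q : L × L) : om (K := K) (p + p') q = om (K := K) p q + om (K := K) p' q := by
  simp [om]; ring

omit h [IsKilling K L] [CharZero K] [IsAlgClosed K] in
theorem om_add_r (p q q' : L × L) : om (K := K) p (q + q') = om (K := K) p q + om (K := K) p q' := by
  simp [om]; ring

theorem Stp.T1_dim : finrank K (T1 K xs xn ys yn) + finrank K (zl K xs) ≤ finrank K L := by
  have e : finrank K ((zl K xs).map (LinearMap.inr K L L)) = finrank K (zl K xs) :=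
    (Submodule.equivMapOfInjective _ LinearMap.inr_injective _).finrank_eq.symm
  have hz : (zl K xs).map (LinearMap.inr K L L) ≤ (zl K xs).prod (zl K xs) := by
    rintro _ ⟨a, ha, rfl⟩; exact ⟨zero_mem _, ha⟩
  rw [← e, ← Submodule.finrank_sup_add_finrank_inf_eq]
  have : T1 K xs xn ys yn ⊓ (zl K xs).map (LinearMap.inr K L L) = ⊥ := by
    rw [Submodule.eq_bot_iff]
    exact fun p hp => h.T1_z hp.1 (hz hp.2)
  rw [this, finrank_bot, add_zero]
  apply iso_dim
  intro q hq
  rw [mem_pp]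
  intro p hp
  obtain ⟨q1, hq1, q2, hq2, rfl⟩ := Submodule.mem_sup.1 hq
  obtain ⟨p1, hp1, p2, hp2, rfl⟩ := Submodule.mem_sup.1 hp
  rw [om_add_l, om_add_r, om_add_r, mem_pp.1 (h.T1_iso hq1) p1 hp1, mem_pp.1 (h.z_pp (hz hq2)) p1 hp1,
    om_swap p2 q1, mem_pp.1 (h.z_pp (hz hp2)) q1 hq1]
  obtain ⟨a, -, rfl⟩ := hp2
  obtain ⟨b, -, rfl⟩ := hq2
  simp [om]

omit h [IsKilling K L] [CharZero K] [IsAlgClosed K] in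
theorem prod_dim (z : Submodule K L) : finrank K (z.prod z) = 2 * finrank K z := by
  have : finrank K (z × z) = finrank K (z.prod z) := LinearEquiv.finrank_eq
    { toFun := fun p => ⟨(p.1.1, p.2.1), p.1.2, p.2.2⟩
      invFun := fun p => (⟨p.1.1, p.2.1⟩, ⟨p.1.2, p.2.2⟩)
      map_add' := fun _ _ => rfl
      map_smul' := fun _ _ => rfl }
  rw [← this, Module.finrank_prod, two_mul]

theorem Stp.TT_dim : finrank K (TT K (xs + xn) (ys + yn)) ≤ finrank K (T1 K xs xn ys yn) + 2 * finrank K (zl K xs) := by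
  refine (Submodule.finrank_mono h.TT_le).trans ?_
  refine (Submodule.finrank_add_le_finrank_add_finrank _ _).trans ?_
  rw [prod_dim]

theorem Stp.ppT1 (hd : finrank K L ≤ finrank K (T1 K xs xn ys yn) + finrank K (zl K xs)) :
    pp (T1 K xs xn ys yn) = T1 K xs xn ys yn ⊔ (zl K xs).prod (zl K xs) := by
  symm
  apply Submodule.eq_of_le_of_finrank_le
  · exact sup_le h.T1_iso h.z_pp
  · have h1 := Submodule.finrank_sup_add_finrank_inf_eq (T1 K xs xn ys yn) ((zl K xs).prod (zl K xs))
    have : T1 K xs xn ys yn ⊓ (zl K xs).prod (zl K xs) = ⊥ := by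
      rw [Submodule.eq_bot_iff]
      exact fun p hp => h.T1_z hp.1 hp.2
    rw [this, finrank_bot, add_zero, prod_dim] at h1
    have h2 := pp_dim (T1 K xs xn ys yn)
    omega

/-- kernel of `xn + c yn` on `l` -/
theorem Stp.dist0 (hd : finrank K L ≤ finrank K (T1 K xs xn ys yn) + finrank K (zl K xs)) {v w : L} {c c' : ℕ} (hc : c ≠ c')
    (hv : ⁅xs, v⁆ = 0) (hv' : ⁅xn + c • yn, v⁆ = 0) (hw : ⁅xs, w⁆ = 0) (hw' : ⁅xn + c' • yn, w⁆ = 0) (hz : ∀ a ∈ zl K xs, κ v a = 0) :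
    κ v w = 0 := by
  have key : ∀ (v : L) (c : ℕ), ⁅xs, v⁆ = 0 → ⁅xn + c • yn, v⁆ = 0 → ((-(c : K)) • v, v) ∈ pp (T1 K xs xn ys yn) := by
    intro v c hv hv'
    refine h.mem_ppT1 _ ?_ ?_
    · simp only [add_lie, hv, lie_smul, h.g1 v hv, zero_add, smul_zero]
      rw [add_lie, nsmul_lie] at hv'
      rw [eq_neg_of_add_eq_zero_left hv', neg_smul, Nat.cast_smul_eq_nsmul]
    · intro b hb
      have := h.BB_k hb c hv'
      simp only [map_smul, smul_eq_mul]
      linear_combination -this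
  have h1 := key v c hv hv'
  have h2 := key w c' hw hw'
  have h3 : ((-(c : K)) • v, v) ∈ T1 K xs xn ys yn := by
    rw [h.ppT1 hd] at h1
    obtain ⟨τ, hτ, ζ, hζ, e⟩ := Submodule.mem_sup.1 h1
    have h4 : ζ = 0 := by
      have h5 : ∀ q ∈ (zl K xs).prod (zl K xs), om (K := K) ζ q = 0 := by
        intro q hq
        have h6 := mem_pp.1 (h.z_pp hq) τ hτ
        have h7 := om_add_l (K := K) τ ζ q
        rw [e, h6, zero_add] at h7
        rw [← h7]
        simp [om, hz _ hq.1, hz _ hq.2]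
      refine Prod.ext (h.lemZ hζ.1 fun a ha => ?_) (h.lemZ hζ.2 fun a ha => ?_)
      · simpa [om] using h5 (0, a) ⟨zero_mem _, ha⟩
      · simpa [om] using h5 (a, 0) ⟨ha, zero_mem _⟩
    rw [h4, add_zero] at e
    rwa [← e]
  have h4 := mem_pp.1 h2 _ h3
  simp only [om, map_smul, LinearMap.smul_apply, smul_eq_mul] at h4
  have h5 : ((c' : K) - c) * κ v w = 0 := by linear_combination h4
  refine (mul_eq_zero.1 h5).resolve_left ?_
  rw [sub_eq_zero]
  exact_mod_cast hc.symm

theorem Stp.T1_dep (h0 : ∃ l : K, yn = l • xn) :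
    finrank K (TT K (xs + xn) (ys + yn)) + finrank K ↥(LinearMap.ker (phi K (xs + xn) (ys + yn))) ≤ finrank K L + finrank K (Submodule.span K {xn}) + 2 * finrank K (zl K xs) := by
  have h1 := h.TT_dim
  have h2 : finrank K (T1 K xs xn ys yn) ≤ finrank K (LinearMap.range (phi K (xs + xn) (ys + yn))) + finrank K ((BB K xs xn ys yn).map (LinearMap.inr K L L)) := 
    Submodule.finrank_add_le_finrank_add_finrank _ _
  have h3 := Submodule.finrank_map_le (LinearMap.inr K L L) (BB K xs xn ys yn)
  have h4 := LinearMap.finrank_range_add_finrank_ker (phi K (xs + xn) (ys + yn))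
  have h5 : BB K xs xn ys yn ≤ Submodule.span K {xn} := by
    refine Submodule.span_le.2 ?_
    rintro _ ⟨D, hD, rfl⟩
    obtain ⟨l, hl⟩ := h0
    obtain ⟨d, hd⟩ := hD.sd.sl
    rw [hl, hd, hD.xn0, smul_zero, add_zero]
    exact Submodule.smul_mem _ _ (Submodule.mem_span_singleton_self xn)
  have h6 := Submodule.finrank_mono h5
  omega
end

/-- semicontinuity of kernels -/
theorem CVsemi {K V W : Type*} [Field K] [CharZero K] [AddCommGroup V] [Module K V] [FiniteDimensional K V] [AddCommGroup W] [Module K W] 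
    (A B : V →ₗ[K] W) : ∃ c : ℕ, c ≠ 0 ∧ finrank K (LinearMap.ker (A + (c:K) • B)) ≤ finrank K (LinearMap.ker A) := by
  obtain ⟨V', hV'⟩ := Submodule.exists_isCompl (LinearMap.ker A)
  have hi : LinearMap.ker (A ∘ₗ V'.subtype) = ⊥ := by
    rw [Submodule.eq_bot_iff]
    intro v hv
    have : (v : V) ∈ LinearMap.ker A ⊓ V' := ⟨hv, v.2⟩
    rw [hV'.inf_eq_bot] at this
    exact Subtype.ext this
  obtain ⟨g, hg⟩ := LinearMap.exists_leftInverse_of_injective _ hi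
  let M : End K V' := g ∘ₗ B ∘ₗ V'.subtype
  have hfin : {c : ℕ | c ≠ 0 ∧ M.HasEigenvalue (-(c:K)⁻¹)}.Finite := by
    have := (Module.End.finite_hasEigenvalue M)
    refine Set.Finite.of_finite_image (f := fun c : ℕ => -(c:K)⁻¹) (this.subset ?_) ?_
    · rintro _ ⟨c, hc, rfl⟩; exact hc.2
    · intro a _ b _ hab
      simpa using hab
  obtain ⟨c, hc⟩ := (hfin.union (Set.finite_singleton 0)).exists_notMem
  simp only [Set.mem_union, Set.mem_setOf_eq, Set.mem_singleton_iff, not_or, not_and] at hc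
  have hc0 : (c : K) ≠ 0 := by exact_mod_cast hc.2
  refine ⟨c, hc.2, ?_⟩
  have hd : LinearMap.ker (A + (c:K) • B) ⊓ V' = ⊥ := by
    rw [Submodule.eq_bot_iff]
    rintro v ⟨hv, hvV⟩
    by_contra hne
    apply hc.1 hc.2
    refine Module.End.hasEigenvalue_of_hasEigenvector (x := ⟨v, hvV⟩) ⟨?_, fun h => hne (congrArg Subtype.val h)⟩
    rw [Module.End.mem_eigenspace_iff]
    have h1 : A v + (c:K) • B v = 0 := hv
    have h2 : g (A v) = ⟨v, hvV⟩ := congrArg (fun f => f ⟨v, hvV⟩) hg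
    have h3 : g (A v) + (c:K) • g (B v) = 0 := by rw [← map_smul, ← map_add, h1, map_zero]
    change g (B v) = _
    rw [h2] at h3
    rw [eq_neg_of_add_eq_zero_left h3]
    rw [smul_neg, neg_smul, _root_.neg_neg, smul_smul, inv_mul_cancel₀ hc0, one_smul]
  have h1 := Submodule.finrank_add_le_finrank_add_finrank (LinearMap.ker (A + (c:K) • B)) V'
  have h2 := Submodule.finrank_sup_add_finrank_inf_eq (LinearMap.ker (A + (c:K) • B)) V'
  rw [hd, finrank_bot, add_zero] at h2
  have h3 := Submodule.finrank_le (LinearMap.ker (A + (c:K) • B) ⊔ V')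
  have h4 := Submodule.finrank_add_eq_of_isCompl hV'
  omega

/-- centralizer of `n` in `l` -/
def cl (K : Type*) {L : Type*} [Field K] [LieRing L] [LieAlgebra K L] (s n : L) : Submodule K L := LinearMap.ker (ad K L s) ⊓ LinearMap.ker (ad K L n)

theorem Stp.dist [CharZero K] [IsAlgClosed K] {xs xn ys yn : L} (h : Stp K xs xn ys yn)
    (g3 : ∀ c : ℕ, finrank K (cl K xs xn) ≤ finrank K (cl K xs (xn + c • yn)))
    (hd : finrank K L ≤ finrank K (T1 K xs xn ys yn) + finrank K (zl K xs)) {v w : L}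
    (hv : ⁅xs, v⁆ = 0) (hv' : ⁅xn, v⁆ = 0) (hw : ⁅xs, w⁆ = 0) (hw' : ⁅xn, w⁆ = 0) (hz : ∀ a ∈ zl K xs, κ v a = 0) :
    κ v w = 0 := by
  let l := LinearMap.ker (ad K L xs)
  let A : L →ₗ[K] (L × L) × K := ((ad K L xs).prod (ad K L xn)).prod (κ v)
  let B : L →ₗ[K] (L × L) × K := ((0 : L →ₗ[K] L).prod (ad K L yn)).prod 0
  obtain ⟨c, hc, hc'⟩ := CVsemi A B
  have h1 : LinearMap.ker A ≤ cl K xs xn := fun u hu => by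
    have h2 : ((⁅xs, u⁆, ⁅xn, u⁆), κ v u) = 0 := hu
    simp only [Prod.mk_eq_zero] at h2
    exact h2.1
  have h2 : cl K xs (xn + c • yn) ≤ LinearMap.ker (A + (c:K) • B) := fun u hu => by
    have h3 : ⁅xs, u⁆ = 0 := hu.1
    have h4 : ⁅xn + c • yn, u⁆ = 0 := hu.2
    have h5 := h.dist0 hd (c := 0) (c' := c) hc.symm hv (by simpa using hv') h3 h4 hz
    have h6 : ((⁅xs, u⁆, ⁅xn, u⁆), κ v u) + (c:K) • ((0, ⁅yn, u⁆), 0) = (0 : (L × L) × K) := by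
      rw [h3, h5]
      rw [add_lie, nsmul_lie] at h4
      simp [h4, Nat.cast_smul_eq_nsmul]
    exact h6
  have h3 : LinearMap.ker A = cl K xs xn := Submodule.eq_of_le_of_finrank_le h1 
    (((g3 c).trans (Submodule.finrank_mono h2)).trans hc')
  have h4 : w ∈ LinearMap.ker A := by rw [h3]; exact ⟨hw, hw'⟩
  exact (Prod.mk_eq_zero.1 h4).2

end

section
open Module LieAlgebra

namespace RD
variable {K L : Type*} [Field K] [CharZero K] [LieRing L] [LieAlgebra K L] [FiniteDimensional K L]
  {R : Type*} [Fintype R] {D : RD K L R}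

local notation "κ" => killingForm K L

variable (D) in
/-- Levels with respect to a characteristic `h` of `e`. -/
structure Lv (s e h : L) (lev : R → ℤ) : Prop where
  sH : s ∈ D.H
  hH : h ∈ D.H
  se : ⁅s, e⁆ = 0
  he : ⁅h, e⁆ = (2:K) • e
  lev_eq : ∀ α, κ (D.t α) h = lev α
  nat : ∀ (v : L) (μ : K), v ≠ 0 → ⁅h, v⁆ = μ • v → ⁅e, v⁆ = 0 → (∃ n : ℕ, μ = n) ∧ ((∃ u, v = ⁅e, u⁆) → ∃ n : ℕ, 1 ≤ n ∧ μ = n)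

variable (D) in
theorem eigind {h : L} (hh : h ∈ D.H) (W N : Submodule K L) (hW : ∀ v ∈ W, ⁅h, v⁆ ∈ W)
    (hN : ∀ v ∈ W, ∀ μ : K, ⁅h, v⁆ = μ • v → v ∈ N) : W ≤ N := by
  have htop : ⨆ μ, (ad K L h).genEigenspace μ 1 = ⊤ := by
    rw [eq_top_iff]
    intro v _
    obtain ⟨a, ha, c, rfl⟩ := D.dec v
    refine add_mem ?_ (sum_mem fun α _ => Submodule.smul_mem _ _ ?_)
    · refine Submodule.mem_iSup_of_mem 0 ?_
      rw [Module.End.mem_genEigenspace_one]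
      rw [ad_apply, D.Hab _ hh _ ha, zero_smul]
    · refine Submodule.mem_iSup_of_mem (κ (D.t α) h) ?_
      rw [Module.End.mem_genEigenspace_one]
      exact D.rv_eig _ _ hh
  rw [Submodule.eq_iSup_inf_genEigenspace (p := W) (f := ad K L h) 1 hW htop]
  refine iSup_le fun μ v hv => hN v hv.1 μ ?_
  exact Module.End.mem_genEigenspace_one.1 hv.2

variable {s e h : L} {lev : R → ℤ}

theorem Lv.e_lev (l : D.Lv s e h lev) {α : R} (hα : D.cf α e ≠ 0) : lev α = 2 ∧ κ (D.t α) s = 0 := by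
  constructor
  · have := D.ss h l.hH e 2 α l.he hα
    rw [l.lev_eq] at this
    exact_mod_cast this
  · exact D.ss s l.sH e 0 α (by rw [l.se, zero_smul]) hα

theorem Lv.e_sum (l : D.Lv s e h lev) : e = ∑ β, (D.cf β e / D.cf β (D.rv β)) • D.rv β :=
  D.eig_of h l.hH e 2 two_ne_zero l.he

theorem Lv.le (l : D.Lv s e h lev) {v : L} (hv : ⁅e, v⁆ = 0) {β : R} (hβ : D.cf β v ≠ 0) : 0 ≤ lev β := by
  by_contra hneg
  refine hβ ?_
  have : LinearMap.ker (ad K L e) ≤ LinearMap.ker (D.cf β) := by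
    refine D.eigind l.hH _ _ ?_ ?_
    · intro v hv
      have hv : ⁅e, v⁆ = 0 := hv
      change ⁅e, ⁅h, v⁆⁆ = 0
      rw [leibniz_lie, hv, ← lie_skew e h, l.he, neg_lie, smul_lie, hv]; simp
    · intro v hv μ hμ
      by_contra hc
      have hc : D.cf β v ≠ 0 := hc
      obtain ⟨⟨n, hn⟩, -⟩ := l.nat v μ (fun h => hc (by rw [h, map_zero])) hμ hv
      have := D.ss h l.hH v μ β hμ hc
      rw [l.lev_eq, hn] at this
      have : lev β = n := by exact_mod_cast this
      omega
  exact this hv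

theorem Lv.surj [IsKilling K L] (l : D.Lv s e h lev) {α : R} (hα : 1 ≤ lev α) : ∃ w, D.rv α = ⁅e, w⁆ := by
  apply CVim_perp (K := K)
  have : LinearMap.ker (ad K L e) ≤ LinearMap.ker ((κ).flip (D.rv α)) := by
    refine D.eigind l.hH _ _ ?_ ?_
    · intro v hv
      have hv : ⁅e, v⁆ = 0 := hv
      change ⁅e, ⁅h, v⁆⁆ = 0
      rw [leibniz_lie, hv, ← lie_skew e h, l.he, neg_lie, smul_lie, hv]; simp
    · intro v hv μ hμ
      change κ v (D.rv α) = 0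
      by_cases h0 : v = 0
      · simp [h0]
      obtain ⟨⟨n, hn⟩, -⟩ := l.nat v μ h0 hμ hv
      have h1 : κ ⁅h, v⁆ (D.rv α) = - κ v ⁅h, D.rv α⁆ := by
        rw [← lie_skew, map_neg, LinearMap.neg_apply, CVkinv]
      rw [hμ, D.rv_eig _ _ l.hH, l.lev_eq, map_smul, map_smul, LinearMap.smul_apply, hn] at h1
      have h2 : ((n + lev α : ℤ) : K) * κ v (D.rv α) = 0 := by
        push_cast; simp only [smul_eq_mul] at h1; linear_combination h1
      refine (mul_eq_zero.1 h2).resolve_left ?_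
      have : (n + lev α : ℤ) ≠ 0 := by omega
      exact_mod_cast this
  exact fun u hu => this hu

theorem Lv.cf_e_rv (l : D.Lv s e h lev) {α β : R} (hc : D.cf α ⁅e, D.rv β⁆ ≠ 0) : ∃ α', lev α' = 2 ∧ κ (D.t α') s = 0 ∧ D.t α = D.t α' + D.t β := by
  classical
  have h1 : D.rv β = ∑ γ, (D.cf γ (D.rv β) / D.cf γ (D.rv γ)) • D.rv γ := by
    rw [Finset.sum_eq_single β]
    · rw [div_self (D.cf_self β), one_smul]
    · intro γ _ hγ; rw [D.cf_ne hγ.symm]; simp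
    · simp
  obtain ⟨α', β', h2, h3, h4⟩ := D.cf_br hc l.e_sum h1
  have : β' = β := by
    by_contra hne
    exact h3 (D.cf_ne (Ne.symm hne))
  rw [this] at h4
  exact ⟨α', (l.e_lev h2).1, (l.e_lev h2).2, h4⟩

theorem Lv.lev_lin (l : D.Lv s e h lev) {α β γ : R} {m n : ℤ} (hh : D.t γ = m • D.t α + n • D.t β) : lev γ = m * lev α + n * lev β := by
  have h1 := l.lev_eq γ
  rw [hh, map_add, map_zsmul, map_zsmul, LinearMap.add_apply, LinearMap.smul_apply, LinearMap.smul_apply, l.lev_eq, l.lev_eq,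
    zsmul_eq_mul, zsmul_eq_mul] at h1
  exact_mod_cast h1.symm

theorem Lv.lev_neg (l : D.Lv s e h lev) (α : R) : lev (D.neg α) = - lev α := by
  have := l.lev_lin (α := α) (β := α) (γ := D.neg α) (m := -1) (n := 0) (by simp [D.tneg])
  simpa using this

/-- Lemma E -/
theorem Lv.lemE [IsKilling K L] (l : D.Lv s e h lev) (h0 : ∀ α, κ (D.t α) s = 0 → lev α ≠ 0 ∧ lev α ≠ 1) :
    finrank K (cl K s e) ≤ finrank K D.H := by
  classical
  let F : Finset R := Finset.univ.filter fun β => κ (D.t β) s = 0 ∧ 0 ≤ lev β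
  have hF : ∀ β, β ∈ F ↔ κ (D.t β) s = 0 ∧ 0 ≤ lev β := fun β => by simp [F]
  have hle : cl K s e ≤ D.U F := by
    intro v hv
    rw [D.mem_U]
    intro α hα
    by_contra hc
    refine hα ((hF α).2 ⟨?_, l.le hv.2 hc⟩)
    refine D.ss s l.sH v 0 α ?_ hc
    rw [zero_smul]; exact hv.1
  let f : D.U F →ₗ[K] (F → K) := LinearMap.pi fun α => D.cf α.1 ∘ₗ ad K L e ∘ₗ (D.U F).subtype
  have hlev : ∀ α ∈ F, 2 ≤ lev α := fun α hα => by
    have h1 := (hF α).1 hα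
    have h2 := h0 α h1.1
    omega
  have hs : Function.Surjective f := by
    have h1 : ∀ α ∈ F, ∃ w ∈ D.U F, ∀ α' ∈ F, D.cf α' ⁅e, w⁆ = D.cf α' (D.rv α) := by
      intro α hα
      have := hlev α hα
      obtain ⟨w, hw⟩ := l.surj (α := α) (by omega)
      obtain ⟨wH, hwH, ew⟩ := D.dec' w
      set c : R → K := fun β => D.cf β w / D.cf β (D.rv β) with hc
      refine ⟨wH + ∑ β, (if β ∈ F then c β else 0) • D.rv β, ?_, ?_⟩
      · rw [D.mem_U]
        intro δ hδ
        rw [D.cf_sum δ hwH, if_neg hδ, zero_mul]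
      · intro α' hα'
        rw [hw, ew, lie_add, lie_add, lie_sum, lie_sum, map_add, map_add, map_sum, map_sum]
        congr 1
        refine Finset.sum_congr rfl fun β _ => ?_
        by_cases hβ : β ∈ F
        · simp [hβ, hc]
        · rw [if_neg hβ, zero_smul, _root_.lie_zero, map_zero, lie_smul, map_smul]
          by_contra hne
          have hne2 : D.cf α' ⁅e, D.rv β⁆ ≠ 0 := fun h => hne (by rw [h, smul_zero])
          obtain ⟨δ, hδ, hδ', hδ''⟩ := l.cf_e_rv hne2
          apply hβ
          rw [hF]
          have h3 := (hF α').1 hα'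
          constructor
          · have := h3.1
            rw [hδ'', map_add, LinearMap.add_apply, hδ', zero_add] at this
            exact this
          · have h4 := l.lev_lin (α := δ) (β := β) (γ := α') (m := 1) (n := 1) (by simpa using hδ'')
            have := hlev α' hα'
            omega
    choose! w hwU hw using h1
    intro c
    refine ⟨∑ α : F, (c α / D.cf α.1 (D.rv α.1)) • ⟨w α.1, hwU _ α.2⟩, ?_⟩
    ext α'
    change D.cf α'.1 (ad K L e ((D.U F).subtype _)) = _
    rw [map_sum, map_sum, map_sum, Finset.sum_eq_single α']
    · rw [map_smul, map_smul, map_smul]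
      change _ • D.cf α'.1 ⁅e, w α'.1⁆ = _
      rw [hw _ α'.2 _ α'.2, smul_eq_mul, div_mul_cancel₀ _ (D.cf_self _)]
    · intro β _ hβ
      rw [map_smul, map_smul, map_smul]
      change _ • D.cf α'.1 ⁅e, w β.1⁆ = _
      rw [hw _ β.2 _ α'.2, D.cf_ne (fun h => hβ (Subtype.ext h)), smul_zero]
    · simp
  have h1 := LinearMap.finrank_range_add_finrank_ker f
  rw [LinearMap.range_eq_top.2 hs, finrank_top, Module.finrank_fintype_fun_eq_card, Fintype.card_coe, D.finrank_U] at h1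
  have h2 : finrank K (cl K s e) ≤ finrank K (LinearMap.ker f) := by
    rw [← LinearEquiv.finrank_eq (Submodule.comapSubtypeEquivOfLe hle)]
    refine Submodule.finrank_mono ?_
    intro v hv
    ext α
    change D.cf α.1 ⁅e, (v : L)⁆ = 0
    have : ⁅e, (v : L)⁆ = 0 := hv.2
    rw [this, map_zero]
  omega

theorem Lv.phi1 [IsKilling K L] (l : D.Lv s e h lev) {γ : R} (hγ : κ (D.t γ) s = 0) (hl : lev γ = 1) :
    ∃ α γ', κ (D.t α) s = 0 ∧ lev α = 2 ∧ κ (D.t γ') s = 0 ∧ lev γ' = 1 ∧ D.t α = D.t γ + D.t γ' := by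
  obtain ⟨w, hw⟩ := l.surj (α := γ) (by omega)
  obtain ⟨wH, hwH, ew⟩ := D.dec' w
  have h1 := D.cf_self γ
  rw [hw, ew, lie_add, lie_sum, map_add, map_sum] at h1
  have h2 : D.cf γ ⁅e, wH⁆ = 0 := by
    rw [← lie_skew, map_neg, D.cf_lie γ hwH]
    by_cases hc : D.cf γ e = 0
    · rw [hc]; simp
    · have := (l.e_lev hc).1; omega
  rw [h2, zero_add] at h1
  obtain ⟨β, -, hβ⟩ := Finset.exists_ne_zero_of_sum_ne_zero h1
  rw [lie_smul, map_smul] at hβ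
  obtain ⟨α, hα, hα', ht⟩ := l.cf_e_rv (right_ne_zero_of_smul hβ)
  refine ⟨α, D.neg β, hα', hα, ?_, ?_, by rw [D.tneg, ht]; abel⟩
  · rw [ht, map_add, LinearMap.add_apply, hα', zero_add] at hγ
    rw [D.tneg, map_neg, LinearMap.neg_apply, hγ, neg_zero]
  · have h4 := l.lev_lin (α := α) (β := β) (γ := γ) (m := 1) (n := 1) (by simpa using ht)
    rw [l.lev_neg]; omega

theorem Lv.dist2 [IsKilling K L] (l : D.Lv s e h lev)
    (hD : ∀ v : L, ⁅s, v⁆ = 0 → ⁅e, v⁆ = 0 → (∀ a ∈ zl K s, κ v a = 0) → ⁅h, v⁆ = 0 → v = 0) (F0 F2 : Finset R)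
    (h0 : ∀ α ∈ F0, κ (D.t α) s = 0 ∧ lev α = 0) (h2 : ∀ α, κ (D.t α) s = 0 → lev α = 2 → α ∈ F2) :
    finrank K D.H + F0.card ≤ finrank K (zl K s) + F2.card := by
  classical
  let f : D.U F0 →ₗ[K] (F2 → K) × Dual K (zl K s) := 
    (LinearMap.pi fun α => D.cf α.1 ∘ₗ ad K L e ∘ₗ (D.U F0).subtype).prod ((zl K s).subtype.dualMap ∘ₗ κ ∘ₗ (D.U F0).subtype)
  have hf : LinearMap.ker f = ⊥ := by
    rw [Submodule.eq_bot_iff]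
    intro v hv
    have hv1 : ∀ α ∈ F2, D.cf α ⁅e, (v : L)⁆ = 0 := fun α hα => congrFun (congrArg Prod.fst hv) ⟨α, hα⟩
    have hv2 : ∀ a ∈ zl K s, κ v a = 0 := fun a ha => congrArg (fun g => g ⟨a, ha⟩) (congrArg Prod.snd hv)
    have hvs : ⁅s, (v : L)⁆ = 0 := by
      rw [D.lie_zero l.sH]
      intro α hα
      exact (D.mem_U F0 _).1 v.2 α fun hc => hα (h0 α hc).1
    have hvh : ⁅h, (v : L)⁆ = 0 := by
      rw [D.lie_zero l.hH]
      intro α hα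
      refine (D.mem_U F0 _).1 v.2 α fun hc => hα ?_
      rw [l.lev_eq, (h0 α hc).2]; simp
    have hve : ⁅h, ⁅e, (v : L)⁆⁆ = (2:K) • ⁅e, (v:L)⁆ := by
      rw [leibniz_lie, l.he, hvh]; simp
    have hse : ⁅s, ⁅e, (v : L)⁆⁆ = 0 := by rw [leibniz_lie, l.se, hvs]; simp
    refine Subtype.ext (hD v hvs ?_ hv2 hvh)
    rw [D.eig_of h l.hH _ 2 two_ne_zero hve]
    refine Finset.sum_eq_zero fun β _ => ?_
    by_cases hc : D.cf β ⁅e, (v:L)⁆ = 0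
    · rw [hc]; simp
    · exfalso
      apply hc
      apply hv1
      apply h2
      · exact D.ss s l.sH _ 0 β (by rw [hse, zero_smul]) hc
      · have := D.ss h l.hH _ 2 β hve hc
        rw [l.lev_eq] at this
        exact_mod_cast this
  have h3 := LinearMap.finrank_le_finrank_of_injective (LinearMap.ker_eq_bot.1 hf)
  rw [D.finrank_U, Module.finrank_prod, Module.finrank_fintype_fun_eq_card, Fintype.card_coe, Subspace.dual_finrank_eq] at h3
  omega
end RD

end

section
open Module LieAlgebra

theorem CVcram {K : Type*} [Field K] {a1 a2 a3 b1 b2 b3 c1 c2 c3 x y z : K} (e1 : a1*x+a2*y+a3*z=0) (e2 : b1*x+b2*y+b3*z=0) (e3 : c1*x+c2*y+c3*z=0)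
   (hd : a1*(b2*c3-b3*c2)-a2*(b1*c3-b3*c1)+a3*(b1*c2-b2*c1) ≠ 0) : x = 0 ∧ y = 0 ∧ z = 0 := by
  refine ⟨(mul_eq_zero.1 ?_).resolve_left hd, (mul_eq_zero.1 ?_).resolve_left hd, (mul_eq_zero.1 ?_).resolve_left hd⟩
  · linear_combination (b2*c3-b3*c2)*e1 - (a2*c3-a3*c2)*e2 + (a2*b3-a3*b2)*e3
  · linear_combination -(b1*c3-b3*c1)*e1 + (a1*c3-a3*c1)*e2 - (a1*b3-a3*b1)*e3
  · linear_combination (b1*c2-b2*c1)*e1 - (a1*c2-a2*c1)*e2 + (a1*b2-a2*b1)*e3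

/-- integral determinant -/
def CVdet (a1 a2 a3 b1 b2 b3 c1 c2 c3 : ℤ) : ℤ := a1*(b2*c3-b3*c2)-a2*(b1*c3-b3*c1)+a3*(b1*c2-b2*c1)

set_option maxRecDepth 100000 in
theorem CVdets : ∀ p ∈ ([0,-1] : List ℤ), ∀ q ∈ ([0,-1] : List ℤ), ∀ r ∈ ([0,-1] : List ℤ), ∀ m ∈ ([1,0,-1] : List ℤ), ∀ n ∈ ([1,0,-1] : List ℤ), ∀ k ∈ ([1,0,-1] : List ℤ),
   CVdet (2-2*m) (p-2*m) (q-2*m) (p-2*n) (2-2*n) (r-2*n) (q-2*k) (r-2*k) (2-2*k) ≠ 0 ∨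
   CVdet (m-4) (n-4) (k-4) (p-2*n) (2-2*n) (r-2*n) (q-2*k) (r-2*k) (2-2*k) ≠ 0 ∨
   CVdet (2-2*m) (p-2*m) (q-2*m) (m-4) (n-4) (k-4) (q-2*k) (r-2*k) (2-2*k) ≠ 0 ∨
   CVdet (2-2*m) (p-2*m) (q-2*m) (p-2*n) (2-2*n) (r-2*n) (m-4) (n-4) (k-4) ≠ 0 := by
  decide

theorem CVcramZ {K : Type*} [Field K] [CharZero K] {a1 a2 a3 b1 b2 b3 c1 c2 c3 : ℤ} {x y z : K} (e1 : a1*x+a2*y+a3*z=0) (e2 : b1*x+b2*y+b3*z=0) (e3 : c1*x+c2*y+c3*z=0)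
   (hd : CVdet a1 a2 a3 b1 b2 b3 c1 c2 c3 ≠ 0) : x = 0 ∧ y = 0 ∧ z = 0 := by
  refine CVcram e1 e2 e3 ?_
  unfold CVdet at hd
  exact_mod_cast hd

namespace RD
variable {K L : Type*} [Field K] [CharZero K] [LieRing L] [LieAlgebra K L] [FiniteDimensional K L]
  {R : Type*} [Fintype R] {D : RD K L R}

local notation "κ" => killingForm K L

theorem dep (s : L) (n : ℕ) (hS : finrank K (D.S s) < n) (v : Fin n → R) (hv : ∀ i, κ (D.t (v i)) s = 0) :
    ∃ c : Fin n → K, ∑ i, c i • D.t (v i) = 0 ∧ ∃ i, c i ≠ 0 := by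
  let u : Fin n → D.S s := fun i => ⟨D.t (v i), D.t_S (hv i)⟩
  have : ¬ LinearIndependent K u := fun hu => by
    have := hu.fintype_card_le_finrank
    simp at this; omega
  rw [Fintype.not_linearIndependent_iff] at this
  obtain ⟨c, hc, hi⟩ := this
  refine ⟨c, ?_, hi⟩
  have := congrArg (Submodule.subtype _) hc
  simpa [u] using this

theorem p_rel {n : ℕ} {v : Fin n → R} {c : Fin n → K} (h : ∑ i, c i • D.t (v i) = 0) (δ : R) : ∑ i, c i * (D.p (v i) δ : K) = 0 := by
  have h1 : κ (∑ i, c i • D.t (v i)) (D.t δ) = 0 := by rw [h]; simp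
  rw [map_sum, LinearMap.sum_apply] at h1
  have h2 : (∑ i, c i * (D.p (v i) δ : K)) * κ (D.t δ) (D.t δ) = 0 := by
    rw [Finset.sum_mul]
    have h3 : ∑ i, 2 * κ (c i • D.t (v i)) (D.t δ) = 0 := by rw [← Finset.mul_sum, h1, mul_zero]
    rw [← h3]
    refine Finset.sum_congr rfl fun i _ => ?_
    rw [map_smul, LinearMap.smul_apply, smul_eq_mul]
    linear_combination -(c i) * D.pq (v i) δ
  exact (mul_eq_zero.1 h2).resolve_right (D.ktt_ne δ)

variable {s e h : L} {lev : R → ℤ}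

theorem Lv.lev_rel (l : D.Lv s e h lev) {n : ℕ} {v : Fin n → R} {c : Fin n → K} (hh : ∑ i, c i • D.t (v i) = 0) : ∑ i, c i * (lev (v i) : K) = 0 := by
  have h1 : κ (∑ i, c i • D.t (v i)) h = 0 := by rw [hh]; simp
  rw [map_sum, LinearMap.sum_apply] at h1
  rw [← h1]
  refine Finset.sum_congr rfl fun i _ => ?_
  rw [map_smul, LinearMap.smul_apply, smul_eq_mul, l.lev_eq]

/-- relation of length three -/
theorem Lv.dep3 (l : D.Lv s e h lev) (hS : finrank K (D.S s) ≤ 2) {x y z : R} (hx : κ (D.t x) s = 0) (hy : κ (D.t y) s = 0) (hz : κ (D.t z) s = 0) :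
    ∃ a b c : K, (a ≠ 0 ∨ b ≠ 0 ∨ c ≠ 0) ∧ a • D.t x + b • D.t y + c • D.t z = 0 ∧ a * lev x + b * lev y + c * lev z = 0 ∧
      ∀ δ, a * D.p x δ + b * D.p y δ + c * D.p z δ = 0 := by
  obtain ⟨c, hc, i, hi⟩ := dep (D := D) s 3 (by omega) ![x, y, z] (by intro i; fin_cases i <;> simpa)
  have h1 := l.lev_rel hc
  have h2 := p_rel hc
  simp only [Fin.sum_univ_three, Matrix.cons_val] at hc h1 h2
  refine ⟨c 0, c 1, c 2, ?_, hc, h1, h2⟩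
  fin_cases i <;> simp_all

theorem Lv.dep4 (l : D.Lv s e h lev) (hS : finrank K (D.S s) ≤ 3) {x y z w : R} (hx : κ (D.t x) s = 0) (hy : κ (D.t y) s = 0) (hz : κ (D.t z) s = 0) (hw : κ (D.t w) s = 0) :
    ∃ a b c d : K, (a ≠ 0 ∨ b ≠ 0 ∨ c ≠ 0 ∨ d ≠ 0) ∧ a * lev x + b * lev y + c * lev z + d * lev w = 0 ∧
      ∀ δ, a * D.p x δ + b * D.p y δ + c * D.p z δ + d * D.p w δ = 0 := by
  obtain ⟨c, hc, i, hi⟩ := dep (D := D) s 4 (by omega) ![x, y, z, w] (by intro i; fin_cases i <;> simpa)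
  have h1 := l.lev_rel hc
  have h2 := p_rel hc
  simp only [Fin.sum_univ_four, Matrix.cons_val] at hc h1 h2
  refine ⟨c 0, c 1, c 2, c 3, ?_, h1, h2⟩
  fin_cases i <;> simp_all

theorem Lv.ne_of (l : D.Lv s e h lev) {α β : R} (hab : lev α ≠ lev β) (hab' : lev α ≠ - lev β) : α ≠ β ∧ α ≠ D.neg β := by
  constructor
  · rintro rfl; exact hab rfl
  · rintro rfl; exact hab' (l.lev_neg β)

theorem Lv.c2a (l : D.Lv s e h lev) (hS : finrank K (D.S s) ≤ 2) (hP : ¬ D.P 3) (F2 : Finset R)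
    (h2 : ∀ α ∈ F2, κ (D.t α) s = 0 ∧ lev α = 2) (hc : 4 ≤ F2.card) {β : R} (hβ : κ (D.t β) s = 0) (hβ0 : lev β = 0) : False := by
  have hinj : ∀ α ∈ F2, ∀ α' ∈ F2, D.p α β = D.p α' β → α = α' := by
    intro α hα α' hα' hp
    obtain ⟨a, b, c, hne, hr, hl, hp'⟩ := l.dep3 hS (h2 α hα).1 (h2 α' hα').1 hβ
    have hq := hp' β
    rw [(h2 α hα).2, (h2 α' hα').2, hβ0] at hl
    rw [D.p_self, hp] at hq
    push_cast at hl hq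
    have e1 : b = -a := by linear_combination hl/2
    have e2 : c = 0 := by linear_combination hq/2 - (D.p α' β : K)/2 * e1
    rw [e1, e2, zero_smul, add_zero, neg_smul, ← sub_eq_add_neg, ← smul_sub] at hr
    have ha : a ≠ 0 := by
      rintro rfl
      rw [e1, e2] at hne; simp at hne
    exact D.tinj _ _ (sub_eq_zero.1 ((smul_eq_zero.1 hr).resolve_left ha))
  have hb : ∀ α ∈ F2, -2 ≤ D.p α β ∧ D.p α β ≤ 2 := fun α hα => by
    obtain ⟨h3, h4⟩ := l.ne_of (α := α) (β := β) (by rw [(h2 α hα).2, hβ0]; omega) (by rw [(h2 α hα).2, hβ0]; omega)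
    have h5 := D.p_ge (n := 2) hP h3 h4
    have h6 := D.p_le (n := 2) hP h3 h4
    exact ⟨by simpa using h5, by simpa using h6⟩
  have h12 : ∀ β : R, κ (D.t β) s = 0 → lev β = 0 → ∀ α ∈ F2, ∀ α' ∈ F2, D.p α β = 1 → D.p α' β = 2 → False := by
    intro β hβ hβ0 α hα α' hα' hp1 hp2
    obtain ⟨a, b, c, hne, hr, hl, hp'⟩ := l.dep3 hS (h2 α hα).1 (h2 α' hα').1 hβ
    have hq := hp' β
    have hq2 := hp' α
    rw [(h2 α hα).2, (h2 α' hα').2, hβ0] at hl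
    rw [D.p_self, hp1, hp2] at hq
    rw [D.p_self] at hq2
    push_cast at hl hq hq2
    have e1 : b = -a := by linear_combination hl/2
    have e2 : c = a/2 := by linear_combination hq/2 - e1
    have ha : a ≠ 0 := by
      rintro rfl
      rw [e1, e2] at hne; simp at hne
    have e3 : 2 * D.p α' α = 4 + D.p β α := by
      have : (2 * D.p α' α : K) = 4 + D.p β α := by
        refine mul_left_cancel₀ ha ?_
        rw [e1, e2] at hq2
        linear_combination -2 * hq2
      exact_mod_cast this
    have h3 : 0 < D.p β α := D.p_pos.1 (by omega)
    have hne : α' ≠ α := by rintro rfl; omega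
    have hne' : α' ≠ D.neg α := by
      intro h4
      have := l.lev_neg α
      rw [← h4, (h2 α hα).2, (h2 α' hα').2] at this
      omega
    have h5 := D.p_le (n := 2) hP hne hne'
    push_cast at h5
    omega
  have hbn : κ (D.t (D.neg β)) s = 0 := by rw [D.tneg, map_neg, LinearMap.neg_apply, hβ, neg_zero]
  have hbn0 : lev (D.neg β) = 0 := by rw [l.lev_neg, hβ0, neg_zero]
  have hcard : F2.card ≤ (Finset.Icc (-1:ℤ) 1).card := by
    refine Finset.card_le_card_of_injOn (fun α => Int.sign (D.p α β)) ?_ ?_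
    · intro α hα
      rcases lt_trichotomy (D.p α β) 0 with hh | hh | hh
      · simp [Int.sign_eq_neg_one_of_neg hh]
      · simp [hh]
      · simp [Int.sign_eq_one_of_pos hh]
    · intro α hα α' hα' hss
      simp only at hss
      apply hinj α hα α' hα'
      have a1 := hb α hα
      have a2 := hb α' hα'
      have b1 := h12 β hβ hβ0 α hα α' hα'
      have b2 := h12 β hβ hβ0 α' hα' α hα
      have b3 := h12 _ hbn hbn0 α hα α' hα'
      have b4 := h12 _ hbn hbn0 α' hα' α hα
      rw [D.p_neg_right, D.p_neg_right] at b3 b4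
      rcases lt_trichotomy (D.p α β) 0 with hh | hh | hh <;> rcases lt_trichotomy (D.p α' β) 0 with hh' | hh' | hh' <;>
        simp only [Int.sign_eq_neg_one_of_neg, Int.sign_eq_one_of_pos, Int.sign_zero, hh, hh'] at hss <;> first | omega | skip
      · by_contra hne
        have : (D.p α β = -1 ∧ D.p α' β = -2) ∨ (D.p α' β = -1 ∧ D.p α β = -2) := by omega
        rcases this with ⟨t1, t2⟩ | ⟨t1, t2⟩
        · exact b3 (by omega) (by omega)
        · exact b4 (by omega) (by omega)
      · by_contra hne
        have : (D.p α β = 1 ∧ D.p α' β = 2) ∨ (D.p α' β = 1 ∧ D.p α β = 2) := by omega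
        rcases this with ⟨t1, t2⟩ | ⟨t1, t2⟩
        · exact b1 (by omega) (by omega)
        · exact b2 (by omega) (by omega)
  simp at hcard
  omega

theorem Lv.c2b [IsKilling K L] (l : D.Lv s e h lev) (hS : finrank K (D.S s) ≤ 2) (hP : ¬ D.P 3) (F2 : Finset R)
    (h2 : ∀ α ∈ F2, κ (D.t α) s = 0 ∧ lev α = 2) (hc : 2 ≤ F2.card) (h0 : ∀ β, κ (D.t β) s = 0 → lev β ≠ 0)
    {γ : R} (hγ : κ (D.t γ) s = 0) (hγ1 : lev γ = 1) : False := by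
  obtain ⟨α1, γ', hα1, hl1, hγ', hγ1', ht⟩ := l.phi1 hγ hγ1
  have hne : γ ≠ γ' := by
    rintro rfl
    rcases D.red α1 γ 2 (by rw [ht, two_smul]) with h3 | h3
    · norm_num at h3
    · have : (3:K) = 0 := by linear_combination h3
      norm_num at this
  have hne' : γ ≠ D.neg γ' := by
    rintro rfl
    rw [l.lev_neg] at hγ1; omega
  have hnes : γ' ≠ D.neg γ := fun h5 => hne' (by rw [h5, D.neg_neg])
  obtain ⟨α2, hα2, hne2⟩ : ∃ α2 ∈ F2, α2 ≠ α1 := by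
    by_contra hcon
    push Not at hcon
    have : F2 ⊆ {α1} := fun a ha => Finset.mem_singleton.2 (hcon a ha)
    have := Finset.card_le_card this
    simp at this; omega
  have hp1 : ∀ α, κ (D.t α) s = 0 → lev α = 2 → ∀ γ, κ (D.t γ) s = 0 → lev γ = 1 → D.p α γ ≤ 1 := by
    intro α hα hα2 γ hγ hγ1
    by_contra hcon
    obtain ⟨h3, h4⟩ := l.ne_of (α := α) (β := γ) (by omega) (by omega)
    obtain ⟨δ, hδ⟩ := D.sub2_root h3 h4 (by omega)
    refine h0 δ ?_ ?_
    · rw [hδ, map_sub, map_zsmul, LinearMap.sub_apply, LinearMap.smul_apply, hα, hγ]; simp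
    · have := l.lev_lin (α := α) (β := γ) (γ := δ) (m := 1) (n := -2) (by rw [hδ]; simp [sub_eq_add_neg])
      omega
  have ht1 := fun δ => D.p_lin γ γ' δ α1 1 1 (by simpa using ht)
  have m1 := hp1 α1 hα1 hl1 γ hγ hγ1
  have m2 := hp1 α1 hα1 hl1 γ' hγ' hγ1'
  rw [ht1, D.p_self] at m1 m2
  have m3 := D.p_ge (n := 2) hP hne hne'
  have m4 := D.p_ge (n := 2) hP hne.symm hnes
  have s1 := hp1 α2 (h2 _ hα2).1 (h2 _ hα2).2 γ hγ hγ1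
  have s2 := hp1 α2 (h2 _ hα2).1 (h2 _ hα2).2 γ' hγ' hγ1'
  have m5 : ¬ (D.p γ γ' = -2 ∧ D.p γ' γ = -2) := by
    rintro ⟨u1, u2⟩
    have v1 := D.pq α1 γ
    have v2 := D.pq α1 γ'
    rw [ht1, D.p_self, u2] at v1
    rw [ht1, D.p_self, u1] at v2
    apply D.ktt_ne α1
    have : κ (D.t α1) (D.t α1) = κ (D.t α1) (D.t γ) + κ (D.t α1) (D.t γ') := by
      rw [← map_add, ← ht]
    push_cast at v1 v2
    rw [this]
    linear_combination v1/2 + v2/2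
  obtain ⟨a, b, c, hnz, hr, hl, hp'⟩ := l.dep3 hS (h2 _ hα2).1 hγ hγ'
  have hq1 := hp' γ
  have hq2 := hp' γ'
  rw [(h2 _ hα2).2, hγ1, hγ1'] at hl
  rw [D.p_self] at hq1 hq2
  have ha : a ≠ 0 := by
    rintro rfl
    push_cast at hl
    have e1 : c = -b := by linear_combination hl
    rw [e1, zero_smul, zero_add, neg_smul, ← sub_eq_add_neg, ← smul_sub] at hr
    rcases smul_eq_zero.1 hr with h5 | h5
    · rw [e1, h5] at hnz; simp at hnz
    · exact hne (D.tinj _ _ (sub_eq_zero.1 h5))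
  have fin : b = -a → False := by
    intro e1
    have e2 : c = -a := by push_cast at hl; linear_combination hl - e1
    rw [e1, e2] at hr
    have : a • (D.t α2 - (D.t γ + D.t γ')) = 0 := by rw [← hr]; module
    rcases smul_eq_zero.1 this with h5 | h5
    · exact ha h5
    · exact hne2 (D.tinj _ _ (by rw [ht]; exact sub_eq_zero.1 h5))
  have cases : (D.p γ γ' = -1 ∧ D.p γ' γ = -1) ∨ (D.p γ γ' = -1 ∧ D.p γ' γ = -2) ∨ (D.p γ γ' = -2 ∧ D.p γ' γ = -1) := by
    push_cast at m3 m4; omega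
  rcases cases with ⟨u1, u2⟩ | ⟨u1, u2⟩ | ⟨u1, u2⟩
  · rw [u2] at hq1; rw [u1] at hq2
    push_cast at hq1 hq2 hl
    have e3 : (D.p α2 γ + D.p α2 γ' : ℤ) = 2 := by
      have : ((D.p α2 γ + D.p α2 γ' : ℤ) : K) = ((2 : ℤ) : K) := by
        refine mul_left_cancel₀ ha ?_
        push_cast; linear_combination hq1 + hq2 - hl
      exact_mod_cast this
    have e4 : D.p α2 γ = 1 := by omega
    rw [e4] at hq1
    push_cast at hq1
    apply fin
    linear_combination hq1/3 + hl/3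
  · rw [u2] at hq1; rw [u1] at hq2
    push_cast at hq1 hq2 hl
    have e3 : (3 * D.p α2 γ + 4 * D.p α2 γ' : ℤ) = 4 := by
      have : ((3 * D.p α2 γ + 4 * D.p α2 γ' : ℤ) : K) = ((4 : ℤ) : K) := by
        refine mul_left_cancel₀ ha ?_
        push_cast; linear_combination 3*hq1 + 4*hq2 - 2*hl
      exact_mod_cast this
    have e4 : D.p α2 γ = 0 := by omega
    rw [e4] at hq1
    push_cast at hq1
    apply fin
    linear_combination hq1/4 + hl/2
  · rw [u2] at hq1; rw [u1] at hq2
    push_cast at hq1 hq2 hl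
    have e3 : (4 * D.p α2 γ + 3 * D.p α2 γ' : ℤ) = 4 := by
      have : ((4 * D.p α2 γ + 3 * D.p α2 γ' : ℤ) : K) = ((4 : ℤ) : K) := by
        refine mul_left_cancel₀ ha ?_
        push_cast; linear_combination 4*hq1 + 3*hq2 - 2*hl
      exact_mod_cast this
    have e4 : D.p α2 γ' = 0 := by omega
    rw [e4] at hq2
    push_cast at hq2
    apply fin
    linear_combination hl/2 - hq2/4
end RD

end

section
open Module LieAlgebra

namespace RD
variable {K L : Type*} [Field K] [CharZero K] [LieRing L] [LieAlgebra K L] [FiniteDimensional K L]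
  {R : Type*} [Fintype R] {D : RD K L R}

local notation "κ" => killingForm K L

variable {s e h : L} {lev : R → ℤ}

theorem pb1 (hP : ¬ D.P 2) {α β : R} (h : α ≠ β) (h' : α ≠ D.neg β) : -1 ≤ D.p α β ∧ D.p α β ≤ 1 := by
  have h5 := D.p_ge (n := 1) hP h h'
  have h6 := D.p_le (n := 1) hP h h'
  exact ⟨by simpa using h5, by simpa using h6⟩

theorem Lv.ne2 (l : D.Lv s e h lev) {α β : R} (ha : lev α = 2) (hb : lev β = 2) : α ≠ D.neg β := by
  rintro rfl
  rw [l.lev_neg] at ha; omega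

theorem Lv.sub_lev (l : D.Lv s e h lev) {α β : R} (ha : κ (D.t α) s = 0) (hb : κ (D.t β) s = 0) (h1 : α ≠ β) (h2 : α ≠ D.neg β) (hp : 0 < D.p α β) :
    ∃ γ, κ (D.t γ) s = 0 ∧ lev γ = lev α - lev β ∧ ∀ δ, D.p γ δ = D.p α δ - D.p β δ := by
  obtain ⟨γ, hγ⟩ := D.sub_root h1 h2 hp
  have e1 : D.t γ = (1:ℤ) • D.t α + (-1:ℤ) • D.t β := by rw [hγ]; simp [sub_eq_add_neg]
  refine ⟨γ, by rw [hγ, map_sub, LinearMap.sub_apply, ha, hb, sub_zero], ?_, fun δ => ?_⟩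
  · rw [l.lev_lin e1]; ring
  · rw [D.p_lin α β δ γ 1 (-1) e1]; ring

theorem Lv.c3core (l : D.Lv s e h lev) (hS : finrank K (D.S s) ≤ 3) (hP : ¬ D.P 2) {β α α' γ : R} (hβ : κ (D.t β) s = 0) (hβ0 : lev β = 0)
    (hF : ∀ δ, κ (D.t δ) s = 0 → lev δ = 0 → D.p δ β = 2 ∨ D.p δ β = -2)
    (hα : κ (D.t α) s = 0 ∧ lev α = 2) (hα' : κ (D.t α') s = 0 ∧ lev α' = 2) (hγ : κ (D.t γ) s = 0 ∧ lev γ = 2)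
    (hne : α ≠ α') (p1 : D.p α β = 1) (p2 : D.p α' β = 1) (p3 : D.p γ β = 0) : False := by
  have hag : α ≠ γ := by rintro rfl; omega
  have hag' : α' ≠ γ := by rintro rfl; omega
  have key : ∀ x y, κ (D.t x) s = 0 ∧ lev x = 2 → κ (D.t y) s = 0 ∧ lev y = 2 → x ≠ y → D.p x β = 1 → (0 ≤ D.p y β) → D.p x y ≤ 0 := by
    intro x y hx hy hxy q1 q2
    by_contra hcon
    obtain ⟨δ, d1, d2, d3⟩ := l.sub_lev hx.1 hy.1 hxy (l.ne2 hx.2 hy.2) (by omega)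
    have h3 := d3 β
    have h4 := hF δ d1 (by omega)
    have hyb := l.ne_of (α := y) (β := β) (by omega) (by omega)
    have := pb1 hP hyb.1 hyb.2
    omega
  have k1 := key α α' hα hα' hne p1 (by omega)
  have k2 := key α γ hα hγ hag p1 (by omega)
  have k3 := key α' γ hα' hγ hag' p2 (by omega)
  have hab := l.ne_of (α := α) (β := β) (by omega) (by omega)
  have hab' := l.ne_of (α := α') (β := β) (by omega) (by omega)
  have hgb' := l.ne_of (α := γ) (β := β) (by omega) (by omega)
  have s1 := D.p_symm hP hab.1 hab.2
  have s2 := D.p_symm hP hab'.1 hab'.2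
  have s3 := D.p_symm hP hgb'.1 hgb'.2
  have s4 := D.p_symm hP hne (l.ne2 hα.2 hα'.2)
  have s5 := D.p_symm hP hag (l.ne2 hα.2 hγ.2)
  have s6 := D.p_symm hP hag' (l.ne2 hα'.2 hγ.2)
  have k4 : D.p α α' = 0 := by
    obtain ⟨μ, d1, d2, d3⟩ := l.sub_lev hα.1 hβ hab.1 hab.2 (by omega)
    have h3 := d3 α'
    have h4 := d3 β
    rw [D.p_self] at h4
    have hma : μ ≠ α' := by rintro rfl; omega
    have := pb1 hP hma (l.ne2 (by omega) hα'.2)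
    omega
  obtain ⟨a, a', c, d, hnz, hl, hp⟩ := l.dep4 hS hα.1 hα'.1 hγ.1 hβ
  have r1 := hp β
  have r2 := hp α
  have r3 := hp α'
  rw [hα.2, hα'.2, hγ.2, hβ0] at hl
  rw [p1, p2, p3, D.p_self] at r1
  rw [D.p_self, ← s4, k4, ← s1, p1] at r2
  rw [D.p_self, k4, ← s2, p2] at r3
  push_cast at hl r1 r2 r3
  have e1 : c = 2 * d := by linear_combination hl/2 - r1
  have e2 : d * (((D.p γ α + D.p γ α' - 1 : ℤ)) : K) = 0 := by
    push_cast
    rw [e1] at r2 r3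
    linear_combination r2/2 + r3/2 - r1
  have e3 : d = 0 := by
    rcases mul_eq_zero.1 e2 with h5 | h5
    · exact h5
    · have : (D.p γ α + D.p γ α' - 1 : ℤ) = 0 := by exact_mod_cast h5
      omega
  rw [e3] at e1 r2 r3
  simp only [mul_zero] at e1
  rw [e1] at r2 r3
  have e4 : a = 0 := by linear_combination r2/2
  have e5 : a' = 0 := by linear_combination r3/2
  rw [e1, e3, e4, e5] at hnz
  simp at hnz

theorem Lv.c3a (l : D.Lv s e h lev) (hS : finrank K (D.S s) ≤ 3) (hP : ¬ D.P 2) (F0 F2 : Finset R)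
    (h0 : ∀ β, κ (D.t β) s = 0 → lev β = 0 → β ∈ F0)
    (h2 : ∀ α ∈ F2, κ (D.t α) s = 0 ∧ lev α = 2) (hc : 3 + F0.card ≤ F2.card) {β : R} (hβ : κ (D.t β) s = 0) (hβ0 : lev β = 0) : False := by
  classical
  have hbn : κ (D.t (D.neg β)) s = 0 := by rw [D.tneg, map_neg, LinearMap.neg_apply, hβ, neg_zero]
  have hbn0 : lev (D.neg β) = 0 := by rw [l.lev_neg, hβ0, neg_zero]
  have nn : ∀ δ, D.neg δ ≠ δ := by
    intro δ hd
    have := D.p_neg_left δ δ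
    rw [hd, D.p_self] at this; omega
  have hpb : ∀ α ∈ F2, -1 ≤ D.p α β ∧ D.p α β ≤ 1 := by
    intro α hα
    have := h2 α hα
    have hab := l.ne_of (α := α) (β := β) (by omega) (by omega)
    exact pb1 hP hab.1 hab.2
  have h3 : ∀ c : ℤ, (F2.filter (fun α => D.p α β = c)).card ≤ 2 := by
    intro m
    by_contra hcon
    push Not at hcon
    obtain ⟨x, y, z, hx, hy, hz, hxy, hxz, hyz⟩ := Finset.two_lt_card_iff.1 hcon
    rw [Finset.mem_filter] at hx hy hz
    obtain ⟨hx, hx'⟩ := hx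
    obtain ⟨hy, hy'⟩ := hy
    obtain ⟨hz, hz'⟩ := hz
    replace hx := h2 x hx
    replace hy := h2 y hy
    replace hz := h2 z hz
    obtain ⟨a, b, c, d, hnz, hl, hp⟩ := l.dep4 hS hx.1 hy.1 hz.1 hβ
    have r1 := hp β
    have r2 := hp x
    have r3 := hp y
    have r4 := hp z
    have s1 := D.p_symm hP hxy (l.ne2 hx.2 hy.2)
    have s2 := D.p_symm hP hxz (l.ne2 hx.2 hz.2)
    have s3 := D.p_symm hP hyz (l.ne2 hy.2 hz.2)
    have b1 := pb1 hP hxy (l.ne2 hx.2 hy.2)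
    have b2 := pb1 hP hxz (l.ne2 hx.2 hz.2)
    have b3 := pb1 hP hyz (l.ne2 hy.2 hz.2)
    rw [hx.2, hy.2, hz.2, hβ0] at hl
    rw [hx', hy', hz', D.p_self] at r1
    push_cast at hl r1
    have ed : d = 0 := by linear_combination r1/2 - (m:K)/4*hl
    have ea : a = -b-c := by linear_combination hl/2
    rw [ed, ea, D.p_self] at r2 r3 r4
    rw [← s1, ← s2] at r2
    rw [← s3] at r3
    generalize D.p x y = p at *
    generalize D.p x z = q at *
    generalize D.p y z = r at *
    have u1 : c * ((q + r - p - 2 : ℤ) : K) = 0 := by push_cast at *; linear_combination r2 + r3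
    have u2 : b * ((p + r - q - 2 : ℤ) : K) = 0 := by push_cast at *; linear_combination r2 + r4
    have v1 : b = 0 ∨ (p + r - q - 2 : ℤ) = 0 := by
      rcases mul_eq_zero.1 u2 with h | h
      · exact Or.inl h
      · exact Or.inr (by exact_mod_cast h)
    have v2 : c = 0 ∨ (q + r - p - 2 : ℤ) = 0 := by
      rcases mul_eq_zero.1 u1 with h | h
      · exact Or.inl h
      · exact Or.inr (by exact_mod_cast h)
    have v3 : c = 0 → b = 0 := by
      rintro rfl
      have : b * ((p - 2 : ℤ) : K) = 0 := by push_cast at *; linear_combination r2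
      refine (mul_eq_zero.1 this).resolve_right ?_
      intro h5
      have : (p - 2 : ℤ) = 0 := by exact_mod_cast h5
      omega
    have v4 : b = 0 → c = 0 := by
      rintro rfl
      have : c * ((q - 2 : ℤ) : K) = 0 := by push_cast at *; linear_combination r2
      refine (mul_eq_zero.1 this).resolve_right ?_
      intro h5
      have : (q - 2 : ℤ) = 0 := by exact_mod_cast h5
      omega
    have : b = 0 ∧ c = 0 := by
      rcases v1 with h | h
      · exact ⟨h, v4 h⟩
      · rcases v2 with h' | h'
        · exact ⟨v3 h', h'⟩
        · omega
    rw [ed, ea, this.1, this.2] at hnz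
    simp at hnz
  have hcard : F2.card = ∑ c ∈ ({-1, 0, 1} : Finset ℤ), (F2.filter (fun α => D.p α β = c)).card := by
    apply Finset.card_eq_sum_card_fiberwise
    intro α hα
    have := hpb α hα
    have : D.p α β = -1 ∨ D.p α β = 0 ∨ D.p α β = 1 := by omega
    simpa using this
  rw [Finset.sum_insert (by simp), Finset.sum_insert (by simp), Finset.sum_singleton] at hcard
  have c1 := h3 (-1)
  have c2 := h3 0
  have c3 := h3 1
  have hF : ∀ δ, κ (D.t δ) s = 0 → lev δ = 0 → D.p δ β = 2 ∨ D.p δ β = -2 := by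
    intro δ hδ hδ0
    by_contra hcon
    have n1 : δ ≠ β := by rintro rfl; exact hcon (Or.inl (D.p_self _))
    have n2 : δ ≠ D.neg β := by rintro rfl; exact hcon (Or.inr (by rw [D.p_neg_left, D.p_self]))
    have hdn : κ (D.t (D.neg δ)) s = 0 := by rw [D.tneg, map_neg, LinearMap.neg_apply, hδ, neg_zero]
    have hdn0 : lev (D.neg δ) = 0 := by rw [l.lev_neg, hδ0, neg_zero]
    have n3 : D.neg δ ≠ β := by rintro rfl; exact n2 (by rw [D.neg_neg])
    have n4 : D.neg δ ≠ D.neg β := by intro h5; exact n1 (by rw [← D.neg_neg δ, h5, D.neg_neg])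
    have : ({β, D.neg β, δ, D.neg δ} : Finset R).card = 4 := by
      rw [Finset.card_insert_of_notMem, Finset.card_insert_of_notMem, Finset.card_insert_of_notMem, Finset.card_singleton]
      · simpa using (nn δ).symm
      · simp only [Finset.mem_insert, Finset.mem_singleton, not_or]; exact ⟨n2.symm, n4.symm⟩
      · simp only [Finset.mem_insert, Finset.mem_singleton, not_or]; exact ⟨(nn β).symm, n1.symm, n3.symm⟩
    have h5 : ({β, D.neg β, δ, D.neg δ} : Finset R) ⊆ F0 := by
      intro x hx
      simp only [Finset.mem_insert, Finset.mem_singleton] at hx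
      rcases hx with rfl | rfl | rfl | rfl
      exacts [h0 _ hβ hβ0, h0 _ hbn hbn0, h0 _ hδ hδ0, h0 _ hdn hdn0]
    have := Finset.card_le_card h5
    omega
  have h5 : 2 ≤ F0.card := by
    have h5 : ({β, D.neg β} : Finset R) ⊆ F0 := by
      intro x hx
      simp only [Finset.mem_insert, Finset.mem_singleton] at hx
      rcases hx with rfl | rfl
      exacts [h0 _ hβ hβ0, h0 _ hbn hbn0]
    have := Finset.card_le_card h5
    rwa [Finset.card_pair (nn β).symm] at this
  obtain ⟨γ, hγ⟩ := Finset.card_pos.1 (show 0 < (F2.filter (fun α => D.p α β = 0)).card by omega)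
  rw [Finset.mem_filter] at hγ
  have : 1 < (F2.filter (fun α => D.p α β = 1)).card ∨ 1 < (F2.filter (fun α => D.p α β = -1)).card := by omega
  rcases this with h6 | h6
  · obtain ⟨α, hα, α', hα', hne⟩ := Finset.one_lt_card.1 h6
    rw [Finset.mem_filter] at hα hα'
    exact l.c3core hS hP hβ hβ0 hF (h2 _ hα.1) (h2 _ hα'.1) (h2 _ hγ.1) hne hα.2 hα'.2 hγ.2
  · obtain ⟨α, hα, α', hα', hne⟩ := Finset.one_lt_card.1 h6
    rw [Finset.mem_filter] at hα hα'
    refine l.c3core hS hP hbn hbn0 ?_ (h2 _ hα.1) (h2 _ hα'.1) (h2 _ hγ.1) hne (by rw [D.p_neg_right, hα.2]; rfl) (by rw [D.p_neg_right, hα'.2]; rfl) (by rw [D.p_neg_right, hγ.2]; rfl)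
    intro δ h7 h8
    rw [D.p_neg_right]
    have := hF δ h7 h8
    omega

theorem Lv.c3b (l : D.Lv s e h lev) (hS : finrank K (D.S s) ≤ 3) (hP : ¬ D.P 2) (F2 : Finset R)
    (h2 : ∀ α ∈ F2, κ (D.t α) s = 0 ∧ lev α = 2) (hc : 3 ≤ F2.card) (h0 : ∀ β, κ (D.t β) s = 0 → lev β ≠ 0)
    {γ : R} (hγ : κ (D.t γ) s = 0) (hγ1 : lev γ = 1) : False := by
  classical
  obtain ⟨x, y, z, hx, hy, hz, hxy, hxz, hyz⟩ := Finset.two_lt_card_iff.1 (show 2 < F2.card by omega)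
  replace hx := h2 x hx
  replace hy := h2 y hy
  replace hz := h2 z hz
  have key : ∀ x y, κ (D.t x) s = 0 ∧ lev x = 2 → κ (D.t y) s = 0 ∧ lev y = 2 → x ≠ y → D.p y x = D.p x y ∧ D.p x y ∈ ([0, -1] : List ℤ) := by
    intro x y hx hy hxy
    refine ⟨(D.p_symm hP hxy (l.ne2 hx.2 hy.2)).symm, ?_⟩
    have b1 := pb1 hP hxy (l.ne2 hx.2 hy.2)
    have : ¬ 0 < D.p x y := by
      intro hcon
      obtain ⟨δ, d1, d2, d3⟩ := l.sub_lev hx.1 hy.1 hxy (l.ne2 hx.2 hy.2) hcon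
      exact h0 δ d1 (by omega)
    have : D.p x y = 0 ∨ D.p x y = -1 := by omega
    simpa using this
  have key2 : ∀ x, κ (D.t x) s = 0 ∧ lev x = 2 → D.p γ x = D.p x γ ∧ D.p x γ ∈ ([1, 0, -1] : List ℤ) := by
    intro x hx
    have hab := l.ne_of (α := x) (β := γ) (by omega) (by omega)
    refine ⟨(D.p_symm hP hab.1 hab.2).symm, ?_⟩
    have b1 := pb1 hP hab.1 hab.2
    have : D.p x γ = 1 ∨ D.p x γ = 0 ∨ D.p x γ = -1 := by omega
    simpa using this
  obtain ⟨s1, m1⟩ := key x y hx hy hxy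
  obtain ⟨s2, m2⟩ := key x z hx hz hxz
  obtain ⟨s3, m3⟩ := key y z hy hz hyz
  obtain ⟨s4, m4⟩ := key2 x hx
  obtain ⟨s5, m5⟩ := key2 y hy
  obtain ⟨s6, m6⟩ := key2 z hz
  obtain ⟨a, b, c, d, hnz, hl, hp⟩ := l.dep4 hS hx.1 hy.1 hz.1 hγ
  have r1 := hp x
  have r2 := hp y
  have r3 := hp z
  have r4 := hp γ
  rw [hx.2, hy.2, hz.2, hγ1] at hl
  rw [D.p_self, s1, s2, s4] at r1
  rw [D.p_self, s3, s5] at r2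
  rw [D.p_self, s6] at r3
  rw [D.p_self] at r4
  have hdd := CVdets _ m1 _ m2 _ m3 _ m4 _ m5 _ m6
  generalize D.p x y = p at *
  generalize D.p x z = q at *
  generalize D.p y z = r at *
  generalize D.p x γ = m at *
  generalize D.p y γ = n at *
  generalize D.p z γ = k at *
  have ed : d = -2*(a+b+c) := by push_cast at hl; linear_combination hl
  rw [ed] at r1 r2 r3 r4
  have t1 : ((2-2*m : ℤ):K) * a + ((p-2*m : ℤ):K)*b + ((q-2*m : ℤ):K)*c = 0 := by push_cast at *; linear_combination r1
  have t2 : ((p-2*n : ℤ):K) * a + ((2-2*n : ℤ):K)*b + ((r-2*n : ℤ):K)*c = 0 := by push_cast at *; linear_combination r2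
  have t3 : ((q-2*k : ℤ):K) * a + ((r-2*k : ℤ):K)*b + ((2-2*k : ℤ):K)*c = 0 := by push_cast at *; linear_combination r3
  have t4 : ((m-4 : ℤ):K) * a + ((n-4 : ℤ):K)*b + ((k-4 : ℤ):K)*c = 0 := by push_cast at *; linear_combination r4
  have : a = 0 ∧ b = 0 ∧ c = 0 := by
    rcases hdd with h | h | h | h
    · exact CVcramZ t1 t2 t3 h
    · exact CVcramZ t4 t2 t3 h
    · exact CVcramZ t1 t4 t3 h
    · exact CVcramZ t1 t2 t4 h
  obtain ⟨rfl, rfl, rfl⟩ := this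
  rw [ed] at hnz
  simp at hnz
end RD

end

section
open Module LieAlgebra

namespace RD
variable {K L : Type*} [Field K] [CharZero K] [LieRing L] [LieAlgebra K L] [FiniteDimensional K L]
  {R : Type*} [Fintype R] {D : RD K L R}

local notation "κ" => killingForm K L

variable {s e h : L} {lev : R → ℤ}

/-- weight vectors are multiples of root vectors -/
theorem wt_mul {v : L} {δ : R} (hv : ∀ a ∈ D.H, ⁅a, v⁆ = κ (D.t δ) a • v) : ∃ c : K, v = c • D.rv δ := by
  classical
  have e1 := D.eig_of (D.t δ) (D.tH δ) v _ (D.ktt_ne δ) (hv _ (D.tH δ))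
  refine ⟨D.cf δ v / D.cf δ (D.rv δ), ?_⟩
  conv_lhs => rw [e1]
  refine Finset.sum_eq_single δ ?_ (by simp)
  intro β _ hβ
  by_cases hc : D.cf β v = 0
  · rw [hc]; simp
  · exfalso
    apply hβ
    apply D.tinj
    rw [← sub_eq_zero]
    refine D.hzero _ (D.H.sub_mem (D.tH _) (D.tH _)) fun α => ?_
    have := D.ss _ (D.tH α) v _ β (hv _ (D.tH α)) hc
    rw [map_sub, sub_eq_zero, CVkcomm, this, CVkcomm]

theorem wt_br {α γ δ : R} (ht : D.t δ = D.t α + D.t γ) : ∃ c : K, ⁅D.rv α, D.rv γ⁆ = c • D.rv δ := by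
  refine D.wt_mul fun a ha => ?_
  rw [leibniz_lie, D.rv_eig _ _ ha, D.rv_eig _ _ ha, ht, smul_lie, lie_smul, map_add, LinearMap.add_apply, add_smul]

theorem t_indep {α γ : R} (h1 : γ ≠ α) (h2 : γ ≠ D.neg α) {y z : K} (hr : y • D.t α + z • D.t γ = 0) : y = 0 ∧ z = 0 := by
  have hz : z = 0 := by
    by_contra hz
    apply D.t_ne_t h1 h2 (-(z⁻¹ * y))
    have : z⁻¹ • (y • D.t α + z • D.t γ) = 0 := by rw [hr, smul_zero]
    rw [smul_add, smul_smul, smul_smul, inv_mul_cancel₀ hz, one_smul] at this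
    rw [neg_smul]
    exact (neg_eq_of_add_eq_zero_right this).symm
  refine ⟨?_, hz⟩
  rw [hz, zero_smul, add_zero] at hr
  exact (smul_eq_zero.1 hr).resolve_right (D.tne α)

theorem Lv.cls (l : D.Lv s e h lev) (hS : finrank K (D.S s) ≤ 2) (hP : ¬ D.P 2) {α γ : R} (hα : κ (D.t α) s = 0) (hγ : κ (D.t γ) s = 0)
    (h1 : γ ≠ α) (h2 : γ ≠ D.neg α) (hp : 0 ≤ D.p γ α) : ∃ δ, κ (D.t δ) s = 0 ∧ D.p γ δ < 0 ∧ (∃ m : K, D.t δ = m • D.t α - D.t γ) ∧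
      ∀ β, κ (D.t β) s = 0 → 0 ≤ D.p β α → β = α ∨ β = γ ∨ β = δ := by
  have b0 := pb1 hP h1 h2
  have s0 := D.p_symm hP h1 h2
  have key : ∀ β, κ (D.t β) s = 0 → 0 ≤ D.p β α → β ≠ α → β ≠ γ → β ≠ D.neg γ → ∃ x y z : K, x ≠ 0 ∧ x • D.t β + y • D.t α + z • D.t γ = 0 ∧
      D.p β α ≤ 1 ∧ -1 ≤ D.p β γ ∧ D.p β γ ≤ 1 ∧ x * D.p β α + y * 2 + z * D.p γ α = 0 ∧ x * D.p β γ + y * D.p γ α + z * 2 = 0 ∧ x * 2 + y * D.p β α + z * D.p β γ = 0 := by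
    intro β hβ q0 n1 n3 n4
    have n2 : β ≠ D.neg α := by
      rintro rfl
      rw [D.p_neg_left, D.p_self] at q0; omega
    obtain ⟨x, y, z, hnz, hr, hl, hq⟩ := l.dep3 hS hβ hα hγ
    refine ⟨x, y, z, ?_, hr, (pb1 hP n1 n2).2, (pb1 hP n3 n4).1, (pb1 hP n3 n4).2, ?_, ?_, ?_⟩
    · rintro rfl
      rw [zero_smul, zero_add] at hr
      have := D.t_indep h1 h2 hr
      rw [this.1, this.2] at hnz; simp at hnz
    · have := hq α
      rw [D.p_self] at this; push_cast at this; exact this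
    · have := hq γ
      rw [D.p_self, ← s0] at this; push_cast at this; exact this
    · have := hq β
      rw [D.p_self, ← D.p_symm hP n1 n2, ← D.p_symm hP n3 n4] at this; push_cast at this; exact this
  have hc : D.p γ α = 0 ∨ D.p γ α = 1 := by omega
  rcases hc with hc | hc
  · refine ⟨D.neg γ, by rw [D.tneg, map_neg, LinearMap.neg_apply, hγ, neg_zero], by rw [D.p_neg_right, D.p_self]; omega, ⟨0, by rw [D.tneg]; simp⟩, ?_⟩
    intro β hβ q0
    by_contra hcon
    push Not at hcon
    obtain ⟨x, y, z, hx, hr, c1, c2, c3, e1, e2, e3⟩ := key β hβ q0 hcon.1 hcon.2.1 hcon.2.2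
    rw [hc] at e1 e2
    generalize D.p β α = P at *
    generalize D.p β γ = Q at *
    have : x * ((4 - P*P - Q*Q : ℤ) : K) = 0 := by
      push_cast at *
      linear_combination 2*e3 - (P:K)*e1 - (Q:K)*e2
    have : (4 - P*P - Q*Q : ℤ) = 0 := by
      have := (mul_eq_zero.1 this).resolve_left hx
      exact_mod_cast this
    nlinarith
  · obtain ⟨μ, hμ⟩ := D.sub_root h1 h2 (by omega)
    have ht : D.t (D.neg μ) = (1:K) • D.t α - D.t γ := by rw [D.tneg, hμ, one_smul]; abel
    have hpp : ∀ β, D.p (D.neg μ) β = D.p α β - D.p γ β := fun β => by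
      rw [D.p_lin α γ β (D.neg μ) 1 (-1) (by rw [ht]; simp [sub_eq_add_neg])]; ring
    have hpd : D.p (D.neg μ) γ < 0 := by rw [hpp, D.p_self, ← s0, hc]; omega
    refine ⟨D.neg μ, by rw [ht, one_smul, map_sub, LinearMap.sub_apply, hα, hγ, sub_zero], ?_, ⟨1, ht⟩, ?_⟩
    · have h5 := D.p_pos (α := D.neg γ) (β := D.neg μ)
      rw [D.p_neg_left γ (D.neg μ), D.p_neg_right (D.neg μ) γ] at h5
      have := h5.2 (by omega)
      omega
    intro β hβ q0
    by_contra hcon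
    push Not at hcon
    have n5 : β ≠ D.neg γ := by
      rintro rfl
      rw [D.p_neg_left] at q0; omega
    obtain ⟨x, y, z, hx, hr, c1, c2, c3, e1, e2, e3⟩ := key β hβ q0 hcon.1 hcon.2.1 n5
    rw [hc] at e1 e2
    have h6 : D.p β α = 1 ∧ D.p β γ = -1 := by
      generalize D.p β α = P at *
      generalize D.p β γ = Q at *
      have : x * ((3 - P*P + P*Q - Q*Q : ℤ) : K) = 0 := by
        push_cast at *
        linear_combination (3/2)*e3 - (P:K)*(2*e1-e2)/2 - (Q:K)*(2*e2-e1)/2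
      have : (3 - P*P + P*Q - Q*Q : ℤ) = 0 := by
        have := (mul_eq_zero.1 this).resolve_left hx
        exact_mod_cast this
      have hP' : P = 0 ∨ P = 1 := by omega
      have hQ' : Q = -1 ∨ Q = 0 ∨ Q = 1 := by omega
      rcases hP' with rfl | rfl <;> rcases hQ' with rfl | rfl | rfl <;> first | omega | simp
    rw [h6.1] at e1
    rw [h6.2] at e2
    push_cast at e1 e2
    have ez : z = x := by linear_combination (2*e2-e1)/3
    have ey : y = -x := by linear_combination (2*e1-e2)/3
    apply hcon.2.2
    apply D.tinj
    rw [ez, ey] at hr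
    have : x • (D.t β - D.t (D.neg μ)) = 0 := by rw [ht, ← hr]; module
    exact sub_eq_zero.1 ((smul_eq_zero.1 this).resolve_left hx)

theorem Lv.nd [IsKilling K L] (l : D.Lv s e h lev) (hS : finrank K (D.S s) ≤ 2) (hP : ¬ D.P 2) {σ f : L} (hσ : σ ∈ D.H) (hσe : ⁅σ, e⁆ = 0)
    (hσz : σ ∉ zl K s) (he0 : e ≠ 0) (hsf : ⁅s, f⁆ = 0) (hef : ⁅e, f⁆ = 0) (hf : ∀ a ∈ zl K s, ∀ c : K, f ≠ a + c • e) :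
    ∀ u : L, ⁅s, u⁆ = 0 → ⁅e, u⁆ = 0 → ⁅f, u⁆ = 0 → ∃ a ∈ zl K s, ∃ c d : K, u = a + c • e + d • f := by
  classical
  obtain ⟨γ0, hγ0, hγσ⟩ : ∃ γ, κ (D.t γ) s = 0 ∧ κ (D.t γ) σ ≠ 0 := by
    by_contra hcon
    push Not at hcon
    exact hσz ((D.zl_iff l.sH).2 ⟨hσ, hcon⟩)
  obtain ⟨α, hαe⟩ : ∃ α, D.cf α e ≠ 0 := by
    by_contra hcon
    push Not at hcon
    apply he0
    rw [l.e_sum]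
    exact Finset.sum_eq_zero fun β _ => by rw [hcon]; simp
  obtain ⟨hα2, hα⟩ := l.e_lev hαe
  have hz := (D.lie_zero (v := e) hσ).1 hσe
  have hασ : κ (D.t α) σ = 0 := by
    by_contra hne
    exact hαe (hz α hne)
  have huniq : ∀ β, D.cf β e ≠ 0 → β = α := by
    intro β hβ
    obtain ⟨hβ2, hβs⟩ := l.e_lev hβ
    by_contra hne
    obtain ⟨x, y, z, hnz, hr, -, -⟩ := l.dep3 hS hα hβs hγ0
    have hβσ : κ (D.t β) σ = 0 := by
      by_contra hne
      exact hβ (hz β hne)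
    have h1 : κ (x • D.t α + y • D.t β + z • D.t γ0) σ = 0 := by rw [hr]; simp
    simp only [map_add, map_smul, LinearMap.add_apply, LinearMap.smul_apply, hασ, hβσ, smul_zero, zero_add] at h1
    have hz0 := (smul_eq_zero.1 h1).resolve_right hγσ
    rw [hz0, zero_smul, add_zero] at hr
    have := D.t_indep hne (l.ne2 hβ2 hα2) hr
    rw [this.1, this.2, hz0] at hnz; simp at hnz
  obtain ⟨ce, hce, ee⟩ : ∃ c : K, c ≠ 0 ∧ e = c • D.rv α := by
    refine ⟨D.cf α e / D.cf α (D.rv α), div_ne_zero hαe (D.cf_self α), ?_⟩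
    conv_lhs => rw [l.e_sum]
    refine Finset.sum_eq_single α ?_ (by simp)
    intro β _ hβ
    by_cases hc : D.cf β e = 0
    · rw [hc]; simp
    · exact absurd (huniq β hc) hβ
  have hrα : ∀ u : L, ⁅e, u⁆ = 0 → ⁅D.rv α, u⁆ = 0 := by
    intro u hu
    rw [ee, smul_lie] at hu
    exact (smul_eq_zero.1 hu).resolve_left hce
  -- choose γ
  obtain ⟨γ, hγ, h1, h2, hp⟩ : ∃ γ, κ (D.t γ) s = 0 ∧ γ ≠ α ∧ γ ≠ D.neg α ∧ 0 ≤ D.p γ α := by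
    have n1 : γ0 ≠ α := by rintro rfl; exact hγσ hασ
    have n2 : γ0 ≠ D.neg α := by
      rintro rfl
      rw [D.tneg, map_neg, LinearMap.neg_apply, hασ, neg_zero] at hγσ; exact hγσ rfl
    by_cases hp : 0 ≤ D.p γ0 α
    · exact ⟨γ0, hγ0, n1, n2, hp⟩
    · refine ⟨D.neg γ0, by rw [D.tneg, map_neg, LinearMap.neg_apply, hγ0, neg_zero], ?_, ?_, by rw [D.p_neg_left]; omega⟩
      · rintro rfl; exact n2 (by rw [D.neg_neg])
      · intro h5; exact n1 (by rw [← D.neg_neg γ0, h5, D.neg_neg])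
  obtain ⟨δ, hδ, hγδ, ⟨m, hm⟩, hcls⟩ := l.cls hS hP hα hγ h1 h2 hp
  have hda : δ ≠ α := by rintro rfl; omega
  have hdg : γ ≠ δ := by rintro rfl; rw [D.p_self] at hγδ; omega
  have hbr : ⁅D.rv γ, D.rv δ⁆ ≠ 0 := by
    intro h5
    apply D.br δ γ hγδ
    rw [← lie_skew, h5, neg_zero]
  have hzl : ∀ a ∈ D.H, κ (D.t α) a = 0 → κ (D.t γ) a = 0 → a ∈ zl K s := by
    intro a ha q1 q2
    rw [D.zl_iff l.sH]
    have q3 : κ (D.t δ) a = 0 := by rw [hm]; simp [q1, q2]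
    have h7 : ∀ β, κ (D.t β) s = 0 → 0 ≤ D.p β α → κ (D.t β) a = 0 := by
      intro β hβ hp
      rcases hcls β hβ hp with rfl | rfl | rfl <;> assumption
    refine ⟨ha, fun β hβ => ?_⟩
    by_cases hp : 0 ≤ D.p β α
    · exact h7 β hβ hp
    · have := h7 (D.neg β) (by rw [D.tneg, map_neg, LinearMap.neg_apply, hβ, neg_zero]) (by rw [D.p_neg_left]; omega)
      rw [D.tneg, map_neg, LinearMap.neg_apply, neg_eq_zero] at this
      exact this
  -- structure of centraliser elements
  have str : ∀ u : L, ⁅s, u⁆ = 0 → ⁅e, u⁆ = 0 → ∃ t' ∈ D.H, κ (D.t α) t' = 0 ∧ ∃ a b c : K, u = t' + a • D.rv α + b • D.rv γ + c • D.rv δ := by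
    intro u hsu heu
    have hu := hrα u heu
    have hk : ∀ w : L, κ u ⁅D.rv α, w⁆ = 0 := fun w => by
      rw [← CVkinv, ← lie_skew, hu]; simp
    obtain ⟨t', ht', eu⟩ := D.dec' u
    have hαu : κ (D.t α) u = 0 := by
      obtain ⟨c, hc, h6⟩ := D.brn α
      have := hk (D.rv (D.neg α))
      rw [h6, map_smul, smul_eq_zero] at this
      rw [CVkcomm]; exact this.resolve_left hc
    have hαt : κ (D.t α) t' = 0 := by
      rw [eu, map_add, map_sum, Finset.sum_eq_zero, add_zero] at hαu
      · exact hαu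
      · intro β _
        rw [map_smul, CVkcomm, D.kHr (D.tH α), smul_zero]
    have hvan : ∀ β, β ≠ α → β ≠ γ → β ≠ δ → D.cf β u = 0 := by
      intro β g1 g2 g3
      by_cases hβ : κ (D.t β) s = 0
      swap
      · exact (D.lie_zero l.sH).1 hsu β hβ
      have hp : D.p β α < 0 := by
        by_contra hcon
        rcases hcls β hβ (by omega) with h | h | h
        exacts [g1 h, g2 h, g3 h]
      by_cases hβα : β = D.neg α
      · have := hk (D.t α)
        rw [← lie_skew, D.rv_eig α _ (D.tH α), map_neg, map_smul, neg_eq_zero, smul_eq_zero] at this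
        unfold cf
        rw [hβα, D.neg_neg, CVkcomm]
        exact this.resolve_left (D.ktt_ne α)
      · have hb := pb1 hP g1 hβα
        obtain ⟨μ, hμ⟩ := D.str' g1 hβα 1 (by omega) (by omega)
        rw [one_smul] at hμ
        have hpm : D.p (D.neg μ) α < 0 := by
          rw [D.p_neg_left, D.p_lin β α α μ 1 1 (by simpa using hμ), D.p_self]; omega
        obtain ⟨c, hc⟩ := D.wt_br (α := α) (γ := D.neg μ) (δ := D.neg β) (by rw [D.tneg, D.tneg, hμ]; abel)
        have hc0 : c ≠ 0 := by
          rintro rfl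
          apply D.br α (D.neg μ) hpm
          rw [hc, zero_smul]
        have := hk (D.rv (D.neg μ))
        rw [hc, map_smul, smul_eq_zero] at this
        unfold cf
        rw [CVkcomm]
        exact this.resolve_left hc0
    refine ⟨t', ht', hαt, D.cf α u / D.cf α (D.rv α), D.cf γ u / D.cf γ (D.rv γ), D.cf δ u / D.cf δ (D.rv δ), ?_⟩
    conv_lhs => rw [eu]
    rw [add_assoc, add_assoc]
    congr 1
    have h9 : ∑ β, (D.cf β u / D.cf β (D.rv β)) • D.rv β = ∑ β ∈ ({α, γ, δ} : Finset R), (D.cf β u / D.cf β (D.rv β)) • D.rv β := by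
      symm
      refine Finset.sum_subset (Finset.subset_univ _) ?_
      intro β _ hβ
      simp only [Finset.mem_insert, Finset.mem_singleton, not_or] at hβ
      rw [hvan β hβ.1 hβ.2.1 hβ.2.2]; simp
    rw [h9, Finset.sum_insert (by simp [h1.symm, hda.symm]), Finset.sum_pair hdg]
  -- main computation
  obtain ⟨t, ht, hαt, a, b, c, ef⟩ := str f hsf hef
  have hδt : ∀ t', κ (D.t α) t' = 0 → κ (D.t δ) t' = - κ (D.t γ) t' := fun t' q1 => by
    rw [hm]; simp [q1]
  have cross : ∀ u : L, ⁅s, u⁆ = 0 → ⁅e, u⁆ = 0 → ⁅f, u⁆ = 0 → ∀ t' ∈ D.H, κ (D.t α) t' = 0 → ∀ a' b' c' : K, u = t' + a' • D.rv α + b' • D.rv γ + c' • D.rv δ →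
      κ (D.t γ) t * b' = b * κ (D.t γ) t' ∧ κ (D.t γ) t * c' = c * κ (D.t γ) t' ∧ b * c' = c * b' := by
    intro u hsu heu hfu t' ht' hαt' a' b' c' eu
    set F := t + b • D.rv γ + c • D.rv δ with hF
    set U := t' + b' • D.rv γ + c' • D.rv δ with hU
    have eF : F = f - a • D.rv α := by rw [ef, hF]; abel
    have eU : U = u - a' • D.rv α := by rw [eu, hU]; abel
    have h0 : ⁅F, U⁆ = 0 := by
      rw [eF, eU, sub_lie, lie_sub, lie_sub, hfu, smul_lie, hrα u heu, smul_lie, lie_smul, lie_smul, lie_self, ← lie_skew, hrα f hef]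
      simp
    have h3 : ⁅F, U⁆ = (κ (D.t γ) t * b' - b * κ (D.t γ) t') • D.rv γ + (c * κ (D.t γ) t' - κ (D.t γ) t * c') • D.rv δ + (b * c' - c * b') • ⁅D.rv γ, D.rv δ⁆ := by
      have w1 : ⁅D.rv γ, t'⁆ = - (κ (D.t γ) t' • D.rv γ) := by rw [← lie_skew, D.rv_eig _ _ ht']
      have w2 : ⁅D.rv δ, t'⁆ = κ (D.t γ) t' • D.rv δ := by rw [← lie_skew, D.rv_eig _ _ ht', hδt _ hαt']; module
      have w3 : ⁅D.rv δ, D.rv γ⁆ = - ⁅D.rv γ, D.rv δ⁆ := by rw [lie_skew]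
      rw [hF, hU]
      simp only [add_lie, lie_add, smul_lie, lie_smul, D.Hab _ ht _ ht', D.rv_eig _ _ ht, lie_self, w1, w2, w3, hδt _ hαt]
      module
    have cg : D.cf γ ⁅D.rv γ, D.rv δ⁆ = 0 := by
      unfold cf
      obtain ⟨c0, -, h6⟩ := D.brn γ
      rw [← CVkinv, ← lie_skew, h6, map_neg, LinearMap.neg_apply, map_smul, LinearMap.smul_apply, CVkcomm, D.kHr (D.tH γ)]; simp
    have cd : D.cf δ ⁅D.rv γ, D.rv δ⁆ = 0 := by
      unfold cf
      obtain ⟨c0, -, h6⟩ := D.brn δ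
      rw [CVkcomm, CVkinv, h6, map_smul, D.kHr (D.tH δ)]; simp
    rw [h0] at h3
    have i1 := congrArg (D.cf γ) h3
    have i2 := congrArg (D.cf δ) h3
    simp only [map_zero, map_add, map_smul, cg, cd, D.cf_ne hdg, D.cf_ne hdg.symm, smul_zero, add_zero, zero_add] at i1 i2
    have j1 := (smul_eq_zero.1 i1.symm).resolve_right (D.cf_self γ)
    have j2 := (smul_eq_zero.1 i2.symm).resolve_right (D.cf_self δ)
    rw [j1, j2, zero_smul, zero_smul, zero_add, zero_add] at h3
    have j3 := (smul_eq_zero.1 h3.symm).resolve_right hbr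
    exact ⟨sub_eq_zero.1 j1, (sub_eq_zero.1 j2).symm, sub_eq_zero.1 j3⟩
  intro u hsu heu hfu
  obtain ⟨t', ht', hαt', a', b', c', eu⟩ := str u hsu heu
  obtain ⟨r1, r2, r3⟩ := cross u hsu heu hfu t' ht' hαt' a' b' c' eu
  have concl : ∀ d : K, κ (D.t γ) t' = d * κ (D.t γ) t → b' = d * b → c' = d * c → ∃ a ∈ zl K s, ∃ c d : K, u = a + c • e + d • f := by
    intro d d1 d2 d3
    refine ⟨t' - d • t, hzl _ (D.H.sub_mem ht' (D.H.smul_mem _ ht)) (by simp [hαt, hαt']) (by simp [d1]), ce⁻¹ * (a' - d * a), d, ?_⟩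
    have : (ce⁻¹ * (a' - d * a)) • e = (a' - d * a) • D.rv α := by
      rw [ee, smul_smul]; congr 1; field_simp
    rw [this, eu, ef, d2, d3]
    module
  by_cases q1 : κ (D.t γ) t = 0
  swap
  · refine concl (κ (D.t γ) t' / κ (D.t γ) t) (by field_simp) ?_ ?_
    · field_simp; linear_combination r1
    · field_simp; linear_combination r2
  by_cases q2 : b = 0
  swap
  · refine concl (b' / b) ?_ (by field_simp) ?_
    · field_simp; linear_combination -r1
    · field_simp; linear_combination r3
  by_cases q3 : c = 0
  swap
  · refine concl (c' / c) ?_ ?_ (by field_simp)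
    · field_simp; linear_combination -r2
    · field_simp; linear_combination -r3
  exfalso
  refine hf t (hzl t ht hαt q1) (ce⁻¹ * a) ?_
  rw [ef, q2, q3, ee, smul_smul, show ce⁻¹ * a * ce = a by field_simp]
  simp
end RD

end

section
open Module LieAlgebra

section
variable {K L : Type*} [Field K] [IsAlgClosed K] [CharZero K] [LieRing L] [LieAlgebra K L] [FiniteDimensional K L] [IsKilling K L]

local notation "κ" => killingForm K L

theorem CVcomm_ad {a b : L} (h : ⁅a, b⁆ = 0) : Commute (ad K L a) (ad K L b) := by
  ext w
  simp only [Module.End.mul_apply, ad_apply]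
  rw [leibniz_lie, h]; simp

theorem CVjd {s n w : L} (hs : (ad K L s).IsSemisimple) (hn : IsNilpotent (ad K L n)) (hc : ⁅s, n⁆ = 0) (hw : ⁅s + n, w⁆ = 0) : ⁅s, w⁆ = 0 ∧ ⁅n, w⁆ = 0 := by
  have h1 : ad K L s w = (- ad K L n) w := by
    rw [add_lie] at hw
    simp only [LinearMap.neg_apply, ad_apply]
    exact eq_neg_of_add_eq_zero_left hw
  have hcm : Commute (ad K L s) (- ad K L n) := (CVcomm_ad hc).neg_right
  have h2 : ∀ k : ℕ, ((ad K L s)^k) w = ((- ad K L n)^k) w := by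
    intro k
    induction k with
    | zero => rfl
    | succ k ih =>
      rw [pow_succ, Module.End.mul_apply, h1, ← Module.End.mul_apply, (hcm.pow_left k).eq, Module.End.mul_apply, ih, ← Module.End.mul_apply, ← pow_succ']
  obtain ⟨k, hk⟩ := hn.neg
  have h3 : ∀ k : ℕ, ((ad K L s)^(k+1)) w = 0 → ad K L s w = 0 := by
    intro k
    induction k with
    | zero => intro h; simpa using h
    | succ k ih =>
      intro h
      apply ih
      rw [pow_succ', Module.End.mul_apply]
      apply CVss_kr hs
      rw [← h, pow_succ' _ (k+1), pow_succ' _ k]; rfl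
  have h4 : ⁅s, w⁆ = 0 := h3 k (by rw [pow_succ', Module.End.mul_apply, h2, hk]; simp)
  refine ⟨h4, ?_⟩
  rw [add_lie, h4, zero_add] at hw; exact hw

theorem CVLv {s e σ : L} (hs : (ad K L s).IsSemisimple) (he : IsNilpotent (ad K L e)) (hσ : (ad K L σ).IsSemisimple) (hse : ⁅s, e⁆ = 0) (hσe : ⁅σ, e⁆ = 0)
    (hsσ : ⁅s, σ⁆ = 0) : ∃ (H : LieSubalgebra K L) (_ : H.IsCartanSubalgebra), s ∈ H ∧ σ ∈ H ∧ ∃ (h : L) (lev : H.root → ℤ), (CVRD H).Lv s e h lev := by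
  obtain ⟨h, hh, h2, h3, h4, -, hintg, hnat⟩ := CVJM e s σ s he hs hσ hs hse hσe hse hsσ (lie_self s) (by rw [← lie_skew, hsσ, neg_zero])
  obtain ⟨H, hH, m1, m2, m3⟩ := CVCartan3 hs hσ hh hsσ h3 h4
  refine ⟨H, hH, m1, m2, h, ?_⟩
  have : ∀ α : H.root, ∃ n : ℤ, κ ((CVRD H).t α) h = n := fun α =>
    hintg _ _ ((CVRD H).rv_ne α) ((CVRD H).rv_eig α h m3)
  choose lev hlev using this
  exact ⟨lev, m1, m3, hse, h2, hlev, hnat⟩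

/-- the isotropy property -/
def Dst (K : Type*) {L : Type*} [Field K] [LieRing L] [LieAlgebra K L] [FiniteDimensional K L] (s e : L) : Prop :=
  ∀ v w : L, ⁅s, v⁆ = 0 → ⁅e, v⁆ = 0 → ⁅s, w⁆ = 0 → ⁅e, w⁆ = 0 → (∀ a ∈ zl K s, killingForm K L v a = 0) → killingForm K L v w = 0

theorem RD.Lv.hD {R : Type*} [Fintype R] {D : RD K L R} {s e h : L} {lev : R → ℤ} (l : D.Lv s e h lev) (hs : (ad K L s).IsSemisimple) (hd : Dst K s e) :
    ∀ v : L, ⁅s, v⁆ = 0 → ⁅e, v⁆ = 0 → (∀ a ∈ zl K s, κ v a = 0) → ⁅h, v⁆ = 0 → v = 0 := by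
  intro v hv he ha hh
  by_contra hne
  obtain ⟨P, p1, p2, p3, p4⟩ := CVproj hs
  have : ∃ w, v = ⁅e, w⁆ := by
    apply CVim_perp (K := K)
    intro u hu
    have h1 : κ v (P u) = 0 := by
      refine hd v _ hv he (p1 u) ?_ ha
      rw [← p3 e l.se, hu, map_zero]
    obtain ⟨w, hw⟩ := p2 u
    have h2 : κ v (u - P u) = 0 := by
      rw [hw, ← CVkinv, ← lie_skew, hv]; simp
    rw [map_sub, h1, sub_zero] at h2
    rw [CVkcomm, h2]
  obtain ⟨n, hn, h0⟩ := (l.nat v 0 hne (by rw [hh, zero_smul]) he).2 this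
  have : n = 0 := by exact_mod_cast h0.symm
  omega

theorem CVndst {s e : L} (hs : (ad K L s).IsSemisimple) (hd : ¬ Dst K s e) : ∃ σ : L, (ad K L σ).IsSemisimple ∧ ⁅s, σ⁆ = 0 ∧ ⁅e, σ⁆ = 0 ∧ σ ∉ zl K s := by
  by_contra hcon
  push Not at hcon
  apply hd
  have zn : ∀ w : L, w ∈ zl K s → (∀ a ∈ zl K s, κ w a = 0) → w = 0 := by
    intro w hw h0
    obtain ⟨H, hH, ha, -, -⟩ := CVCartan3 hs hs hs (lie_self s) (lie_self s) (lie_self s)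
    exact (CVRD H).lemZ ha hw h0
  have jd : ∀ u : L, ⁅s, u⁆ = 0 → ⁅e, u⁆ = 0 → ∃ σ ν : L, σ + ν = u ∧ σ ∈ zl K s ∧ IsNilpotent (ad K L ν) ∧ ⁅s, ν⁆ = 0 ∧ ⁅e, ν⁆ = 0 := by
    intro u h1 h2
    obtain ⟨σ, ν, e1, e2, e3, e4, -⟩ := CVjordan (K := K) u
    have f1 := e4 s (by rw [← lie_skew, h1, neg_zero])
    have f2 := e4 e (by rw [← lie_skew, h2, neg_zero])
    refine ⟨σ, ν, e1, ?_, e3, by rw [← lie_skew, f1.2, neg_zero], by rw [← lie_skew, f2.2, neg_zero]⟩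
    exact hcon σ e2 (by rw [← lie_skew, f1.1, neg_zero]) (by rw [← lie_skew, f2.1, neg_zero])
  have kz : ∀ ν : L, IsNilpotent (ad K L ν) → ⁅s, ν⁆ = 0 → ∀ a ∈ zl K s, κ ν a = 0 := by
    intro ν h1 h2 a ha
    exact CVknil h1 (by rw [← lie_skew, ha ν h2, neg_zero])
  have np : ∀ u : L, ⁅s, u⁆ = 0 → ⁅e, u⁆ = 0 → (∀ a ∈ zl K s, κ u a = 0) → κ u u = 0 := by
    intro u h1 h2 h3
    obtain ⟨σ, ν, e1, e2, e3, e4, e5⟩ := jd u h1 h2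
    have : σ = 0 := by
      apply zn σ e2
      intro a ha
      have := h3 a ha
      rw [← e1, map_add, LinearMap.add_apply, kz ν e3 e4 a ha, add_zero] at this
      exact this
    rw [this, zero_add] at e1
    rw [← e1]
    exact CVknil e3 (lie_self ν)
  intro v w h1 h2 h3 h4 h5
  obtain ⟨σ, ν, e1, e2, e3, e4, e5⟩ := jd w h3 h4
  have k1 := np v h1 h2 h5
  have k2 := np ν e4 e5 (kz ν e3 e4)
  have k3 := np (v + ν) (by rw [lie_add, h1, e4, add_zero]) (by rw [lie_add, h2, e5, add_zero]) (by
    intro a ha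
    rw [map_add, LinearMap.add_apply, h5 a ha, kz ν e3 e4 a ha, add_zero])
  simp only [map_add, LinearMap.add_apply] at k3
  rw [k1, k2, CVkcomm ν v] at k3
  rw [← e1, map_add, h5 σ e2, zero_add]
  have : (2:K) * κ v ν = 0 := by linear_combination k3
  simpa using this

theorem RD.P_mono {R : Type*} [Fintype R] {D : RD K L R} (h : D.P 3) : D.P 2 := by
  obtain ⟨α, β, h⟩ := h
  exact ⟨α, β, fun i h1 h2 => h i h1 (by omega)⟩

variable {xs xn ys yn : L}

theorem Stp.ker_le (h : Stp K xs xn ys yn) : LinearMap.ker (phi K (xs + xn) (ys + yn)) ≤ cl K xs xn ⊓ LinearMap.ker (ad K L yn) := by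
  intro u hu
  have h1 : ⁅xs + xn, u⁆ = 0 ∧ ⁅ys + yn, u⁆ = 0 := by
    have := LinearMap.mem_ker.1 hu
    have a1 := congrArg Prod.fst this
    have a2 := congrArg Prod.snd this
    exact ⟨neg_eq_zero.1 a1, neg_eq_zero.1 a2⟩
  have a := CVjd h.ss1 h.n1 h.c1 h1.1
  have b := CVjd h.ss2 h.n2 h.c6 h1.2
  exact ⟨⟨a.1, a.2⟩, b.2⟩

theorem CVker_ss {d0 : ℕ} (hd0 : ∀ (H : LieSubalgebra K L) [H.IsCartanSubalgebra], finrank K H = d0) {s : L} (hs : (ad K L s).IsSemisimple)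
    (hc : d0 < finrank K (LinearMap.ker (ad K L s))) : d0 + 2 ≤ finrank K (LinearMap.ker (ad K L s)) ∧ finrank K (zl K s) + 1 ≤ d0 := by
  classical
  obtain ⟨H, hH, ha, -, -⟩ := CVCartan3 hs hs hs (lie_self s) (lie_self s) (lie_self s)
  let D := CVRD H
  have hdH : finrank K D.H = d0 := hd0 H
  let Φ : Finset H.root := Finset.univ.filter fun α => κ (D.t α) s = 0
  have e1 : LinearMap.ker (ad K L s) = D.U Φ := by
    ext v
    rw [D.mem_U, LinearMap.mem_ker, ad_apply, D.lie_zero ha]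
    simp [Φ]
  have e2 := D.finrank_U Φ
  rw [← e1, hdH] at e2
  rw [e2] at hc ⊢
  obtain ⟨α, hα⟩ := Finset.card_pos.1 (show 0 < Φ.card by omega)
  have hα' : κ (D.t α) s = 0 := by simpa [Φ] using hα
  have hn : D.neg α ∈ Φ := by simp [Φ, D.tneg, hα']
  have hne : D.neg α ≠ α := by
    intro hd
    have := D.p_neg_left α α
    rw [hd, D.p_self] at this; omega
  have h2 : 1 < Φ.card := Finset.one_lt_card.2 ⟨_, hn, _, hα, hne⟩
  refine ⟨by omega, ?_⟩
  have h3 := D.S_dim (s := s) ha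
  have h4 : 0 < finrank K (D.S s) := by
    apply Module.finrank_pos_iff_exists_ne_zero.2
    exact ⟨⟨D.t α, D.t_S hα'⟩, fun h => D.tne α (congrArg Subtype.val h)⟩
  omega

theorem Stp.main (h : Stp K xs xn ys yn) (g2 : xn = 0 → yn = 0) (g3 : ∀ c : ℕ, finrank K (cl K xs xn) ≤ finrank K (cl K xs (xn + c • yn)))
    {d0 : ℕ} (hd0 : ∀ (H : LieSubalgebra K L) [H.IsCartanSubalgebra], finrank K H = d0)
    (hc : d0 < finrank K (LinearMap.ker (phi K (xs + xn) (ys + yn)))) :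
    (finrank K (TT K (xs + xn) (ys + yn)) + 2 ≤ finrank K L + d0) ∧
    ((∀ (H : LieSubalgebra K L) [H.IsCartanSubalgebra], ¬ (CVRD H).P 3) → finrank K (TT K (xs + xn) (ys + yn)) + 3 ≤ finrank K L + d0) ∧
    ((∀ (H : LieSubalgebra K L) [H.IsCartanSubalgebra], ¬ (CVRD H).P 2) → finrank K (TT K (xs + xn) (ys + yn)) + 4 ≤ finrank K L + d0) := by
  classical
  have hT := h.TT_dim
  have hT1 := h.T1_dim
  by_cases hx : xn = 0
  · have hy := g2 hx
    have hdep := h.T1_dep ⟨0, by rw [hy, zero_smul]⟩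
    have hsp : finrank K (Submodule.span K {xn}) = 0 := by rw [hx]; simp
    have hle : LinearMap.ker (phi K (xs + xn) (ys + yn)) = LinearMap.ker (ad K L xs) := by
      apply le_antisymm
      · exact fun u hu => (h.ker_le hu).1.1
      · intro u hu
        have hu' : ⁅xs, u⁆ = 0 := hu
        rw [LinearMap.mem_ker]
        simp [phi, hx, hy, hu', h.g1 u hu']
    rw [hle] at hc hdep
    have := CVker_ss hd0 h.ss1 hc
    refine ⟨?_, fun _ => ?_, fun _ => ?_⟩ <;> omega
  have hccl : d0 < finrank K (cl K xs xn) := lt_of_lt_of_le hc (Submodule.finrank_mono fun u hu => (h.ker_le hu).1)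
  have lowlev : ∀ (H : LieSubalgebra K L) [H.IsCartanSubalgebra] (hh : L) (lev : H.root → ℤ), (CVRD H).Lv xs xn hh lev →
      ∃ α, κ ((CVRD H).t α) xs = 0 ∧ (lev α = 0 ∨ lev α = 1) := by
    intro H _ hh lev l
    by_contra hcon
    push Not at hcon
    have := l.lemE hcon
    have h2 : finrank K (CVRD H).H = d0 := hd0 H
    omega
  have hr2 : finrank K (zl K xs) + 2 ≤ d0 := by
    obtain ⟨H, hH, m1, -, hh, lev, l⟩ := CVLv h.ss1 h.n1 h.ss1 h.c1 h.c1 (lie_self xs)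
    obtain ⟨α, hα, hl⟩ := lowlev H hh lev l
    have h3 := (CVRD H).S_dim (s := xs) m1
    have h2 : finrank K (CVRD H).H = d0 := hd0 H
    by_contra hcon
    obtain ⟨α0, hα0⟩ : ∃ α, (CVRD H).cf α xn ≠ 0 := by
      by_contra hcon
      push Not at hcon
      apply hx
      rw [l.e_sum]
      exact Finset.sum_eq_zero fun β _ => by rw [hcon]; simp
    obtain ⟨g1, g2⟩ := l.e_lev hα0
    obtain ⟨c, hc, i, hi⟩ := RD.dep (D := CVRD H) xs 2 (by omega) ![α, α0] (by intro i; fin_cases i <;> simpa)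
    have hne := l.ne_of (α := α0) (β := α) (by omega) (by omega)
    simp only [Fin.sum_univ_two, Matrix.cons_val] at hc
    have := (CVRD H).t_indep hne.1 hne.2 hc
    fin_cases i
    · exact hi this.1
    · exact hi this.2
  refine ⟨by omega, ?_⟩
  by_cases hdepn : ∃ l : K, yn = l • xn
  · have hdep := h.T1_dep hdepn
    have hsp : finrank K (Submodule.span K {xn}) ≤ 1 := (finrank_span_le_card {xn}).trans (by simp)
    refine ⟨fun _ => ?_, fun _ => ?_⟩ <;> omega
  have core : ∀ (H : LieSubalgebra K L) [H.IsCartanSubalgebra] (hh : L) (lev : H.root → ℤ), (CVRD H).Lv xs xn hh lev → Dst K xs xn →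
      ∃ F0 F2 : Finset H.root, (∀ β, β ∈ F0 ↔ κ ((CVRD H).t β) xs = 0 ∧ lev β = 0) ∧ (∀ β, β ∈ F2 ↔ κ ((CVRD H).t β) xs = 0 ∧ lev β = 2) ∧
        d0 + F0.card ≤ finrank K (zl K xs) + F2.card := by
    intro H _ hh lev l hD
    refine ⟨Finset.univ.filter fun β => κ ((CVRD H).t β) xs = 0 ∧ lev β = 0, Finset.univ.filter fun β => κ ((CVRD H).t β) xs = 0 ∧ lev β = 2, by simp, by simp, ?_⟩
    have h2 : finrank K (CVRD H).H = d0 := hd0 H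
    rw [← h2]
    refine l.dist2 (l.hD h.ss1 hD) _ _ ?_ ?_
    · intro α hα; simpa using hα
    · intro α h1 h2; simp [h1, h2]
  have two : (∀ (H : LieSubalgebra K L) [H.IsCartanSubalgebra], ¬ (CVRD H).P 3) → d0 = finrank K (zl K xs) + 2 → Dst K xs xn → False := by
    intro hP hr hD
    obtain ⟨H, hH, m1, -, hh, lev, l⟩ := CVLv h.ss1 h.n1 h.ss1 h.c1 h.c1 (lie_self xs)
    obtain ⟨F0, F2, f0, f2, hcard⟩ := core H hh lev l hD
    have h3 := (CVRD H).S_dim (s := xs) m1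
    have h2 : finrank K (CVRD H).H = d0 := hd0 H
    by_cases hex : ∃ β, κ ((CVRD H).t β) xs = 0 ∧ lev β = 0
    · obtain ⟨β, hβ, hβ0⟩ := hex
      have hne : (CVRD H).neg β ≠ β := by
        intro hd
        have := (CVRD H).p_neg_left β β
        rw [hd, (CVRD H).p_self] at this; omega
      have : 1 < F0.card := Finset.one_lt_card.2 ⟨(CVRD H).neg β, (f0 _).2 ⟨by rw [(CVRD H).tneg, map_neg, LinearMap.neg_apply, hβ, neg_zero], by rw [l.lev_neg, hβ0, neg_zero]⟩, β, (f0 _).2 ⟨hβ, hβ0⟩, hne⟩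
      exact l.c2a (by omega) (hP H) F2 (fun α hα => (f2 α).1 hα) (by omega) hβ hβ0
    · push Not at hex
      obtain ⟨γ, hγ, hl⟩ := lowlev H hh lev l
      exact l.c2b (by omega) (hP H) F2 (fun α hα => (f2 α).1 hα) (by omega) hex hγ (hl.resolve_left (hex γ hγ))
  refine ⟨fun hP => ?_, fun hP => ?_⟩
  · by_contra hcon
    have hd : finrank K L ≤ finrank K (T1 K xs xn ys yn) + finrank K (zl K xs) := by omega
    exact two hP (by omega) (fun v w a b c d e => h.dist g3 hd a b c d e)
  · by_contra hcon
    by_cases hr : d0 = finrank K (zl K xs) + 2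
    · have hnd : ¬ Dst K xs xn := two (fun H _ hp => hP H (RD.P_mono hp)) hr
      obtain ⟨σ, hσ, hsσ, heσ, hσz⟩ := CVndst h.ss1 hnd
      obtain ⟨H, hH, m1, m2, hh, lev, l⟩ := CVLv h.ss1 h.n1 hσ h.c1 (by rw [← lie_skew, heσ, neg_zero]) hsσ
      have h3 := (CVRD H).S_dim (s := xs) m1
      have h2 : finrank K (CVRD H).H = d0 := hd0 H
      have hf : ∀ a ∈ zl K xs, ∀ c : K, yn ≠ a + c • xn := by
        intro a ha c hfa
        have hn : IsNilpotent (ad K L a) := by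
          have : a = yn - c • xn := by rw [hfa]; abel
          rw [this, map_sub, map_smul]
          refine Commute.isNilpotent_sub ?_ h.n2 (h.n1.smul c)
          exact ((CVcomm_ad h.c5).symm).smul_right c
        have haH := (CVRD H).zl_H m1 ha
        have : a = 0 := (CVRD H).hzero a haH fun α => by
          rw [CVkcomm]; exact CVknil hn ((CVRD H).Hab _ haH _ ((CVRD H).tH α))
        exact hdepn ⟨c, by rw [hfa, this, zero_add]⟩
      have hnd := l.nd (by omega) (hP H) (f := yn) m2 (by rw [← lie_skew, heσ, neg_zero]) hσz hx h.c3 h.c5 hf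
      have hle : LinearMap.ker (phi K (xs + xn) (ys + yn)) ≤ (zl K xs ⊔ Submodule.span K {xn}) ⊔ Submodule.span K {yn} := by
        intro u hu
        obtain ⟨⟨u1, u2⟩, u3⟩ := h.ker_le hu
        obtain ⟨a, ha, c, d, rfl⟩ := hnd u u1 u2 u3
        exact Submodule.add_mem_sup (Submodule.add_mem_sup ha (Submodule.smul_mem _ _ (Submodule.mem_span_singleton_self _))) (Submodule.smul_mem _ _ (Submodule.mem_span_singleton_self _))
      have q1 := Submodule.finrank_mono hle
      have q2 := Submodule.finrank_add_le_finrank_add_finrank (zl K xs ⊔ Submodule.span K {xn}) (Submodule.span K {yn})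
      have q3 := Submodule.finrank_add_le_finrank_add_finrank (zl K xs) (Submodule.span K {xn})
      have hsp : ∀ v : L, finrank K (Submodule.span K {v}) ≤ 1 := fun v => (finrank_span_le_card {v}).trans (by simp)
      have := hsp xn
      have := hsp yn
      omega
    · have hr3 : d0 = finrank K (zl K xs) + 3 := by omega
      have hd : finrank K L ≤ finrank K (T1 K xs xn ys yn) + finrank K (zl K xs) := by omega
      have hD : Dst K xs xn := fun v w a b c d e => h.dist g3 hd a b c d e
      obtain ⟨H, hH, m1, -, hh, lev, l⟩ := CVLv h.ss1 h.n1 h.ss1 h.c1 h.c1 (lie_self xs)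
      obtain ⟨F0, F2, f0, f2, hcard⟩ := core H hh lev l hD
      have h3 := (CVRD H).S_dim (s := xs) m1
      have h2 : finrank K (CVRD H).H = d0 := hd0 H
      by_cases hex : ∃ β, κ ((CVRD H).t β) xs = 0 ∧ lev β = 0
      · obtain ⟨β, hβ, hβ0⟩ := hex
        exact l.c3a (by omega) (hP H) F0 F2 (fun β a b => (f0 β).2 ⟨a, b⟩) (fun α hα => (f2 α).1 hα) (by omega) hβ hβ0
      · push Not at hex
        obtain ⟨γ, hγ, hl⟩ := lowlev H hh lev l
        exact l.c3b (by omega) (hP H) F2 (fun α hα => (f2 α).1 hα) (by omega) hex hγ (hl.resolve_left (hex γ hγ))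
end

end

section
open Module LieAlgebra

theorem CVevent (K : Type*) {V : Type*} [Field K] [CharZero K] [AddCommGroup V] [Module K V] (u v : V) : ∃ N : ℕ, ∀ c : ℕ, N ≤ c → u + c • v = 0 → v = 0 := by
  by_cases h : ∃ c : ℕ, u + c • v = 0
  · obtain ⟨c, hc⟩ := h
    refine ⟨c + 1, fun d hd he => ?_⟩
    have : (d - c : ℕ) • v = 0 := by
      have e : d • v = (d - c) • v + c • v := by rw [← add_smul]; congr 1; omega
      have e2 : u + d • v = (d - c) • v + (u + c • v) := by rw [e]; abel
      rw [he, hc, add_zero] at e2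
      exact e2.symm
    rw [← Nat.cast_smul_eq_nsmul K] at this
    rcases smul_eq_zero.1 this with h | h
    · have := Nat.cast_eq_zero.1 h
      omega
    · exact h
  · exact ⟨0, fun c _ hc => absurd ⟨c, hc⟩ h⟩

section
variable {K L : Type*} [Field K] [IsAlgClosed K] [CharZero K] [LieRing L] [LieAlgebra K L] [FiniteDimensional K L] [IsKilling K L]

local notation "κ" => killingForm K L

theorem CVgen {a b : L} (ha : (ad K L a).IsSemisimple) (hb : (ad K L b).IsSemisimple) (hab : ⁅a, b⁆ = 0) :
    ∃ N : ℕ, ∀ c : ℕ, N ≤ c → ∀ v : L, ⁅a + c • b, v⁆ = 0 → ⁅a, v⁆ = 0 ∧ ⁅b, v⁆ = 0 := by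
  classical
  obtain ⟨H, hH, m1, m2, -⟩ := CVCartan3 ha hb hb hab hab (lie_self b)
  choose N hN using fun α : H.root => CVevent K (κ ((CVRD H).t α) a) (κ ((CVRD H).t α) b)
  refine ⟨∑ α, N α, fun c hc v hv => ?_⟩
  have m1' : a ∈ (CVRD H).H := m1
  have m2' : b ∈ (CVRD H).H := m2
  have m3 : a + c • b ∈ (CVRD H).H := add_mem m1' (nsmul_mem m2' c)
  have key := ((CVRD H).lie_zero m3).1 hv
  have : ∀ α, κ ((CVRD H).t α) (a + c • b) = 0 → κ ((CVRD H).t α) b = 0 := by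
    intro α h
    refine hN α c (le_trans (Finset.single_le_sum (f := N) (fun _ _ => Nat.zero_le _) (Finset.mem_univ α)) hc) ?_
    rw [← h, map_add, map_nsmul]
  have h2 : ⁅b, v⁆ = 0 := ((CVRD H).lie_zero m2').2 fun α hα => key α fun h => hα (this α h)
  refine ⟨?_, h2⟩
  rwa [add_lie, nsmul_lie, h2, nsmul_zero, add_zero] at hv

theorem CVmainII {x y : L} (hxy : ⁅x, y⁆ = 0)
    {d0 : ℕ} (hd0 : ∀ (H : LieSubalgebra K L) [H.IsCartanSubalgebra], finrank K H = d0)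
    (hc : d0 < finrank K (LinearMap.ker (phi K x y))) :
    (finrank K (TT K x y) + 2 ≤ finrank K L + d0) ∧
    ((∀ (H : LieSubalgebra K L) [H.IsCartanSubalgebra], ¬ (CVRD H).P 3) → finrank K (TT K x y) + 3 ≤ finrank K L + d0) ∧
    ((∀ (H : LieSubalgebra K L) [H.IsCartanSubalgebra], ¬ (CVRD H).P 2) → finrank K (TT K x y) + 4 ≤ finrank K L + d0) := by
  have sk : ∀ a b : L, ⁅a, b⁆ = 0 → ⁅b, a⁆ = 0 := fun a b h => by rw [← lie_skew, h, neg_zero]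
  obtain ⟨xs, xn, ex, xss, xnil, xc, -⟩ := CVjordan (K := K) x
  obtain ⟨ys, yn, ey, yss, ynil, yc, -⟩ := CVjordan (K := K) y
  have c1 : ⁅xs, xn⁆ = 0 := sk _ _ (xc xs (sk _ _ (xc x (lie_self x)).1)).2
  have c6 : ⁅ys, yn⁆ = 0 := sk _ _ (yc ys (sk _ _ (yc y (lie_self y)).1)).2
  have q1 := yc xs (sk _ _ (xc y hxy).1)
  have q2 := yc xn (sk _ _ (xc y hxy).2)
  obtain ⟨N1, hN1⟩ := CVgen xss yss (sk _ _ q1.1)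
  obtain ⟨N2, hN2⟩ := CVevent K xn yn
  let f : ℕ → ℕ := fun c => finrank K (cl K (xs + (N1 + N2 + c) • ys) (xn + (N1 + N2 + c) • yn))
  obtain ⟨c0, hc0⟩ : ∃ c0, ∀ c, f c0 ≤ f c := by
    exact ⟨Function.argmin f, fun c => Function.argmin_le f c⟩
  have stp : Stp K (xs + (N1 + N2 + c0) • ys) (xn + (N1 + N2 + c0) • yn) ys yn :=
    { ss1 := by
        rw [map_add, map_nsmul]
        refine Module.End.IsSemisimple.add_of_commute ((CVcomm_ad (sk _ _ q1.1)).smul_right _) xss ?_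
        rw [← Nat.cast_smul_eq_nsmul K]
        exact Module.End.IsSemisimple_smul _ yss
      ss2 := yss
      n1 := by
        rw [map_add, map_nsmul]
        exact ((CVcomm_ad (sk _ _ q2.2)).smul_right _).isNilpotent_add xnil (ynil.smul _)
      n2 := ynil
      c1 := by simp [c1, c6, sk _ _ q1.2, q2.1, sk _ _ q2.1]
      c2 := by simp [sk _ _ q1.1]
      c3 := by simp [sk _ _ q1.2, c6]
      c4 := by simp [sk _ _ q2.1, sk _ _ c6]
      c5 := by simp [sk _ _ q2.2]
      c6 := c6
      g1 := fun v hv => (hN1 _ (by omega) v hv).2 }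
  have g2 : xn + (N1 + N2 + c0) • yn = 0 → yn = 0 := hN2 _ (by omega)
  have g3 : ∀ c : ℕ, finrank K (cl K (xs + (N1 + N2 + c0) • ys) (xn + (N1 + N2 + c0) • yn)) ≤ finrank K (cl K (xs + (N1 + N2 + c0) • ys) (xn + (N1 + N2 + c0) • yn + c • yn)) := by
    intro c
    refine le_trans (hc0 (c0 + c)) (le_of_eq ?_)
    have e1 : xn + (N1 + N2 + (c0 + c)) • yn = xn + (N1 + N2 + c0) • yn + c • yn := by
      rw [add_assoc xn, ← add_smul, add_assoc (N1 + N2)]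
    have e2 : LinearMap.ker (ad K L (xs + (N1 + N2 + (c0 + c)) • ys)) = LinearMap.ker (ad K L (xs + (N1 + N2 + c0) • ys)) := by
      ext v
      constructor
      · intro h
        have := hN1 _ (by omega) v h
        change ⁅_, v⁆ = 0
        rw [add_lie, nsmul_lie, this.1, this.2, nsmul_zero, add_zero]
      · intro h
        have := hN1 _ (by omega) v h
        change ⁅_, v⁆ = 0
        rw [add_lie, nsmul_lie, this.1, this.2, nsmul_zero, add_zero]
    simp only [f]
    rw [e1, cl, e2, cl]
  have ex' : (xs + (N1 + N2 + c0) • ys) + (xn + (N1 + N2 + c0) • yn) = x + (N1 + N2 + c0) • y := by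
    rw [← ex, ← ey, smul_add]; abel
  set c := N1 + N2 + c0
  have hk : LinearMap.ker (phi K (x + c • y) y) = LinearMap.ker (phi K x y) := by
    ext v
    simp only [LinearMap.mem_ker, phi, LinearMap.prod_apply, Function.prod, LinearMap.neg_apply, ad_apply, Prod.mk_eq_zero, add_lie, nsmul_lie, neg_eq_zero]
    constructor
    · rintro ⟨a, b⟩
      rw [b, nsmul_zero, add_zero] at a
      exact ⟨a, b⟩
    · rintro ⟨a, b⟩
      rw [b, nsmul_zero, add_zero]
      exact ⟨a, rfl⟩
  have hm := stp.main g2 g3 hd0 (by rw [ex', ey, hk]; exact hc)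
  rw [ex', ey] at hm
  have hT : finrank K (TT K x y) ≤ finrank K (TT K (x + c • y) y) := by
    let F : L × L →ₗ[K] L × L := LinearMap.prod (LinearMap.fst K L L + c • LinearMap.snd K L L) (LinearMap.snd K L L)
    have Fi : Function.Injective F := by
      rintro ⟨a, b⟩ ⟨a', b'⟩ h
      have h1 : a + c • b = a' + c • b' := congrArg Prod.fst h
      have h2 : b = b' := congrArg Prod.snd h
      subst h2
      rw [add_right_cancel h1]
    rw [LinearEquiv.finrank_eq (Submodule.equivMapOfInjective F Fi (TT K x y))]
    refine Submodule.finrank_mono ?_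
    rw [TT, Submodule.map_span, Submodule.span_le]
    rintro _ ⟨_, ⟨D, hD, rfl⟩, rfl⟩
    refine Submodule.subset_span ⟨D, hD, ?_⟩
    change (D x + c • D y, D y) = _
    rw [map_add, map_nsmul]
  refine ⟨by omega, fun h => ?_, fun h => ?_⟩
  · have := hm.2.1 h; omega
  · have := hm.2.2 h; omega
end

end

section
open Module LieAlgebra

theorem CVavoid {k E ι : Type*} [Field k] [CharZero k] [AddCommGroup E] [Module k E] [Finite ι] (f : ι → E →ₗ[k] k) (hf : ∀ i, f i ≠ 0) : ∃ v, ∀ i, f i v ≠ 0 := by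
  by_contra hcon
  push Not at hcon
  obtain ⟨i, hi⟩ := Subspace.exists_eq_top_of_iUnion_eq_univ (p := fun i => LinearMap.ker (f i)) (by
    rw [Set.eq_univ_iff_forall]
    intro v
    obtain ⟨i, hi⟩ := hcon v
    exact Set.mem_iUnion.2 ⟨i, hi⟩)
  exact hf i (LinearMap.ker_eq_top.1 hi)

namespace RD
variable {K L : Type*} [Field K] [CharZero K] [LieRing L] [LieAlgebra K L] [FiniteDimensional K L]
  {R : Type*} [Fintype R] (D : RD K L R)

local notation "κ" => killingForm K L

/-- rational levels given by a regular element -/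
structure Rho (ρ : L) (lev : R → ℚ) : Prop where
  mem : ρ ∈ D.H
  lv : ∀ α, κ (D.t α) ρ = (lev α : K)
  ne : ∀ α, lev α ≠ 0

theorem exists_rho : ∃ ρ lev, D.Rho ρ lev := by
  classical
  have hq : ∀ α β, ∃ q : ℚ, κ (D.t α) (D.t β) = (q : K) := by
    intro α β
    obtain ⟨q, -, hq⟩ := D.rat β
    refine ⟨D.p α β * q / 2, ?_⟩
    have := D.pq α β
    rw [hq] at this
    push_cast
    linear_combination this / 2
  choose q hq using hq
  let f : R → (R → ℚ) →ₗ[ℚ] ℚ := fun α => ∑ β, q α β • LinearMap.proj β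
  have fap : ∀ α c, f α c = ∑ β, q α β * c β := by intro α c; simp [f]
  have hf : ∀ α, f α ≠ 0 := by
    intro α h
    have h1 : f α (Pi.single α 1) = 0 := by rw [h]; rfl
    rw [fap] at h1
    simp [Pi.single_apply] at h1
    apply D.ktt_ne α
    rw [hq, h1]; simp
  obtain ⟨c, hc⟩ := CVavoid f hf
  refine ⟨∑ β, (c β : K) • D.t β, fun α => f α c, ?_, ?_, hc⟩
  · exact Submodule.sum_mem _ fun β _ => Submodule.smul_mem _ _ (D.tH β)
  · intro α
    rw [fap, map_sum]
    push_cast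
    refine Finset.sum_congr rfl fun β _ => ?_
    rw [map_smul, hq, smul_eq_mul, mul_comm]

/-- projection to H -/
def pr : L →ₗ[K] L := LinearMap.id - ∑ β, ((D.cf β (D.rv β))⁻¹ • D.cf β).smulRight (D.rv β)

theorem pr_eq (v : L) : v = D.pr v + ∑ β, (D.cf β v / D.cf β (D.rv β)) • D.rv β := by
  simp only [pr, LinearMap.sub_apply, LinearMap.id_apply, LinearMap.sum_apply, LinearMap.smulRight_apply, LinearMap.smul_apply, smul_eq_mul]
  rw [sub_add, eq_comm, sub_eq_self, sub_eq_zero]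
  refine Finset.sum_congr rfl fun β _ => ?_
  rw [div_eq_inv_mul]

theorem pr_H (v : L) : D.pr v ∈ D.H := by
  obtain ⟨h, hh, e⟩ := D.dec' v
  have := D.pr_eq v
  have e2 : D.pr v = h := by
    have := this.symm.trans e
    exact add_right_cancel this
  rw [e2]; exact hh

theorem pr_of_H {v : L} (hv : v ∈ D.H) : D.pr v = v := by
  have := D.pr_eq v
  simp only [D.cf_H _ hv, zero_div, zero_smul, Finset.sum_const_zero, add_zero] at this
  exact this.symm

theorem cf_pr (α : R) (v : L) : D.cf α (D.pr v) = 0 := D.cf_H α (D.pr_H v)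

variable {D} {ρ : L} {lev : R → ℚ}

theorem keig {w u : L} {a b : K} (hw : ⁅ρ, w⁆ = a • w) (hu : ⁅ρ, u⁆ = b • u) (hab : a + b ≠ 0) : κ w u = 0 := by
  have h1 : κ ⁅ρ, w⁆ u = - κ w ⁅ρ, u⁆ := by
    rw [← lie_skew, map_neg, LinearMap.neg_apply, CVkinv]
  rw [hw, hu, map_smul, map_smul, LinearMap.smul_apply, smul_eq_mul, smul_eq_mul] at h1
  have h2 : (a + b) * κ w u = 0 := by linear_combination h1
  exact (mul_eq_zero.1 h2).resolve_left hab

theorem Rho.eig (r : D.Rho ρ lev) (α : R) : ⁅ρ, D.rv α⁆ = (lev α : K) • D.rv α := by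
  rw [D.rv_eig α ρ r.mem, r.lv]

theorem Rho.lneg (r : D.Rho ρ lev) (α : R) : lev (D.neg α) = - lev α := by
  have : ((lev (D.neg α) : ℚ) : K) = ((- lev α : ℚ) : K) := by
    rw [← r.lv, D.tneg, map_neg, LinearMap.neg_apply, r.lv]; push_cast; rfl
  exact_mod_cast this

variable (D lev) in
/-- the Borel subalgebra -/
def bb : Submodule K L := D.U (Finset.univ.filter fun α => 0 < lev α)

theorem mem_bb {x : L} : x ∈ D.bb lev ↔ ∀ α, lev α ≤ 0 → D.cf α x = 0 := by
  rw [bb, D.mem_U]; simp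

variable (D lev) in
/-- the filtration -/
structure Fil (l : ℚ) (v : L) : Prop where
  a : ∀ γ, lev γ < l → D.cf γ v = 0
  b : 0 < l → D.pr v = 0

theorem Rho.kw (r : D.Rho ρ lev) {w v : L} {m l : ℚ} (hw : ⁅ρ, w⁆ = (-m : K) • w) (hm : m < l) (hv : D.Fil lev l v) : κ w v = 0 := by
  rw [D.pr_eq v, map_add, map_sum]
  have h1 : κ w (D.pr v) = 0 := by
    by_cases h0 : m = 0
    · rw [hv.b (h0 ▸ hm), map_zero]
    · refine keig (b := 0) hw ?_ ?_
      · rw [D.Hab _ r.mem _ (D.pr_H v), zero_smul]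
      · rw [add_zero]; exact neg_ne_zero.2 (by exact_mod_cast h0)
  rw [h1, zero_add]
  refine Finset.sum_eq_zero fun γ _ => ?_
  rw [map_smul]
  by_cases h : lev γ = m
  · rw [hv.a γ (by rw [h]; exact hm)]; simp
  · rw [keig hw (r.eig γ), smul_zero]
    intro h2
    apply h
    have : ((lev γ : ℚ) : K) = (m : K) := by linear_combination h2
    exact_mod_cast this

theorem Rho.step (r : D.Rho ρ lev) {x v : L} {l : ℚ} (hx : x ∈ D.bb lev) (hv : D.Fil lev l v) {α : R} (hα : lev α ≤ l) :
    D.cf α ⁅x, v⁆ = κ (D.t α) (D.pr x) * D.cf α v := by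
  conv_lhs => rw [D.pr_eq x, add_lie, map_add, D.cf_lie α (D.pr_H x)]
  rw [add_eq_left, sum_lie, map_sum]
  refine Finset.sum_eq_zero fun β _ => ?_
  by_cases hb : lev β ≤ 0
  · rw [mem_bb.1 hx β hb]; simp
  · rw [smul_lie, map_smul]
    have : D.cf α ⁅D.rv β, v⁆ = 0 := by
      rw [cf, ← CVkinv]
      refine r.kw (m := lev α - lev β) (l := l) ?_ (by linarith) hv
      rw [leibniz_lie, r.eig, r.eig, r.lneg, smul_lie, lie_smul, ← add_smul]
      congr 1
      push_cast; ring
    rw [this, smul_zero]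

theorem Rho.stepH (r : D.Rho ρ lev) {x v : L} (hx : x ∈ D.bb lev) (hv : ∀ γ, lev γ < 0 → D.cf γ v = 0) :
    D.pr ⁅x, v⁆ = 0 := by
  refine D.hzero _ (D.pr_H _) fun δ => ?_
  have h1 : κ (D.t δ) ⁅x, v⁆ = κ (D.t δ) (D.pr ⁅x, v⁆) := by
    conv_lhs => rw [D.pr_eq ⁅x, v⁆, map_add, map_sum]
    rw [add_eq_left]
    refine Finset.sum_eq_zero fun β _ => ?_
    rw [map_smul, CVkcomm, D.kHr (D.tH δ), smul_zero]
  rw [← h1, ← CVkinv, D.pr_eq x, lie_add, D.Hab _ (D.tH δ) _ (D.pr_H x), zero_add, lie_sum, map_sum, LinearMap.sum_apply]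
  refine Finset.sum_eq_zero fun β _ => ?_
  by_cases hb : lev β ≤ 0
  · rw [mem_bb.1 hx β hb]; simp
  · rw [lie_smul, D.rv_eig _ _ (D.tH δ), map_smul, map_smul, LinearMap.smul_apply, LinearMap.smul_apply]
    have := hv (D.neg β) (by rw [r.lneg]; linarith)
    rw [cf, D.neg_neg] at this
    rw [this]; simp

theorem Rho.e1 (r : D.Rho ρ lev) {x : L} (hx : x ∈ D.bb lev) (α : R) : ∃ v : L, v ≠ 0 ∧ ⁅x, v⁆ = κ (D.t α) (D.pr x) • v := by
  classical
  let F : Submodule K L :=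
    { carrier := {v | D.Fil lev (lev α) v}
      add_mem' := fun {u v} hu hv => ⟨fun γ h => (by rw [map_add, hu.a γ h, hv.a γ h, add_zero]), fun h => (by rw [map_add, hu.b h, hv.b h, add_zero])⟩
      zero_mem' := ⟨fun γ _ => map_zero _, fun _ => map_zero _⟩
      smul_mem' := fun c v hv => ⟨fun γ h => (by rw [map_smul, hv.a γ h, smul_zero]), fun h => (by rw [map_smul, hv.b h, smul_zero])⟩ }
  let a := κ (D.t α) (D.pr x)
  let T : L →ₗ[K] L := ad K L x - a • LinearMap.id
  have hT : ∀ v ∈ F, T v ∈ F := by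
    intro v hv
    have hv' : D.Fil lev (lev α) v := hv
    refine F.sub_mem ?_ (F.smul_mem _ hv)
    refine ⟨fun γ h => ?_, fun h => ?_⟩
    · rw [ad_apply, r.step hx hv' h.le, hv'.a γ h, mul_zero]
    · rw [ad_apply, r.stepH hx fun γ h2 => hv'.a γ (h2.trans h)]
  by_contra hcon
  push Not at hcon
  have inj : Function.Injective (T.restrict hT) := by
    rw [← LinearMap.ker_eq_bot, LinearMap.ker_eq_bot']
    intro v hv
    by_contra hne
    refine hcon v (fun h => hne (Subtype.ext h)) ?_
    have : T v = 0 := congrArg Subtype.val hv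
    exact sub_eq_zero.1 this
  have hrv : D.Fil lev (lev α) (D.rv α) := by
    refine ⟨fun γ h => D.cf_ne (fun e => by rw [e] at h; exact lt_irrefl _ h), fun _ => ?_⟩
    have := D.pr_eq (D.rv α)
    rw [Finset.sum_eq_single α (fun β _ h => by rw [D.cf_ne h.symm]; simp) (by simp), div_self (D.cf_self α), one_smul] at this
    simpa using this
  obtain ⟨v, hv⟩ := LinearMap.injective_iff_surjective.1 inj ⟨D.rv α, hrv⟩
  have hv2 : T v = D.rv α := congrArg Subtype.val hv
  have h3 : D.cf α (T v) = 0 := by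
    have hv' : D.Fil lev (lev α) v := v.2
    change D.cf α (⁅x, (v:L)⁆ - a • (v:L)) = 0
    rw [map_sub, map_smul, r.step hx hv' le_rfl, smul_eq_mul, sub_self]
  rw [hv2] at h3
  exact D.cf_self α h3

theorem Rho.e2 (r : D.Rho ρ lev) {x : L} (hx : x ∈ D.bb lev) {v : L} {c : K} (hv : v ≠ 0) (hc : ⁅x, v⁆ = c • v) :
    c = 0 ∨ ∃ β, c = κ (D.t β) (D.pr x) := by
  classical
  have fin : ∀ γ, D.Fil lev (lev γ) v → D.cf γ v ≠ 0 → c = κ (D.t γ) (D.pr x) := by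
    intro γ hF h0
    have := r.step hx hF le_rfl
    rw [hc, map_smul, smul_eq_mul] at this
    exact mul_right_cancel₀ h0 this
  have caseB : (∀ γ, lev γ < 0 → D.cf γ v = 0) → D.pr v ≠ 0 → c = 0 := by
    intro h1 h2
    have := r.stepH hx h1
    rw [hc, map_smul] at this
    exact (smul_eq_zero.1 this).resolve_right h2
  by_cases hS : ∃ γ, D.cf γ v ≠ 0
  · obtain ⟨γ, hγ, hm⟩ := Finset.exists_min_image (Finset.univ.filter fun γ => D.cf γ v ≠ 0) lev (by
      obtain ⟨γ, h⟩ := hS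
      exact ⟨γ, by simp [h]⟩)
    simp only [Finset.mem_filter, Finset.mem_univ, true_and] at hγ hm
    have hm' : ∀ δ, lev δ < lev γ → D.cf δ v = 0 := by
      intro δ hδ
      by_contra h
      exact absurd (hm δ h) (not_le.2 hδ)
    by_cases hp : D.pr v = 0
    · exact Or.inr ⟨γ, fin γ ⟨hm', fun _ => hp⟩ hγ⟩
    · by_cases h0 : 0 < lev γ
      · exact Or.inl (caseB (fun δ hδ => hm' δ (hδ.trans h0)) hp)
      · exact Or.inr ⟨γ, fin γ ⟨hm', fun h => absurd h h0⟩ hγ⟩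
  · push Not at hS
    refine Or.inl (caseB (fun γ _ => hS γ) ?_)
    rw [D.pr_of_H (D.mem_H hS)]; exact hv

theorem Rho.finrank_bb (r : D.Rho ρ lev) : finrank K L + finrank K D.H = 2 * finrank K (D.bb lev) := by
  classical
  have h1 : finrank K L = finrank K D.H + Fintype.card R := by
    have := D.finrank_U Finset.univ
    rw [Finset.card_univ] at this
    have ht : D.U Finset.univ = ⊤ := by
      rw [Submodule.eq_top_iff']
      intro v
      rw [D.mem_U]; simp
    rw [← this, ht, finrank_top]
  have h2 := D.finrank_U (Finset.univ.filter fun α => 0 < lev α)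
  have h3 : (Finset.univ.filter fun α => 0 < lev α).card = (Finset.univ.filter fun α => ¬ 0 < lev α).card := by
    refine Finset.card_bij' (fun α _ => D.neg α) (fun α _ => D.neg α) ?_ ?_ (fun α _ => D.neg_neg α) (fun α _ => D.neg_neg α)
    · intro α h
      simp only [Finset.mem_filter, Finset.mem_univ, true_and] at h ⊢
      rw [r.lneg]; linarith
    · intro α h
      simp only [Finset.mem_filter, Finset.mem_univ, true_and] at h ⊢
      rw [r.lneg]
      have := r.ne α
      rcases lt_or_gt_of_ne this with h' | h'
      · linarith
      · exact absurd h' h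
  have h4 := Finset.card_filter_add_card_filter_not (s := (Finset.univ : Finset R)) (fun α => 0 < lev α)
  rw [Finset.card_univ] at h4
  rw [bb, h2]
  omega

theorem Rho.perp (r : D.Rho ρ lev) {u v : L} (hu : u ∈ D.bb lev) (hp : D.pr u = 0) (hv : v ∈ D.bb lev) : κ u v = 0 := by
  have hF : ∀ w ∈ D.bb lev, D.Fil lev 0 w := fun w hw => ⟨fun γ h => mem_bb.1 hw γ h.le, fun h => absurd h (lt_irrefl _)⟩
  rw [D.pr_eq u, hp, zero_add, map_sum, LinearMap.sum_apply]
  refine Finset.sum_eq_zero fun β _ => ?_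
  rw [map_smul, LinearMap.smul_apply]
  by_cases hb : lev β ≤ 0
  · rw [mem_bb.1 hu β hb]; simp
  · have := r.kw (w := D.rv β) (m := - lev β) (l := 0) (by rw [r.eig]; push_cast; rw [_root_.neg_neg]) (by linarith) (hF v hv)
    rw [this, smul_zero]

end RD

section
variable {K L : Type*} [Field K] [CharZero K] [LieRing L] [LieAlgebra K L] [FiniteDimensional K L] [IsKilling K L]
  {R1 R2 : Type*} [Fintype R1] [Fintype R2]

local notation "κ" => killingForm K L

theorem CVborel (D1 : RD K L R1) (D2 : RD K L R2) : ∃ p : Submodule K L,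
    p.map D1.pr = D1.H ∧ p.map D2.pr = D2.H ∧ finrank K D1.H = finrank K D2.H ∧
    (∀ x ∈ p, ∀ α, κ (D1.t α) (D1.pr x) = 0 ∨ ∃ β, κ (D1.t α) (D1.pr x) = κ (D2.t β) (D2.pr x)) := by
  obtain ⟨ρ1, l1, r1⟩ := D1.exists_rho
  obtain ⟨ρ2, l2, r2⟩ := D2.exists_rho
  have E12 : ∀ x ∈ D1.bb l1 ⊓ D2.bb l2, ∀ α, κ (D1.t α) (D1.pr x) = 0 ∨ ∃ β, κ (D1.t α) (D1.pr x) = κ (D2.t β) (D2.pr x) := by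
    intro x hx α
    obtain ⟨v, hv, he⟩ := r1.e1 hx.1 α
    exact r2.e2 hx.2 hv he
  have E21 : ∀ x ∈ D1.bb l1 ⊓ D2.bb l2, ∀ α, κ (D2.t α) (D2.pr x) = 0 ∨ ∃ β, κ (D2.t α) (D2.pr x) = κ (D1.t β) (D1.pr x) := by
    intro x hx α
    obtain ⟨v, hv, he⟩ := r2.e1 hx.2 α
    exact r1.e2 hx.1 hv he
  set p := D1.bb l1 ⊓ D2.bb l2 with hp
  have q12 : ∀ x ∈ p, D1.pr x = 0 → D2.pr x = 0 := by
    intro x hx h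
    refine D2.hzero _ (D2.pr_H x) fun β => ?_
    rcases E21 x hx β with h' | ⟨γ, h'⟩
    · exact h'
    · rw [h', h, map_zero]
  have q21 : ∀ x ∈ p, D2.pr x = 0 → D1.pr x = 0 := by
    intro x hx h
    refine D1.hzero _ (D1.pr_H x) fun β => ?_
    rcases E12 x hx β with h' | ⟨γ, h'⟩
    · exact h'
    · rw [h', h, map_zero]
  let q := p ⊓ LinearMap.ker D1.pr
  have hq2 : q = p ⊓ LinearMap.ker D2.pr := by
    ext x
    exact ⟨fun h => ⟨h.1, q12 x h.1 h.2⟩, fun h => ⟨h.1, q21 x h.1 h.2⟩⟩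
  have rn : ∀ f : L →ₗ[K] L, finrank K (p.map f) + finrank K (p ⊓ LinearMap.ker f : Submodule K L) = finrank K p := by
    intro f
    have := LinearMap.finrank_range_add_finrank_ker (f.domRestrict p)
    rw [LinearMap.range_domRestrict] at this
    rw [← this]
    congr 1
    rw [LinearMap.ker_domRestrict]
    have e : (p ⊓ LinearMap.ker f).comap p.subtype = (LinearMap.ker f).comap p.subtype := by
      ext x; simp
    rw [← e]
    exact (LinearEquiv.finrank_eq (Submodule.comapSubtypeEquivOfLe inf_le_left)).symm
  have n1 := rn D1.pr
  have n2 := rn D2.pr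
  rw [← hq2] at n2
  have i1 : p.map D1.pr ≤ D1.H := by rintro _ ⟨x, -, rfl⟩; exact D1.pr_H x
  have i2 : p.map D2.pr ≤ D2.H := by rintro _ ⟨x, -, rfl⟩; exact D2.pr_H x
  have m1 := Submodule.finrank_mono i1
  have m2 := Submodule.finrank_mono i2
  have b1 := r1.finrank_bb
  have b2 := r2.finrank_bb
  have s1 := Submodule.finrank_sup_add_finrank_inf_eq (D1.bb l1) (D2.bb l2)
  have o1 : finrank K (D1.bb l1 ⊔ D2.bb l2 : Submodule K L) + finrank K q ≤ finrank K L := by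
    have := LinearMap.BilinForm.finrank_orthogonal (B := killingForm K L) (LieAlgebra.IsKilling.killingForm_nondegenerate K L) q
    have le : (D1.bb l1 ⊔ D2.bb l2 : Submodule K L) ≤ LinearMap.BilinForm.orthogonal (killingForm K L) q := by
      refine sup_le ?_ ?_
      · intro v hv u hu
        exact r1.perp hu.1.1 hu.2 hv
      · intro v hv u hu
        exact r2.perp hu.1.2 (q12 u hu.1 hu.2) hv
    have := Submodule.finrank_mono le
    have := Submodule.finrank_le q
    omega
  have hqd : finrank K q = finrank K (p ⊓ LinearMap.ker D1.pr : Submodule K L) := rfl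
  rw [← hp] at s1
  rw [← hqd] at n1
  have hf : finrank K D1.H = finrank K D2.H := by omega
  refine ⟨p, Submodule.eq_of_le_of_finrank_eq i1 (by omega), Submodule.eq_of_le_of_finrank_eq i2 (by omega), hf, E12⟩

theorem CVP_iso (D1 : RD K L R1) (D2 : RD K L R2) : finrank K D1.H = finrank K D2.H ∧ ∀ n, D1.P n → D2.P n := by
  obtain ⟨p, h1, h2, h3, E⟩ := CVborel D1 D2
  refine ⟨h3, ?_⟩
  have key : ∀ α, ∃ β, ∀ x ∈ p, κ (D1.t α) (D1.pr x) = κ (D2.t β) (D2.pr x) := by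
    intro α
    by_contra hcon
    push Not at hcon
    let f : Option R2 → p →ₗ[K] K := fun o => match o with
      | none => (κ (D1.t α)) ∘ₗ D1.pr ∘ₗ p.subtype
      | some β => (κ (D1.t α)) ∘ₗ D1.pr ∘ₗ p.subtype - (κ (D2.t β)) ∘ₗ D2.pr ∘ₗ p.subtype
    obtain ⟨v, hv⟩ := CVavoid f (by
      rintro (_ | β) h
      · have : D1.t α ∈ p.map D1.pr := by rw [h1]; exact D1.tH α
        obtain ⟨x, hx, e⟩ := this
        have h' : κ (D1.t α) (D1.pr x) = 0 := LinearMap.congr_fun h ⟨x, hx⟩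
        rw [e] at h'
        exact D1.ktt_ne α h'
      · obtain ⟨x, hx, hne⟩ := hcon β
        have h' : κ (D1.t α) (D1.pr x) - κ (D2.t β) (D2.pr x) = 0 := LinearMap.congr_fun h ⟨x, hx⟩
        exact hne (sub_eq_zero.1 h'))
    rcases E v v.2 α with h | ⟨β, h⟩
    · exact hv none h
    · exact hv (some β) (sub_eq_zero.2 h)
  choose φ hφ using key
  have sep : ∀ a ∈ D2.H, (∀ x ∈ p, κ a (D2.pr x) = 0) → a = 0 := by
    intro a ha h
    refine D2.hzero a ha fun β => ?_
    have : D2.t β ∈ p.map D2.pr := by rw [h2]; exact D2.tH β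
    obtain ⟨x, hx, e⟩ := this
    rw [CVkcomm, ← e]; exact h x hx
  have tr : ∀ (α β γ : R1) (m n : ℤ), D1.t γ = m • D1.t α + n • D1.t β → D2.t (φ γ) = m • D2.t (φ α) + n • D2.t (φ β) := by
    intro α β γ m n h
    rw [← sub_eq_zero]
    refine sep _ (sub_mem (D2.tH _) (add_mem (zsmul_mem (D2.tH _) _) (zsmul_mem (D2.tH _) _))) fun x hx => ?_
    simp only [map_sub, map_add, map_zsmul, LinearMap.sub_apply, LinearMap.add_apply, LinearMap.smul_apply]
    rw [← hφ γ x hx, ← hφ α x hx, ← hφ β x hx, h]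
    simp
  have sep1 : ∀ a ∈ D1.H, (∀ x ∈ p, κ a (D1.pr x) = 0) → a = 0 := by
    intro a ha h
    refine D1.hzero a ha fun β => ?_
    have : D1.t β ∈ p.map D1.pr := by rw [h1]; exact D1.tH β
    obtain ⟨x, hx, e⟩ := this
    rw [CVkcomm, ← e]; exact h x hx
  rintro n ⟨α, β, h⟩
  refine ⟨φ α, φ β, fun i hi hin => ?_⟩
  obtain ⟨γ, e, n1, n2⟩ := h i hi hin
  refine ⟨φ γ, ?_, fun h => n1 ?_, fun h => n2 ?_⟩
  · have := tr α β γ 1 i (by rw [e]; simp)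
    rw [this]; simp
  · rw [← sub_eq_zero]
    refine sep1 _ (sub_mem (D1.tH _) (D1.tH _)) fun x hx => ?_
    rw [map_sub, LinearMap.sub_apply, hφ α x hx, hφ β x hx, h, sub_self]
  · rw [eq_neg_iff_add_eq_zero]
    refine sep1 _ (add_mem (D1.tH _) (D1.tH _)) fun x hx => ?_
    rw [map_add, LinearMap.add_apply, hφ α x hx, hφ β x hx, h, map_neg, LinearMap.neg_apply, neg_add_cancel]
end

end

section
open Module LieAlgebra
open scoped TensorProduct

section
variable {K L : Type*} [Field K] [CharZero K] [LieRing L] [LieAlgebra K L] [FiniteDimensional K L] [IsKilling K L]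
variable (F : Type*) [Field F] [Algebra K F]

theorem CVbk (a b : F) (u v : L) : killingForm F (F ⊗[K] L) (a ⊗ₜ u) (b ⊗ₜ v) = a * b * algebraMap K F (killingForm K L u v) := by
  have : killingForm F (F ⊗[K] L) = (killingForm K L).baseChange F := LieModule.traceForm_baseChange K L L F
  rw [this, LinearMap.BilinForm.baseChange_tmul, Algebra.smul_def, mul_comm]

theorem CVbrk (u v : L) : ⁅(1 : F) ⊗ₜ[K] u, (1 : F) ⊗ₜ[K] v⁆ = (1 : F) ⊗ₜ[K] ⁅u, v⁆ := by
  rw [LieAlgebra.ExtendScalars.bracket_tmul, one_mul]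

theorem CVbcKilling : IsKilling F (F ⊗[K] L) := by
  constructor
  rw [eq_bot_iff]
  intro x hx
  rw [LieIdeal.mem_killingCompl] at hx
  rw [LieSubmodule.mem_bot]
  let b := Module.finBasis K L
  let b' := b.baseChange F
  have hr : ∀ i, ∃ a, ∀ v, b.coord i v = killingForm K L a v := fun i => CVkrep (b.coord i)
  choose a ha using hr
  apply b'.ext_elem
  intro i
  have h1 := hx ((1 : F) ⊗ₜ a i) (by trivial)
  have h2 : killingForm F (F ⊗[K] L) ((1 : F) ⊗ₜ a i) x = b'.repr x i := by
    conv_lhs => rw [← b'.sum_repr x, map_sum]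
    rw [Finset.sum_eq_single i]
    · rw [map_smul, Basis.baseChange_apply, CVbk, ← ha]; simp
    · intro j _ hj
      rw [map_smul, Basis.baseChange_apply, CVbk, ← ha]; simp [hj]
    · simp
  rw [← h2, map_zero]
  first | exact h1 | (rw [CVkcomm]; exact h1)

theorem CVbinj {u : L} (h : (1 : F) ⊗ₜ[K] u = 0) : u = 0 := by
  refine CVknd (K := K) u fun v => ?_
  have := CVbk (K := K) F 1 1 u v
  rw [h, map_zero, LinearMap.zero_apply, one_mul, one_mul] at this
  exact (map_eq_zero _).1 this.symm

variable {R : Type*} [Fintype R] (D : RD K L R)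

theorem RD.span_t {h : L} (hh : h ∈ D.H) : h ∈ Submodule.span K (Set.range D.t) := by
  have : h ∈ D.S (0 : L) := by
    refine D.perp_S (zero_mem _) hh fun a ha => ?_
    have : a = 0 := CVcenter (K := K) a fun v => ha v (zero_lie v)
    rw [this, map_zero]
  refine Submodule.span_mono ?_ this
  rintro _ ⟨α, -, rfl⟩
  exact ⟨α, rfl⟩

/-- base change of root data -/
def RD.bc : RD F (F ⊗[K] L) R where
  H := Submodule.span F {w | ∃ h ∈ D.H, w = (1 : F) ⊗ₜ[K] h}
  t α := 1 ⊗ₜ D.t α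
  rv α := 1 ⊗ₜ D.rv α
  neg := D.neg
  p := D.p
  tH α := Submodule.subset_span ⟨_, D.tH α, rfl⟩
  Hab a ha b hb := by
    induction ha using Submodule.span_induction with
    | mem a ha =>
      obtain ⟨a, ha, rfl⟩ := ha
      induction hb using Submodule.span_induction with
      | mem b hb =>
        obtain ⟨b, hb, rfl⟩ := hb
        rw [CVbrk, D.Hab a ha b hb, TensorProduct.tmul_zero]
      | zero => rw [_root_.lie_zero]
      | add u v _ _ hu hv => rw [lie_add, hu, hv, add_zero]
      | smul c u _ hu => rw [lie_smul, hu, smul_zero]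
    | zero => rw [zero_lie]
    | add u v _ _ hu hv => rw [add_lie, hu, hv, add_zero]
    | smul c u _ hu => rw [smul_lie, hu, smul_zero]
  rv_ne α h := D.rv_ne α (CVbinj (K := K) F h)
  rv_eig α h hh := by
    induction hh using Submodule.span_induction with
    | mem a ha =>
      obtain ⟨a, ha, rfl⟩ := ha
      rw [CVbrk, D.rv_eig α a ha, CVbk, one_mul, one_mul, TensorProduct.tmul_smul, algebraMap_smul]
    | zero => rw [zero_lie, map_zero, zero_smul]
    | add u v _ _ hu hv => rw [add_lie, hu, hv, map_add, add_smul]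
    | smul c u _ hu => rw [smul_lie, hu, map_smul, smul_smul, smul_eq_mul]
  dec v := by
    classical
    induction v using TensorProduct.induction_on with
    | zero => exact ⟨0, zero_mem _, 0, by simp⟩
    | tmul a v =>
      obtain ⟨h, hh, c, e⟩ := D.dec v
      refine ⟨a • ((1 : F) ⊗ₜ h), Submodule.smul_mem _ _ (Submodule.subset_span ⟨h, hh, rfl⟩), fun α => a * algebraMap K F (c α), ?_⟩
      rw [e, TensorProduct.tmul_add, TensorProduct.tmul_sum, TensorProduct.smul_tmul', smul_eq_mul, mul_one]
      congr 1
      refine Finset.sum_congr rfl fun α _ => ?_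
      rw [TensorProduct.tmul_smul, TensorProduct.smul_tmul', TensorProduct.smul_tmul', smul_eq_mul, mul_one, Algebra.smul_def, mul_comm]
    | add u v hu hv =>
      obtain ⟨h, hh, c, e⟩ := hu
      obtain ⟨h', hh', c', e'⟩ := hv
      refine ⟨h + h', add_mem hh hh', c + c', ?_⟩
      rw [e, e']
      simp only [Pi.add_apply, add_smul, Finset.sum_add_distrib]
      abel
  tinj α β h := D.tinj α β (by
    rw [← sub_eq_zero]
    apply CVbinj (K := K) F
    rw [TensorProduct.tmul_sub, h, sub_self])
  tne α h := D.tne α (CVbinj (K := K) F h)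
  tneg α := by rw [D.tneg, TensorProduct.tmul_neg]
  hzero h hh h0 := by
    have := CVbcKilling (K := K) (L := L) F
    haveI : CharZero F := charZero_of_injective_algebraMap (algebraMap K F).injective
    have hH : ∀ a ∈ D.H, killingForm F (F ⊗[K] L) (1 ⊗ₜ a) h = 0 := by
      intro a ha
      have := D.span_t ha
      induction this using Submodule.span_induction with
      | mem u hu => obtain ⟨α, rfl⟩ := hu; exact h0 α
      | zero => rw [TensorProduct.tmul_zero, map_zero, LinearMap.zero_apply]
      | add u v a1 a2 hu hv =>
        have e : ∀ w ∈ Submodule.span K (Set.range D.t), w ∈ D.H := fun w hw => (Submodule.span_le.2 (by rintro _ ⟨α, rfl⟩; exact D.tH α)) hw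
        rw [TensorProduct.tmul_add, map_add, LinearMap.add_apply, hu (e u a1), hv (e v a2), add_zero]
      | smul c u a1 hu =>
        have e : ∀ w ∈ Submodule.span K (Set.range D.t), w ∈ D.H := fun w hw => (Submodule.span_le.2 (by rintro _ ⟨α, rfl⟩; exact D.tH α)) hw
        rw [TensorProduct.tmul_smul, ← algebraMap_smul F c, map_smul, LinearMap.smul_apply, hu (e u a1), smul_zero]
    have hr : ∀ α, killingForm F (F ⊗[K] L) (1 ⊗ₜ D.rv α) h = 0 := by
      intro α
      clear h0 hH
      induction hh using Submodule.span_induction with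
      | mem a ha =>
        obtain ⟨a, ha, rfl⟩ := ha
        rw [CVbk, D.kHr ha]; simp
      | zero => rw [map_zero]
      | add u v _ _ hu hv => rw [map_add, hu, hv, add_zero]
      | smul c u _ hu => rw [map_smul, hu, smul_zero]
    refine CVknd (K := F) h fun v => ?_
    rw [CVkcomm]
    induction v using TensorProduct.induction_on with
    | zero => rw [map_zero, LinearMap.zero_apply]
    | tmul a v =>
      obtain ⟨h1, hh1, c, e⟩ := D.dec v
      have e1 : a ⊗ₜ[K] v = a • ((1 : F) ⊗ₜ[K] v) := by rw [TensorProduct.smul_tmul', smul_eq_mul, mul_one]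
      rw [e1, map_smul, LinearMap.smul_apply, e, TensorProduct.tmul_add, TensorProduct.tmul_sum, map_add, LinearMap.add_apply, hH h1 hh1, map_sum, LinearMap.sum_apply, zero_add, Finset.sum_eq_zero, smul_zero]
      intro α _
      rw [TensorProduct.tmul_smul, ← algebraMap_smul F (c α), map_smul, LinearMap.smul_apply, hr α, smul_zero]
    | add u v hu hv => rw [map_add, LinearMap.add_apply, hu, hv, add_zero]
  pq α β := by
    rw [CVbk, CVbk]
    have := congrArg (algebraMap K F) (D.pq α β)
    simp only [map_mul, map_ofNat, map_intCast] at this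
    linear_combination this
  rat β := by
    obtain ⟨q, hq, e⟩ := D.rat β
    haveI : CharZero F := charZero_of_injective_algebraMap (algebraMap K F).injective
    refine ⟨q, hq, ?_⟩
    rw [CVbk, e]; simp
  refl α β := by
    obtain ⟨γ, h⟩ := D.refl α β
    exact ⟨γ, by rw [h, TensorProduct.tmul_sub, map_zsmul (TensorProduct.mk K F L 1) _ _ |> fun e => (e : (1 : F) ⊗ₜ[K] (D.p α β • D.t β) = _)]; rfl⟩
  str α β n i hp h0 hn hne := by
    have em : (1 : F) ⊗ₜ[K] (i • D.t β) = i • ((1 : F) ⊗ₜ[K] D.t β) := map_zsmul (TensorProduct.mk K F L 1) i (D.t β)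
    obtain ⟨γ, h⟩ := D.str α β n i hp h0 hn (fun h => hne (by rw [← em, ← TensorProduct.tmul_add, h, TensorProduct.tmul_zero]))
    exact ⟨γ, by rw [h, TensorProduct.tmul_add, em]⟩
  red α β c h := by
    have h1 := congrArg (fun v => killingForm F (F ⊗[K] L) v ((1 : F) ⊗ₜ D.t β)) h
    simp only [map_smul, LinearMap.smul_apply, CVbk, one_mul, smul_eq_mul] at h1
    have hne : algebraMap K F (killingForm K L (D.t β) (D.t β)) ≠ 0 := (map_ne_zero _).2 (D.ktt_ne β)
    set c0 := killingForm K L (D.t α) (D.t β) / killingForm K L (D.t β) (D.t β) with hc0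
    have hc : c = algebraMap K F c0 := by
      rw [hc0, map_div₀, eq_div_iff hne, h1]
    have h2 : D.t α = c0 • D.t β := by
      rw [← sub_eq_zero]
      apply CVbinj (K := K) F
      rw [TensorProduct.tmul_sub, h, hc, TensorProduct.tmul_smul, algebraMap_smul, sub_self]
    rcases D.red α β c0 h2 with h | h
    · left; rw [hc, h, map_one]
    · right; rw [hc, h, map_neg, map_one]
  br α γ h h0 := D.br α γ h (CVbinj (K := K) F (by rw [← CVbrk, h0]))
  brn α := by
    obtain ⟨c, hc, e⟩ := D.brn α
    exact ⟨algebraMap K F c, (map_ne_zero _).2 hc, by rw [CVbrk, e, TensorProduct.tmul_smul, algebraMap_smul]⟩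

theorem RD.bc_P {n : ℕ} (h : (D.bc F).P n) : D.P n := by
  have bi : ∀ u v : L, (1 : F) ⊗ₜ[K] u = (1 : F) ⊗ₜ[K] v → u = v := by
    intro u v h
    rw [← sub_eq_zero]
    apply CVbinj (K := K) F
    rw [TensorProduct.tmul_sub, h, sub_self]
  obtain ⟨α, β, h⟩ := h
  refine ⟨α, β, fun i h1 h2 => ?_⟩
  obtain ⟨γ, e, n1, n2⟩ := h i h1 h2
  refine ⟨γ, bi _ _ ?_, fun h => n1 ?_, fun h => n2 ?_⟩
  · have em : (1 : F) ⊗ₜ[K] (i • D.t β) = i • ((1 : F) ⊗ₜ[K] D.t β) := map_nsmul (TensorProduct.mk K F L 1) i (D.t β)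
    rw [TensorProduct.tmul_add, em]; exact e
  · exact congrArg (fun v => (1 : F) ⊗ₜ[K] v) h
  · change (1 : F) ⊗ₜ[K] D.t α = - ((1 : F) ⊗ₜ[K] D.t β)
    rw [h, TensorProduct.tmul_neg]

theorem RD.finrank_L {K L : Type*} [Field K] [CharZero K] [LieRing L] [LieAlgebra K L] [FiniteDimensional K L] {R : Type*} [Fintype R] (D : RD K L R) :
    finrank K L = finrank K D.H + Fintype.card R := by
  have := D.finrank_U Finset.univ
  rw [Finset.card_univ] at this
  have ht : D.U Finset.univ = ⊤ := by
    rw [Submodule.eq_top_iff']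
    intro v
    rw [D.mem_U]; simp
  rw [← this, ht, finrank_top]

theorem RD.bc_finrank : finrank F (D.bc F).H = finrank K D.H := by
  haveI : CharZero F := charZero_of_injective_algebraMap (algebraMap K F).injective
  have h1 := (D.bc F).finrank_L
  have h2 := D.finrank_L
  rw [Module.finrank_baseChange] at h1
  omega
end

end

section
open Module LieAlgebra
open scoped TensorProduct

section
open LieModule LieAlgebra.IsKilling
variable {K L : Type*} [Field K] [IsAlgClosed K] [CharZero K] [LieRing L] [LieAlgebra K L] [FiniteDimensional K L] [IsKilling K L]
variable (H : LieSubalgebra K L) [H.IsCartanSubalgebra]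

theorem CVlac_le (α β : H.root) (hαβ : ∀ c : K, CVt H α.1 ≠ c • CVt H β.1) : ((CVRD H).p α β).natAbs ≤ lacety K L H := by
  have hn : ¬ finrank K H = 1 := by
    intro h
    have h1 := finrank_eq_one_iff_of_nonzero' (K := K) (⟨CVt H β.1, CVt_mem H β.1⟩ : H) (by
      intro h0
      exact CVt_ne H β.1 (H.isNonZero_coe_root β) (congrArg Subtype.val h0))
    obtain ⟨c, hc⟩ := h1.1 h ⟨CVt H α.1, CVt_mem H α.1⟩
    exact hαβ c (congrArg Subtype.val hc).symm
  rw [lacety, if_neg hn]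
  have hc : ∀ α β : Weight K H L, α (coroot β) = ((chainBotCoeff β α - chainTopCoeff β α : ℤ) : K) := fun α β => apply_coroot_eq_cast β α
  apply le_csSup
  · have : (Set.range fun p : Weight K H L × Weight K H L => (chainBotCoeff p.2 p.1 - chainTopCoeff p.2 p.1 : ℤ).natAbs).Finite := Set.finite_range _
    refine this.bddAbove.mono ?_
    rintro n ⟨α, β, -, -, -, h⟩
    refine ⟨(α, β), ?_⟩
    simp only
    rw [hc] at h
    rcases h with h | h
    · have : (chainBotCoeff β α - chainTopCoeff β α : ℤ) = n := by exact_mod_cast h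
      omega
    · have : (chainBotCoeff β α - chainTopCoeff β α : ℤ) = -n := by exact_mod_cast h
      omega
  · refine ⟨α.1, β.1, H.isNonZero_coe_root α, H.isNonZero_coe_root β, fun c h => hαβ c ((CVt_smul H _ _ c).1 h), ?_⟩
    rw [hc]
    change ((CVRD H).p α β : K) = _ ∨ ((CVRD H).p α β : K) = _
    rcases Int.natAbs_eq ((CVRD H).p α β) with h | h
    · left
      have := congrArg (Int.cast : ℤ → K) h
      simpa using this
    · right
      have := congrArg (Int.cast : ℤ → K) h
      rw [this]
      push_cast; simp

theorem CVlacP {n : ℕ} (hn : 1 ≤ n) (h : (CVRD H).P n) : n ≤ lacety K L H := by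
  obtain ⟨α, β, h⟩ := h
  obtain ⟨γ, hγ, n1, n2⟩ := h n hn le_rfl
  have hp : (CVRD H).p γ β = (CVRD H).p α β + 2 * n := by
    have e1 := (CVRD H).pq γ β
    have e2 := (CVRD H).pq α β
    have h0 := (CVRD H).ktt_ne β
    rw [hγ, map_add, LinearMap.add_apply, map_nsmul, LinearMap.smul_apply, mul_add, e2, nsmul_eq_mul] at e1
    have : (((CVRD H).p γ β : ℤ) : K) = (CVRD H).p α β + 2 * n := by
      apply mul_right_cancel₀ h0
      rw [← e1]; ring
    exact_mod_cast this
  have ha : ∀ c : K, CVt H α.1 ≠ c • CVt H β.1 := by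
    intro c hc
    rcases (CVRD H).red α β c hc with h1 | h1
    · apply n1; change CVt H α.1 = _; rw [hc, h1, one_smul]; rfl
    · apply n2; change CVt H α.1 = _; rw [hc, h1, neg_smul, one_smul]; rfl
  have hg : ∀ c : K, CVt H γ.1 ≠ c • CVt H β.1 := by
    intro c hc
    apply ha (c - n)
    change CVt H γ.1 = CVt H α.1 + n • CVt H β.1 at hγ
    rw [sub_smul, ← hc, hγ, Nat.cast_smul_eq_nsmul, add_sub_cancel_right]
  have l1 := CVlac_le H α β ha
  have l2 := CVlac_le H γ β hg
  omega

theorem CVlac_pos [IsSimple K L] : 1 ≤ lacety K L H := by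
  by_cases hn : finrank K H = 1
  · rw [lacety, if_pos hn]
  by_contra hl
  have hp : ∀ α β : H.root, (∀ c : K, CVt H α.1 ≠ c • CVt H β.1) → (CVRD H).p α β = 0 := by
    intro α β h
    have := CVlac_le H α β h
    omega
  have irr : (rootSystem H).IsIrreducible := inferInstance
  haveI := irr.nontrivial
  have hne : Nonempty H.root := by
    by_contra h
    rw [not_nonempty_iff] at h
    have := RootPairing.IsRootSystem.span_root_eq_top (P := rootSystem H)
    rw [Set.range_eq_empty, Submodule.span_empty] at this
    exact bot_ne_top this
  obtain ⟨α⟩ := hne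
  have ht := irr.eq_top_of_invtSubmodule_reflection (Submodule.span K {(rootSystem H).root α}) (by
    intro i
    rw [Module.End.mem_invtSubmodule, Submodule.span_le, Set.singleton_subset_iff]
    change (rootSystem H).reflection i ((rootSystem H).root α) ∈ Submodule.span K {(rootSystem H).root α}
    rw [RootPairing.reflection_apply_root]
    refine sub_mem (Submodule.mem_span_singleton_self _) ?_
    by_cases hc : ∃ c : K, CVt H i.1 = c • CVt H α.1
    · obtain ⟨c, hc⟩ := hc
      have := (CVt_smul H i.1 α.1 c).2 hc
      refine Submodule.smul_mem _ _ (Submodule.mem_span_singleton.2 ⟨c, ?_⟩)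
      ext x
      exact (congrFun this x).symm
    · have := hp α i (by
        intro c h
        have h0 : c ≠ 0 := by
          rintro rfl
          exact CVt_ne H α.1 (H.isNonZero_coe_root α) (by rw [h, zero_smul])
        exact hc ⟨c⁻¹, by rw [h, smul_smul, inv_mul_cancel₀ h0, one_smul]⟩)
      have h2 : (rootSystem H).pairing α i = ((CVRD H).p α i : K) := by
        rw [rootSystem_pairing_apply]; exact apply_coroot_eq_cast i.1 α.1
      rw [h2, this, Int.cast_zero, zero_smul]
      exact zero_mem _) (by
    rw [Ne, Submodule.span_singleton_eq_bot]
    exact (rootSystem H).ne_zero α)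
  have h1 : finrank K (Dual K H) ≤ 1 := by
    rw [← finrank_top K (Dual K H), ← ht]
    exact (finrank_span_singleton ((rootSystem H).ne_zero α)).le
  rw [Subspace.dual_finrank_eq] at h1
  have h2 : 0 < finrank K (Dual K H) := finrank_pos
  rw [Subspace.dual_finrank_eq] at h2
  omega
end

section
variable {k g : Type*} [Field k] [IsAlgClosed k] [CharZero k] [LieRing g] [LieAlgebra k g] [FiniteDimensional k g] [IsSimple k g] [IsKilling k g]
variable (t : LieSubalgebra k g) [t.IsCartanSubalgebra]
variable (F : Type*) [Field F] [IsAlgClosed F] [Algebra k F]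

/-- Main inequality over an extension field. -/
theorem CVmainExt {x y : F ⊗[k] g} (hxy : ⁅x, y⁆ = 0) (hc : finrank k t < finrank F (LinearMap.ker (phi F x y))) :
    finrank F (TT F x y) + (5 - lacety k g t) ≤ finrank k g + finrank k t := by
  haveI : CharZero F := charZero_of_injective_algebraMap (algebraMap k F).injective
  haveI := CVbcKilling (K := k) (L := g) F
  have iso : ∀ (H : LieSubalgebra F (F ⊗[k] g)) [H.IsCartanSubalgebra], finrank F H = finrank k t ∧ ∀ n, (CVRD H).P n → (CVRD t).P n := by
    intro H _
    obtain ⟨h1, h2⟩ := CVP_iso (CVRD H) ((CVRD t).bc F)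
    refine ⟨?_, fun n h => (CVRD t).bc_P F (h2 n h)⟩
    rw [RD.bc_finrank] at h1
    exact h1
  obtain ⟨a2, a3, a4⟩ := CVmainII hxy (d0 := finrank k t) (fun H _ => (iso H).1) hc
  rw [Module.finrank_baseChange] at a2 a3 a4
  have l1 := CVlac_pos t
  by_cases h3 : (CVRD t).P 3
  · have := CVlacP t (by norm_num) h3
    omega
  · have := a3 fun H _ h => h3 ((iso H).2 _ h)
    by_cases h2 : (CVRD t).P 2
    · have := CVlacP t (by norm_num) h2
      omega
    · have := a4 fun H _ h => h2 ((iso H).2 _ h)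
      omega
end

end

section
open Module LieAlgebra
open scoped TensorProduct

section
variable {k K : Type*} [Field k] [CharZero k] [Field K] [Algebra k K]

theorem CVder0 {B : Type*} {x : B → K} (hx : IsTranscendenceBasis k x) (f : B → K) :
    ∃ d : Derivation k K K, ∀ b, d (x b) = f b := by
  letI : Algebra (MvPolynomial B k) K := (MvPolynomial.aeval x).toAlgebra
  have hinj : Function.Injective (algebraMap (MvPolynomial B k) K) := hx.1
  haveI : FaithfulSMul (MvPolynomial B k) K := (faithfulSMul_iff_algebraMap_injective _ _).2 hinj
  haveI : IsScalarTower k (MvPolynomial B k) K := IsScalarTower.of_algebraMap_eq fun r => ((MvPolynomial.aeval x).commutes r).symm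
  haveI hal : Algebra.IsAlgebraic (MvPolynomial B k) K := by
    have := hx.isAlgebraic
    constructor
    intro a
    have h1 := this.isAlgebraic a
    exact (isAlgebraic_ringHom_iff_of_comp_eq (hx.1.aevalEquiv : MvPolynomial B k ≃+* _) (RingHom.id K) Function.injective_id (by ext <;> simp [RingHom.algebraMap_toAlgebra] ) ).1 h1
  letI : Algebra (FractionRing (MvPolynomial B k)) K := FractionRing.liftAlgebra _ _
  haveI : IsScalarTower (MvPolynomial B k) (FractionRing (MvPolynomial B k)) K := FractionRing.isScalarTower_liftAlgebra _ _
  haveI : Algebra.IsAlgebraic (FractionRing (MvPolynomial B k)) K := (IsFractionRing.comap_isAlgebraic_iff (A := MvPolynomial B k)).1 hal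
  haveI : CharZero (FractionRing (MvPolynomial B k)) := charZero_of_injective_algebraMap (algebraMap k _).injective
  haveI : Algebra.FormallyEtale (FractionRing (MvPolynomial B k)) K := Algebra.FormallyEtale.of_isSeparable _ _
  haveI : Algebra.FormallyEtale (MvPolynomial B k) (FractionRing (MvPolynomial B k)) := Algebra.FormallyEtale.of_isLocalization (nonZeroDivisors _)
  haveI : Algebra.FormallyEtale (MvPolynomial B k) K := .comp _ (FractionRing (MvPolynomial B k)) _
  let d0 : Derivation k (MvPolynomial B k) K := MvPolynomial.mkDerivation k f
  let l0 : KaehlerDifferential k (MvPolynomial B k) →ₗ[MvPolynomial B k] K := d0.liftKaehlerDifferential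
  let l1 : K ⊗[MvPolynomial B k] KaehlerDifferential k (MvPolynomial B k) →ₗ[K] K :=
    LinearMap.liftBaseChange K l0
  let l2 := l1 ∘ₗ (KaehlerDifferential.tensorKaehlerEquivOfFormallyEtale k (MvPolynomial B k) K).symm.toLinearMap
  refine ⟨l2.compDer (KaehlerDifferential.D k K), fun b => ?_⟩
  have e : x b = algebraMap (MvPolynomial B k) K (MvPolynomial.X b) := by
    change x b = MvPolynomial.aeval x (MvPolynomial.X b); simp
  change l2 (KaehlerDifferential.D k K (x b)) = f b
  rw [e]
  change l1 ((KaehlerDifferential.tensorKaehlerEquivOfFormallyEtale k (MvPolynomial B k) K).symm _) = f b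
  rw [KaehlerDifferential.tensorKaehlerEquivOfFormallyEtale_symm_D_algebraMap]
  simp [l1, l0, d0]

theorem CVder {ι : Type*} [DecidableEq ι] {t : ι → K} (ht : AlgebraicIndependent k t) (j : ι) :
    ∃ d : Derivation k K K, ∀ i, d (t i) = if i = j then 1 else 0 := by
  classical
  obtain ⟨s, hs, hb⟩ := exists_isTranscendenceBasis_superset (R := k) (s := Set.range t) ht.to_subtype_range
  obtain ⟨d, hd⟩ := CVder0 hb (fun b => if (b : K) = t j then 1 else 0)
  refine ⟨d, fun i => ?_⟩
  have := hd ⟨t i, hs ⟨i, rfl⟩⟩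
  simp only at this
  rw [this]
  simp only [ht.injective.eq_iff]
end

section
variable {k R : Type*} [Field k] [CommRing R] [Algebra k R]

theorem CVchain_aux {n : ℕ} {s : Fin n → R} {P Q : Ideal R} [P.IsPrime] (hPQ : P ≤ Q)
    (hs : ∀ F : MvPolynomial (Fin n) k, MvPolynomial.aeval s F ∈ Q → F = 0) {y : R} (hy : y ∈ Q) (hy' : y ∉ P) (N : ℕ) :
    ∀ f : Polynomial (MvPolynomial (Fin n) k), f.natDegree < N → f.eval₂ (MvPolynomial.aeval s : MvPolynomial (Fin n) k →ₐ[k] R).toRingHom y ∈ P → f = 0 := by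
  induction N with
  | zero => intro f h; omega
  | succ N ih =>
    intro f hf h
    have e := f.divX_mul_X_add
    have h1 : f.coeff 0 = 0 := by
      apply hs
      have h2 := hPQ h
      rw [← e, Polynomial.eval₂_add, Polynomial.eval₂_mul, Polynomial.eval₂_X, Polynomial.eval₂_C] at h2
      exact (Q.add_mem_iff_right (Q.mul_mem_left _ hy)).1 h2
    rw [h1, map_zero, add_zero] at e
    rw [← e, Polynomial.eval₂_mul, Polynomial.eval₂_X] at h
    have h3 := ((inferInstance : P.IsPrime).mem_or_mem h).resolve_right hy'
    by_cases h0 : f.natDegree = 0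
    · rw [Polynomial.eq_C_of_natDegree_eq_zero h0, h1, map_zero]
    rw [← e, ih f.divX (by rw [Polynomial.natDegree_divX_eq_natDegree_tsub_one]; omega) h3, zero_mul]

theorem CVchain : ∀ (m : ℕ) (P : Fin (m + 1) → Ideal R), (∀ i, (P i).IsPrime) → StrictMono P →
    ∃ s : Fin m → R, ∀ F : MvPolynomial (Fin m) k, MvPolynomial.aeval s F ∈ P 0 → F = 0 := by
  intro m
  induction m with
  | zero =>
    intro P hP _
    refine ⟨fun i => i.elim0, fun F hF => ?_⟩
    rw [MvPolynomial.eq_C_of_isEmpty F] at hF ⊢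
    by_contra h
    have h' : MvPolynomial.coeff 0 F ≠ 0 := fun h0 => h (by rw [h0, map_zero])
    apply (hP 0).ne_top
    rw [Ideal.eq_top_iff_one]
    rw [MvPolynomial.aeval_C] at hF
    have := (P 0).mul_mem_left (algebraMap k R (MvPolynomial.coeff 0 F)⁻¹) hF
    rwa [← map_mul, inv_mul_cancel₀ h', map_one] at this
  | succ n ih =>
    intro P hP hm
    obtain ⟨s, hs⟩ := ih (fun i => P i.succ) (fun i => hP _) (fun i j h => hm (Fin.succ_lt_succ_iff.2 h))
    have hlt : P 0 < P (Fin.succ 0) := hm (Fin.succ_pos 0)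
    obtain ⟨y, hy, hy'⟩ := SetLike.exists_of_lt hlt
    haveI := hP 0
    refine ⟨Fin.cons y s, fun F hF => ?_⟩
    have : MvPolynomial.finSuccEquiv k n F = 0 := by
      refine CVchain_aux (k := k) hlt.le hs hy hy' _ _ (Nat.lt_succ_self _) ?_
      have e : ∀ F : MvPolynomial (Fin (n + 1)) k, (MvPolynomial.finSuccEquiv k n F).eval₂ (MvPolynomial.aeval s : MvPolynomial (Fin n) k →ₐ[k] R).toRingHom y
          = MvPolynomial.aeval (Fin.cons y s) F := by
        intro F
        induction F using MvPolynomial.induction_on with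
        | C a => rw [MvPolynomial.finSuccEquiv_apply]; simp
        | add p q hp hq => rw [map_add, Polynomial.eval₂_add, hp, hq, map_add]
        | mul_X p i hp =>
          rw [map_mul, Polynomial.eval₂_mul, hp, map_mul, MvPolynomial.aeval_X]
          congr 1
          refine Fin.cases ?_ (fun i => ?_) i
          · rw [MvPolynomial.finSuccEquiv_X_zero, Polynomial.eval₂_X]; rfl
          · rw [MvPolynomial.finSuccEquiv_X_succ, Polynomial.eval₂_C]; simp
      rw [e]; exact hF
    exact (map_eq_zero_iff _ (MvPolynomial.finSuccEquiv k n).injective).1 this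
end

section
variable {k K g : Type*} [Field k] [CharZero k] [Field K] [Algebra k K] [LieRing g] [LieAlgebra k g] [FiniteDimensional k g]

theorem CVSD (d : Derivation k K K) : IsSD K (TensorProduct.map (d : K →ₗ[k] K) (LinearMap.id : g →ₗ[k] g)).toAddMonoidHom := by
  constructor
  · refine ⟨d.restrictScalars ℤ, fun c v => ?_⟩
    change TensorProduct.map _ _ _ = d c • v + c • TensorProduct.map _ _ v
    induction v using TensorProduct.induction_on with
    | zero => simp
    | tmul a v =>
      simp only [TensorProduct.smul_tmul', TensorProduct.map_tmul, smul_eq_mul, LinearMap.id_apply, Derivation.coeFn_coe, Derivation.leibniz, TensorProduct.add_tmul]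
      rw [mul_comm a, add_comm]
    | add u v hu hv => rw [smul_add, map_add, hu, hv, map_add, smul_add, smul_add]; abel
  · intro u v
    change TensorProduct.map _ _ _ = ⁅TensorProduct.map _ _ u, v⁆ + ⁅u, TensorProduct.map _ _ v⁆
    induction u using TensorProduct.induction_on with
    | zero => simp
    | tmul a u =>
      induction v using TensorProduct.induction_on with
      | zero => simp
      | tmul b v =>
        simp only [LieAlgebra.ExtendScalars.bracket_tmul, TensorProduct.map_tmul, smul_eq_mul, LinearMap.id_apply, Derivation.coeFn_coe, Derivation.leibniz, TensorProduct.add_tmul]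
        rw [mul_comm b, add_comm]
      | add v w hv hw => rw [lie_add, map_add, hv, hw, map_add, lie_add, lie_add]; abel
    | add u w hu hw => rw [add_lie, map_add, hu, hw, map_add, add_lie, add_lie]; abel

theorem CVTTge {ι : Type*} [Fintype ι] (b : Basis ι k (g × g)) (z : ι → K) {m : ℕ} (q : Fin m → MvPolynomial ι k)
    (hs : AlgebraicIndependent k fun j => MvPolynomial.aeval z (q j)) :
    m ≤ finrank K (TT K (∑ i, z i ⊗ₜ[k] (b i).1) (∑ i, z i ⊗ₜ[k] (b i).2)) := by
  classical
  have hd := fun j => CVder hs j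
  choose d hd using hd
  let Θ : (ι → K) →ₗ[K] (K ⊗[k] g) × (K ⊗[k] g) :=
    { toFun := fun c => (∑ i, c i ⊗ₜ[k] (b i).1, ∑ i, c i ⊗ₜ[k] (b i).2)
      map_add' := fun c c' => by simp [TensorProduct.add_tmul, Finset.sum_add_distrib]
      map_smul' := fun a c => by simp [TensorProduct.smul_tmul', Finset.smul_sum] }
  have hΘ : LinearMap.ker Θ = ⊥ := by
    rw [LinearMap.ker_eq_bot']
    intro c hc
    have h1 : ∑ i, c i ⊗ₜ[k] (b i).1 = 0 := congrArg Prod.fst hc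
    have h2 : ∑ i, c i ⊗ₜ[k] (b i).2 = 0 := congrArg Prod.snd hc
    funext i
    have e1 := congrArg ((b.coord i ∘ₗ LinearMap.inl k g g).baseChange K) h1
    have e2 := congrArg ((b.coord i ∘ₗ LinearMap.inr k g g).baseChange K) h2
    have e3 := congrArg (TensorProduct.rid k K) (congrArg₂ (· + ·) e1 e2)
    simp only [map_sum, LinearMap.baseChange_tmul, ← Finset.sum_add_distrib, ← TensorProduct.tmul_add, LinearMap.comp_apply, ← map_add, LinearMap.inl_apply, LinearMap.inr_apply, Prod.mk_add_mk, add_zero, zero_add, Prod.mk.eta, TensorProduct.rid_tmul, map_zero] at e3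
    simpa [Finsupp.single_apply] using e3
  have hli : LinearIndependent K fun j : Fin m => Θ (fun i => d j (z i)) := by
    have : LinearIndependent K fun j : Fin m => (fun i => d j (z i) : ι → K) := by
      rw [Fintype.linearIndependent_iff]
      intro c hc j
      let E : Derivation k K K := ∑ j, c j • d j
      have hE : ∀ x, E x = ∑ j, c j * d j x := by
        intro x
        simp only [E]
        rw [← Derivation.coeFnAddMonoidHom_apply, map_sum, Finset.sum_apply]
        rfl
      have h0 : ∀ i, E (z i) = 0 := by
        intro i
        have := congrFun hc i
        rw [hE]
        simpa using this
      have h1 : ∀ p : MvPolynomial ι k, E (MvPolynomial.aeval z p) = 0 := by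
        intro p
        induction p using MvPolynomial.induction_on with
        | C a => rw [MvPolynomial.aeval_C, Derivation.map_algebraMap]
        | add p q hp hq => rw [map_add, map_add, hp, hq, add_zero]
        | mul_X p i hp => rw [map_mul, Derivation.leibniz, hp, MvPolynomial.aeval_X, h0, smul_zero, smul_zero, add_zero]
      have h2 := h1 (q j)
      rw [hE] at h2
      simpa [hd] using h2
    exact this.map' Θ hΘ
  have hmem : ∀ j, Θ (fun i => d j (z i)) ∈ TT K (∑ i, z i ⊗ₜ[k] (b i).1) (∑ i, z i ⊗ₜ[k] (b i).2) := by
    intro j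
    refine Submodule.subset_span ⟨_, CVSD (d j), ?_⟩
    ext
    · change ∑ i, _ = TensorProduct.map _ _ _
      simp [map_sum]
    · change ∑ i, _ = TensorProduct.map _ _ _
      simp [map_sum]
  have h4 : LinearIndependent K fun j : Fin m => (⟨_, hmem j⟩ : TT K (∑ i, z i ⊗ₜ[k] (b i).1) (∑ i, z i ⊗ₜ[k] (b i).2)) :=
    LinearIndependent.of_comp (Submodule.subtype _) hli
  simpa using h4.fintype_card_le_finrank
end

end

section
open Module LieAlgebra
open scoped TensorProduct

section
theorem CVminor1 {F m n : Type*} [Field F] [Fintype n] [Finite m] (A : Matrix m n F) {r : ℕ} (h : r ≤ A.rank) :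
    ∃ e : Fin r → n, LinearIndependent F (A.submatrix id e).col := by
  rw [Matrix.rank_eq_finrank_span_cols] at h
  obtain ⟨f, hf, -, hl⟩ := Submodule.exists_fun_fin_finrank_span_eq F (Set.range A.col)
  choose e he using hf
  refine ⟨fun i => e (Fin.castLE h i), ?_⟩
  have := hl.comp (Fin.castLE h) (Fin.castLE_injective h)
  have e1 : (A.submatrix id fun i => e (Fin.castLE h i)).col = f ∘ Fin.castLE h := by
    funext i
    exact he _
  rw [e1]
  exact this

theorem CVminor {F m n : Type*} [Field F] [Fintype n] [Fintype m] (A : Matrix m n F) {r : ℕ} (h : r ≤ A.rank) :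
    ∃ (f : Fin r → m) (e : Fin r → n), (A.submatrix f e).det ≠ 0 := by
  obtain ⟨e, he⟩ := CVminor1 A h
  have h2 : r ≤ ((A.submatrix id e).transpose).rank := by
    have := LinearIndependent.rank_matrix (M := (A.submatrix id e).transpose) he
    rw [this]; simp
  obtain ⟨f, hf⟩ := CVminor1 _ h2
  refine ⟨f, e, ?_⟩
  have h3 := Matrix.linearIndependent_cols_iff_isUnit.1 hf
  have h4 := (Matrix.isUnit_iff_isUnit_det _).1 h3
  have e1 : (Matrix.submatrix (A.submatrix id e).transpose id f) = (A.submatrix f e).transpose := rfl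
  rw [e1, Matrix.det_transpose] at h4
  exact h4.ne_zero

theorem CVrk {F L I : Type*} [Field F] [LieRing L] [LieAlgebra F L] [Fintype I] [FiniteDimensional F L] (c : Basis I F L) (x y : L)
    (M : Matrix (I ⊕ I) I F) (h1 : ∀ a e, M (Sum.inl a) e = - c.repr ⁅x, c e⁆ a) (h2 : ∀ a e, M (Sum.inr a) e = - c.repr ⁅y, c e⁆ a) :
    M.rank + finrank F (LinearMap.ker (phi F x y)) = finrank F L := by
  classical
  have hM : M = LinearMap.toMatrix c (c.prod c) (phi F x y) := by
    ext a e
    rw [LinearMap.toMatrix_apply]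
    rcases a with a | a
    · rw [h1, ← Finsupp.neg_apply, ← map_neg]; simp [phi]
    · rw [h2, ← Finsupp.neg_apply, ← map_neg]; simp [phi]
  rw [Matrix.rank_eq_finrank_range_toLin M (c.prod c) c, hM, Matrix.toLin_toMatrix]
  exact LinearMap.finrank_range_add_finrank_ker _
end

section
variable (k : Type*) [Field k] (V : Type*) [AddCommGroup V] [Module k V] [FiniteDimensional k V]

theorem CVev_mul (F G : MvPolynomial (Module.Free.ChooseBasisIndex k V) k) (w : V) : CV.evalP k V (F * G) w = CV.evalP k V F w * CV.evalP k V G w := by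
  simp [CV.evalP]

theorem CVzar_basis {U : Set V} (hU : @IsOpen V (CV.zar k V) U) {w : V} (hw : w ∈ U) :
    ∃ F, CV.evalP k V F w ≠ 0 ∧ ∀ w', CV.evalP k V F w' ≠ 0 → w' ∈ U := by
  have hU' : TopologicalSpace.GenerateOpen _ U := hU
  induction hU' with
  | basic s hs => obtain ⟨F, rfl⟩ := hs; exact ⟨F, hw, fun w' h => h⟩
  | univ => exact ⟨1, by simp [CV.evalP], fun w' _ => trivial⟩
  | inter s t hs ht h1 h2 =>
    obtain ⟨F, a1, a2⟩ := h1 hs hw.1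
    obtain ⟨G, b1, b2⟩ := h2 ht hw.2
    refine ⟨F * G, by rw [CVev_mul]; exact mul_ne_zero a1 b1, fun w' h => ?_⟩
    rw [CVev_mul] at h
    exact ⟨a2 _ (left_ne_zero_of_mul h), b2 _ (right_ne_zero_of_mul h)⟩
  | sUnion S hS h =>
    obtain ⟨s, hs, hws⟩ := hw
    obtain ⟨F, a1, a2⟩ := h s hs (hS s hs) hws
    exact ⟨F, a1, fun w' h' => ⟨s, hs, a2 _ h'⟩⟩

/-- the vanishing ideal -/
def CVI (Z : Set V) : Ideal (MvPolynomial (Module.Free.ChooseBasisIndex k V) k) where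
  carrier := {F | ∀ w ∈ Z, CV.evalP k V F w = 0}
  add_mem' := fun {a b} ha hb w hw => by
    have h1 := ha w hw
    have h2 := hb w hw
    simp only [CV.evalP] at *
    rw [map_add, h1, h2, add_zero]
  zero_mem' := fun w hw => by simp [CV.evalP]
  smul_mem' := fun c F hF w hw => by
    rw [smul_eq_mul, CVev_mul, hF w hw, mul_zero]

theorem CVgeo (S : Set V) (c N : ℕ)
    (h : ∀ m (P : Fin (m + 1) → Ideal (MvPolynomial (Module.Free.ChooseBasisIndex k V) k)), (∀ i, (P i).IsPrime) → StrictMono P →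
      (∀ F, (∀ w ∈ S, CV.evalP k V F w = 0) → F ∈ P 0) → m + c ≤ N) :
    CV.dimSet k V S + ((c : ℕ) : ℕ∞) ≤ (((N : ℕ) : ℕ∞) : WithBot ℕ∞) := by
  letI τ0 : TopologicalSpace V := CV.zar k V
  letI τ : TopologicalSpace S := TopologicalSpace.induced Subtype.val (CV.zar k V)
  have key : ∀ p : LTSeries (TopologicalSpace.IrreducibleCloseds S), p.length + c ≤ N := by
    intro p
    have hop : ∀ F, IsOpen {w : S | CV.evalP k V F w ≠ 0} := fun F =>
      isOpen_induced_iff.2 ⟨{w | CV.evalP k V F w ≠ 0}, TopologicalSpace.GenerateOpen.basic _ ⟨F, rfl⟩, rfl⟩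
    refine h p.length (fun i => CVI k V (Subtype.val '' (p.toFun (Fin.rev i)).carrier)) (fun i => ?_) ?_ ?_
    · set Z := p.toFun (Fin.rev i)
      have hZ := Z.isIrreducible'
      obtain ⟨w0, hw0⟩ := hZ.1
      refine Ideal.isPrime_iff.2 ⟨fun ht => ?_, fun {F G} hFG => ?_⟩
      · have h1 : (1 : MvPolynomial (Module.Free.ChooseBasisIndex k V) k) ∈ CVI k V (Subtype.val '' Z.carrier) := by rw [ht]; trivial
        have h2 := h1 w0.1 ⟨w0, hw0, rfl⟩
        simp [CV.evalP] at h2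
      · by_contra hcon
        push Not at hcon
        obtain ⟨hF, hG⟩ := hcon
        have aux : ∀ F, F ∉ CVI k V (Subtype.val '' Z.carrier) → (Z.carrier ∩ {w : S | CV.evalP k V F w ≠ 0}).Nonempty := by
          intro F hF
          by_contra hn
          apply hF
          rintro _ ⟨w, hw, rfl⟩
          by_contra h0
          exact hn ⟨w, hw, h0⟩
        obtain ⟨w, hw, h1, h2⟩ := hZ.2 _ _ (hop F) (hop G) (aux F hF) (aux G hG)
        have := hFG w.1 ⟨w, hw, rfl⟩
        rw [CVev_mul] at this
        exact mul_ne_zero h1 h2 this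
    · intro i j hij
      have hlt : p.toFun (Fin.rev j) < p.toFun (Fin.rev i) := p.strictMono (Fin.rev_lt_rev.2 hij)
      set Z := p.toFun (Fin.rev j)
      set Z' := p.toFun (Fin.rev i)
      obtain ⟨w, hw, hw'⟩ := SetLike.exists_of_lt hlt
      have hle : Z.carrier ⊆ Z'.carrier := hlt.le
      refine lt_of_le_of_ne ?_ ?_
      · intro F hF
        rintro _ ⟨v, hv, rfl⟩
        exact hF v.1 ⟨v, hle hv, rfl⟩
      · intro heq
        obtain ⟨U, hU, hUe⟩ := isOpen_induced_iff.1 Z.isClosed'.isOpen_compl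
        have hwU : w.1 ∈ U := by
          have : w ∈ Subtype.val ⁻¹' U := by rw [hUe]; exact hw'
          exact this
        obtain ⟨F, h1, h2⟩ := CVzar_basis k V hU hwU
        have hF : F ∈ CVI k V (Subtype.val '' Z.carrier) := by
          rintro _ ⟨v, hv, rfl⟩
          by_contra h0
          have : v ∈ Subtype.val ⁻¹' U := h2 _ h0
          rw [hUe] at this
          exact this hv
        have heq' : CVI k V (Subtype.val '' Z'.carrier) = CVI k V (Subtype.val '' Z.carrier) := heq
        rw [← heq'] at hF
        exact h1 (hF w.1 ⟨w, hw, rfl⟩)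
    · intro F hF
      rintro _ ⟨v, hv, rfl⟩
      exact hF v.1 v.2
  change Order.krullDim (TopologicalSpace.IrreducibleCloseds S) + _ ≤ _
  rcases isEmpty_or_nonempty (TopologicalSpace.IrreducibleCloseds S) with he | hne
  · rw [Order.krullDim_eq_bot]; simp
  · obtain ⟨a⟩ := hne
    have hc : c ≤ N := by
      have := key (RelSeries.singleton _ a)
      omega
    have h1 : Order.krullDim (TopologicalSpace.IrreducibleCloseds S) ≤ (((N - c : ℕ) : ℕ∞) : WithBot ℕ∞) := by
      refine iSup_le fun p => ?_
      have := key p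
      have h2 : p.length ≤ N - c := by omega
      exact_mod_cast h2
    refine (add_le_add_left h1 _).trans ?_
    have : N - c + c ≤ N := by omega
    exact_mod_cast this
end

end

section
open Module LieAlgebra
open scoped TensorProduct

section
variable (k g : Type*) [Field k] [LieRing g] [LieAlgebra k g] [FiniteDimensional k g]

local notation "bb" => Module.Free.chooseBasis k (g × g)
local notation "cc" => Module.finBasis k g

/-- coordinates of the bracket -/
def CVF (l : Fin (finrank k g)) : MvPolynomial (Module.Free.ChooseBasisIndex k (g × g)) k :=
  ∑ i, ∑ j, MvPolynomial.C ((cc).repr ⁅((bb) i).1, ((bb) j).2⁆ l) * MvPolynomial.X i * MvPolynomial.X j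

theorem CVsum1 (w : g × g) : w.1 = ∑ i, CV.coordFn k (g × g) w i • ((bb) i).1 := by
  conv_lhs => rw [← (bb).sum_repr w, Prod.fst_sum]
  rfl

theorem CVsum2 (w : g × g) : w.2 = ∑ i, CV.coordFn k (g × g) w i • ((bb) i).2 := by
  conv_lhs => rw [← (bb).sum_repr w, Prod.snd_sum]
  rfl

theorem CVF_aeval {A : Type*} [CommRing A] [Algebra k A] (z : Module.Free.ChooseBasisIndex k (g × g) → A) (l) :
    MvPolynomial.aeval z (CVF k g l) = ∑ i, ∑ j, algebraMap k A ((cc).repr ⁅((bb) i).1, ((bb) j).2⁆ l) * z i * z j := by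
  simp [CVF, map_sum]

theorem CVrep_l (l : Fin (finrank k g)) (x y : g) (w w' : Module.Free.ChooseBasisIndex k (g × g) → k) (u v : Module.Free.ChooseBasisIndex k (g × g) → g)
    (hx : x = ∑ i, w i • u i) (hy : y = ∑ i, w' i • v i) :
    (cc).repr ⁅x, y⁆ l = ∑ i, ∑ j, (cc).repr ⁅u i, v j⁆ l * w i * w' j := by
  rw [hx, hy, sum_lie, map_sum, Finsupp.finsetSum_apply]
  refine Finset.sum_congr rfl fun i _ => ?_
  rw [lie_sum, map_sum, Finsupp.finsetSum_apply]
  refine Finset.sum_congr rfl fun j _ => ?_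
  rw [smul_lie, lie_smul, map_smul, map_smul, Finsupp.smul_apply, Finsupp.smul_apply, smul_eq_mul, smul_eq_mul]
  ring

theorem CVF_ev (l) (w : g × g) : CV.evalP k (g × g) (CVF k g l) w = (cc).repr ⁅w.1, w.2⁆ l := by
  rw [CV.evalP, CVF_aeval, CVrep_l k g l _ _ _ _ _ _ (CVsum1 k g w) (CVsum2 k g w)]
  rfl

theorem CVF_diff (l) (w p : g × g) : CV.diffAt k (g × g) (CVF k g l) w p = (cc).repr (⁅p.1, w.2⁆ + ⁅w.1, p.2⁆) l := by
  classical
  let f : (g × g) →ₗ[k] k := (cc).coord l ∘ₗ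
    ((-ad k g w.2) ∘ₗ LinearMap.fst k g g + (ad k g w.1) ∘ₗ LinearMap.snd k g g)
  have hf : ∀ p, f p = (cc).repr (⁅p.1, w.2⁆ + ⁅w.1, p.2⁆) l := by
    intro p
    simp [f]
  rw [← hf]
  congr 1
  refine (bb).ext fun q => ?_
  rw [hf, CV.diffAt, Basis.constr_basis, CV.evalP, CVF]
  have h1 : ∀ q : Module.Free.ChooseBasisIndex k (g × g), (cc).repr ⁅((bb) q).1, w.2⁆ l = ∑ j, (cc).repr ⁅((bb) q).1, ((bb) j).2⁆ l * CV.coordFn k (g × g) w j := by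
    intro q
    conv_lhs => rw [CVsum2 k g w, lie_sum, map_sum, Finsupp.finsetSum_apply]
    refine Finset.sum_congr rfl fun j _ => ?_
    rw [lie_smul, map_smul, Finsupp.smul_apply, smul_eq_mul, mul_comm]
  have h2 : (cc).repr ⁅w.1, ((bb) q).2⁆ l = ∑ j, (cc).repr ⁅((bb) j).1, ((bb) q).2⁆ l * CV.coordFn k (g × g) w j := by
    conv_lhs => rw [CVsum1 k g w, sum_lie, map_sum, Finsupp.finsetSum_apply]
    refine Finset.sum_congr rfl fun j _ => ?_
    rw [smul_lie, map_smul, Finsupp.smul_apply, smul_eq_mul, mul_comm]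
  rw [map_add, Finsupp.add_apply, h1, h2]
  simp only [map_sum, Derivation.leibniz, MvPolynomial.pderiv_C, MvPolynomial.pderiv_X, smul_eq_mul, map_add, map_mul, MvPolynomial.aeval_X, MvPolynomial.aeval_C, Algebra.algebraMap_self, RingHom.id_apply, smul_zero, mul_zero, add_zero, map_zero, zero_add, Pi.single_apply]
  simp only [Finset.sum_add_distrib, apply_ite (MvPolynomial.aeval _), map_one, map_zero, mul_ite, mul_one, mul_zero]
  rw [add_comm]
  congr 1
  · rw [Finset.sum_comm]
    simp [mul_comm]
  · simp

variable [IsKilling k g]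

theorem CVtan {r : ℕ} (w : g × g) (hw : finrank k g + r < finrank k (CV.tangent k (g × g) (commSet k g) w)) :
    r < finrank k (LinearMap.ker (phi k w.1 w.2)) := by
  let ψ : (g × g) →ₗ[k] g := (-ad k g w.2) ∘ₗ LinearMap.fst k g g + (ad k g w.1) ∘ₗ LinearMap.snd k g g
  have hψ : ∀ p, ψ p = ⁅p.1, w.2⁆ + ⁅w.1, p.2⁆ := by
    intro p; simp [ψ]
  have h1 : CV.tangent k (g × g) (commSet k g) w ≤ LinearMap.ker ψ := by
    intro p hp
    rw [LinearMap.mem_ker]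
    apply (cc).ext_elem
    intro l
    rw [hψ, ← CVF_diff, map_zero, Finsupp.zero_apply]
    simp only [CV.tangent, Submodule.mem_iInf, Set.mem_setOf_eq, LinearMap.mem_ker] at hp
    apply hp
    intro v hv
    rw [CVF_ev]
    have : ⁅v.1, v.2⁆ = 0 := hv
    rw [this, map_zero, Finsupp.zero_apply]
  have h2 := Submodule.finrank_mono h1
  have h3 := LinearMap.finrank_range_add_finrank_ker ψ
  rw [Module.finrank_prod] at h3
  let θ : g →ₗ[k] Dual k (g × g) := ψ.dualMap ∘ₗ killingForm k g
  have h4 : LinearMap.ker θ ≤ LinearMap.ker (phi k w.1 w.2) := by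
    intro c hc
    have h5 : ∀ p, killingForm k g c (ψ p) = 0 := fun p => LinearMap.congr_fun hc p
    rw [LinearMap.mem_ker]
    have a1 : ⁅w.1, c⁆ = 0 := by
      refine CVknd (K := k) _ fun v => ?_
      have := h5 (0, v)
      rw [hψ] at this
      rw [← lie_skew, map_neg, LinearMap.neg_apply, CVkinv]
      simpa using this
    have a2 : ⁅w.2, c⁆ = 0 := by
      refine CVknd (K := k) _ fun v => ?_
      have := h5 (v, 0)
      rw [hψ] at this
      have h9 : killingForm k g c ⁅v, w.2⁆ = 0 := by simpa using this
      rw [← lie_skew, map_neg, neg_eq_zero] at h9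
      rw [← lie_skew, map_neg, LinearMap.neg_apply, CVkinv, h9, neg_zero]
    simp [phi, a1, a2]
  have h6 := Submodule.finrank_mono h4
  have h7 := LinearMap.finrank_range_add_finrank_ker θ
  have h8 : finrank k (LinearMap.range θ) ≤ finrank k (LinearMap.range ψ) := by
    rw [← LinearMap.finrank_range_dualMap_eq_finrank_range ψ]
    exact Submodule.finrank_mono (LinearMap.range_comp_le_range _ _)
  omega

/-- The generic matrix of `phi`. -/
def CVM : Matrix (Fin (finrank k g) ⊕ Fin (finrank k g)) (Fin (finrank k g)) (MvPolynomial (Module.Free.ChooseBasisIndex k (g × g)) k) :=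
  Matrix.of fun a e => a.elim
    (fun a => - ∑ i, MvPolynomial.C ((cc).repr ⁅((bb) i).1, (cc) e⁆ a) * MvPolynomial.X i)
    (fun a => - ∑ i, MvPolynomial.C ((cc).repr ⁅((bb) i).2, (cc) e⁆ a) * MvPolynomial.X i)

theorem CVM_det {B : Type*} [CommRing B] [Algebra k B] {r : ℕ} (f : Fin r → Fin (finrank k g) ⊕ Fin (finrank k g)) (e : Fin r → Fin (finrank k g))
    (y : Module.Free.ChooseBasisIndex k (g × g) → B) :
    (((CVM k g).map (MvPolynomial.aeval y)).submatrix f e).det = MvPolynomial.aeval y (((CVM k g).submatrix f e).det) := by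
  rw [AlgHom.map_det]; rfl

theorem CVM_k (w : g × g) : ((CVM k g).map (MvPolynomial.aeval (CV.coordFn k (g × g) w))).rank + finrank k (LinearMap.ker (phi k w.1 w.2)) = finrank k g := by
  refine CVrk (cc) _ _ _ (fun a e => ?_) (fun a e => ?_)
  · conv_rhs => rw [CVsum1 k g w, sum_lie, map_sum, Finsupp.finsetSum_apply]
    simp [CVM, mul_comm]
  · conv_rhs => rw [CVsum2 k g w, sum_lie, map_sum, Finsupp.finsetSum_apply]
    simp [CVM, mul_comm]

theorem CVM_K {K : Type*} [Field K] [Algebra k K] (z : Module.Free.ChooseBasisIndex k (g × g) → K) :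
    ((CVM k g).map (MvPolynomial.aeval z)).rank + finrank K (LinearMap.ker (phi K (∑ i, z i ⊗ₜ[k] ((bb) i).1) (∑ i, z i ⊗ₜ[k] ((bb) i).2))) = finrank k g := by
  have h : ∀ (u v : g) (a : K) l, ((cc).baseChange K).repr ⁅a ⊗ₜ[k] u, ((1 : K) ⊗ₜ[k] v)⁆ l = algebraMap k K ((cc).repr ⁅u, v⁆ l) * a := by
    intro u v a l
    rw [LieAlgebra.ExtendScalars.bracket_tmul, mul_one, Basis.baseChange_repr_tmul, Algebra.smul_def]
  refine (CVrk ((cc).baseChange K) _ _ _ (fun a e => ?_) (fun a e => ?_)).trans (Module.finrank_baseChange ..)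
  · rw [sum_lie, map_sum, Finsupp.finsetSum_apply, Basis.baseChange_apply]
    simp [CVM, h, Algebra.smul_def]
  · rw [sum_lie, map_sum, Finsupp.finsetSum_apply, Basis.baseChange_apply]
    simp [CVM, h, Algebra.smul_def]
end

section
variable (k : Type*) [Field k] [IsAlgClosed k] [CharZero k]
variable (g : Type*) [LieRing g] [LieAlgebra k g] [FiniteDimensional k g]
local notation "bb" => Module.Free.chooseBasis k (g × g)
local notation "cc" => Module.finBasis k g

theorem CVfinal [LieAlgebra.IsSimple k g] [LieAlgebra.IsKilling k g]
    (t : LieSubalgebra k g) [t.IsCartanSubalgebra] :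
    CV.dimSet k (g × g) (Csing k g t) + ((5 - lacety k g t : ℕ) : ℕ∞)
      ≤ (((Module.finrank k g + Module.finrank k ↥t : ℕ) : ℕ∞) : WithBot ℕ∞) := by
  apply CVgeo
  intro m P hP hmono hS
  obtain ⟨s, hs⟩ := CVchain (k := k) m P hP hmono
  haveI := hP 0
  let A := MvPolynomial (Module.Free.ChooseBasisIndex k (g × g)) k ⧸ P 0
  let K := AlgebraicClosure (FractionRing A)
  let z : Module.Free.ChooseBasisIndex k (g × g) → K := fun i => algebraMap A K (Ideal.Quotient.mk (P 0) (MvPolynomial.X i))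
  have hinj : Function.Injective (algebraMap A K) := by
    rw [IsScalarTower.algebraMap_eq A (FractionRing A) K]
    exact (algebraMap (FractionRing A) K).injective.comp (IsFractionRing.injective A (FractionRing A))
  have hz : ∀ F : MvPolynomial (Module.Free.ChooseBasisIndex k (g × g)) k, MvPolynomial.aeval z F = algebraMap A K (Ideal.Quotient.mk (P 0) F) := by
    intro F
    have : (MvPolynomial.aeval z : _ →ₐ[k] K) = (IsScalarTower.toAlgHom k A K).comp (Ideal.Quotient.mkₐ k (P 0)) := by
      ext i
      simp [z]
      rfl
    rw [this]; rfl
  have hz0 : ∀ F : MvPolynomial (Module.Free.ChooseBasisIndex k (g × g)) k, MvPolynomial.aeval z F = 0 ↔ F ∈ P 0 := by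
    intro F
    rw [hz, map_eq_zero_iff _ hinj, Ideal.Quotient.eq_zero_iff_mem]
  have hai : AlgebraicIndependent k fun j => MvPolynomial.aeval z (s j) := by
    rw [algebraicIndependent_iff]
    intro F hF
    apply hs
    rw [← hz0, ← hF]
    change ((MvPolynomial.aeval z : _ →ₐ[k] K).comp (MvPolynomial.aeval s)) F = _
    congr 1
    ext i
    simp
  have hTT := CVTTge (bb) z s hai
  have hxy : ⁅∑ i, z i ⊗ₜ[k] ((bb) i).1, ∑ i, z i ⊗ₜ[k] ((bb) i).2⁆ = 0 := by
    apply ((cc).baseChange K).ext_elem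
    intro l
    have h1 : CVF k g l ∈ P 0 := by
      apply hS
      intro w hw
      rw [CVF_ev]
      have : ⁅w.1, w.2⁆ = 0 := hw.1
      rw [this, map_zero, Finsupp.zero_apply]
    rw [← hz0, CVF_aeval] at h1
    rw [map_zero, Finsupp.zero_apply, ← h1, sum_lie, map_sum, Finsupp.finsetSum_apply]
    refine Finset.sum_congr rfl fun i _ => ?_
    rw [lie_sum, map_sum, Finsupp.finsetSum_apply]
    refine Finset.sum_congr rfl fun j _ => ?_
    rw [LieAlgebra.ExtendScalars.bracket_tmul, Basis.baseChange_repr_tmul, Algebra.smul_def, mul_assoc]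
  have hker : finrank k t < finrank K (LinearMap.ker (phi K (∑ i, z i ⊗ₜ[k] ((bb) i).1) (∑ i, z i ⊗ₜ[k] ((bb) i).2))) := by
    by_contra hcon
    have hM := CVM_K k g z
    have htg : finrank k t ≤ finrank k g := Submodule.finrank_le t.toSubmodule
    obtain ⟨f, e, hdet⟩ := CVminor ((CVM k g).map (MvPolynomial.aeval z)) (r := finrank k g - finrank k t) (by omega)
    apply hdet
    rw [CVM_det, hz0]
    apply hS
    intro w hw
    have hw2 := CVtan k g w hw.2
    have hM2 := CVM_k k g w
    by_contra hne
    rw [CV.evalP, ← CVM_det] at hne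
    have h5 := Matrix.rank_of_det_ne_zero hne
    have h6 := Matrix.rank_submatrix_le ((CVM k g).map (MvPolynomial.aeval (CV.coordFn k (g × g) w))) f e
    rw [h5, Fintype.card_fin] at h6
    omega
  have := CVmainExt t K hxy hker
  omega
end

end

/-- For a simple Lie algebra `g`, the codimension in the commuting variety
`C` of the singular locus `C^sing` is at least `5 - l`, where `l` is the lacing number of
`g`:  `dim C^sing + (5 - l) ≤ dim C = dim g + rk g`. -/
theorem singular_codim_ge_five_sub_lacety
    [LieAlgebra.IsSimple k g] [LieAlgebra.IsKilling k g]
    (t : LieSubalgebra k g) [t.IsCartanSubalgebra] :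
    CV.dimSet k (g × g) (Csing k g t) + ((5 - lacety k g t : ℕ) : ℕ∞)
      ≤ (((Module.finrank k g + Module.finrank k ↥t : ℕ) : ℕ∞) : WithBot ℕ∞) := by
  exact CVfinal k g t
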